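/- A(1/9;n) ∼ 4√2·sin(π/9)·cosh(5π√(8n−1)/36)/√(8n−1) as n → ∞; that is, the quotient A(1/9;n)·√(8n−1)/(4√2·sin(π/9)·cosh(5π√(8n−1)/36)) tends to 1 as n → ∞. -/

import Mathlib

open scoped Classical

/-- The M2-rank of a partition: ⌈ℓ/2⌉ − s, where ℓ is the largest part
(0 for the empty partition) and s is the number of parts. -/
def m2Rank {n : ℕ} (P : n.Partition) : ℤ :=
  (((P.parts.sup + 1) / 2 : ℕ) : ℤ) - (Multiset.card P.parts : ℤ)

/-- A partition has no repeated odd parts. -/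
def NoRepeatedOddParts {n : ℕ} (P : n.Partition) : Prop :=
  ∀ j : ℕ, Odd j → P.parts.count j ≤ 1

/-- `N2 r m n` is the number of partitions of `n` without repeated odd parts whose
M2-rank is congruent to `r` modulo `m`. -/
noncomputable def N2 (r : ℤ) (m n : ℕ) : ℕ :=
  Nat.card {P : n.Partition // NoRepeatedOddParts P ∧ m2Rank P ≡ r [ZMOD (m : ℤ)]}

/-- `Acoef a c n = Σ_{r=0}^{c−1} N2(r,c,n)·e^{2πiar/c}`, the coefficient of `q^n`
in the M2-rank generating function `R2(e^{2πia/c};q)`. -/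
noncomputable def Acoef (a : ℤ) (c n : ℕ) : ℂ :=
  ∑ r ∈ Finset.range c,
    (N2 (r : ℤ) c n : ℂ) * Complex.exp (2 * Real.pi * Complex.I * (a : ℂ) * (r : ℂ) / (c : ℂ))

section Part1
/-- valid multisets of parts -/
def Vld (s : Multiset ℕ) : Prop := 0 ∉ s ∧ ∀ j, Odd j → s.count j ≤ 1

/-- M2-rank for multisets -/
def mrk (s : Multiset ℕ) : ℤ := (((s.sup + 1) / 2 : ℕ) : ℤ) - (Multiset.card s : ℤ)

noncomputable def dphi (r : ℤ) (s : Multiset ℕ) : Multiset ℕ :=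
  (s.erase s.sup).map (· + 2) + Multiset.replicate (mrk s - r).toNat 2 +
    (if Even s.sup then {1} else 0)

noncomputable def dpart (r : ℤ) (u : Multiset ℕ) : ℕ :=
  (if 1 ∈ u then 2 * ((Multiset.card u : ℤ) + r) else 2 * ((Multiset.card u : ℤ) + r) + 1).toNat

noncomputable def dpsi (r : ℤ) (u : Multiset ℕ) : Multiset ℕ :=
  dpart r u ::ₘ ((u.filter (3 ≤ ·)).map (· - 2))

def DDom (r : ℤ) (s : Multiset ℕ) : Prop := Vld s ∧ s ≠ 0 ∧ r ≤ mrk s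
def DCod (r : ℤ) (u : Multiset ℕ) : Prop := Vld u ∧ mrk u ≤ r + 1 ∧
  (if 1 ∈ u then 1 ≤ (Multiset.card u : ℤ) + r else 0 ≤ (Multiset.card u : ℤ) + r)

lemma msup_mem {s : Multiset ℕ} (h : s ≠ 0) : s.sup ∈ s := by
  induction s using Multiset.induction_on with
  | empty => exact absurd rfl h
  | cons a s ih =>
    rw [Multiset.sup_cons]
    by_cases hs : s = 0
    · subst hs; simp
    · rcases le_total a s.sup with h1 | h1
      · rw [sup_eq_right.2 h1]; exact Multiset.mem_cons_of_mem (ih hs)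
      · rw [sup_eq_left.2 h1]; exact Multiset.mem_cons_self _ _

lemma one_mem_dphi {r : ℤ} {s : Multiset ℕ} (hs : Vld s) : 1 ∈ dphi r s ↔ Even s.sup := by
  unfold dphi
  simp only [Multiset.mem_add, Multiset.mem_map, Multiset.mem_replicate]
  constructor
  · rintro ((⟨a, _, h⟩ | ⟨_, h⟩) | h)
    · omega
    · omega
    · by_contra hc; simp [hc] at h
  · intro h; right; simp [h]

lemma card_dphi {r : ℤ} {s : Multiset ℕ} (hs : DDom r s) :
    (Multiset.card (dphi r s) : ℤ) + r = (((s.sup + 1) / 2 : ℕ) : ℤ) - (if Even s.sup then 0 else 1) := by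
  obtain ⟨h1, h2, h3⟩ := hs
  have hm := msup_mem h2
  have hc : Multiset.card (s.erase s.sup) + 1 = Multiset.card s := Multiset.card_erase_add_one hm
  unfold dphi
  have : ((mrk s - r).toNat : ℤ) = mrk s - r := Int.toNat_of_nonneg (by omega)
  split_ifs <;> simp only [Multiset.card_add, Multiset.card_map, Multiset.card_replicate, Multiset.card_singleton, Multiset.card_zero] <;> push_cast <;> unfold mrk at * <;> omega

lemma sum_map_add_two (s : Multiset ℕ) : (s.map (· + 2)).sum = s.sum + 2 * Multiset.card s := by
  induction s using Multiset.induction_on with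
  | empty => simp
  | cons a s ih => simp [ih]; ring

lemma sum_dphi {r : ℤ} {s : Multiset ℕ} (hs : DDom r s) :
    ((dphi r s).sum : ℤ) = s.sum - 2 * r - 1 := by
  obtain ⟨h1, h2, h3⟩ := hs
  have hm := msup_mem h2
  have hc : Multiset.card (s.erase s.sup) + 1 = Multiset.card s := Multiset.card_erase_add_one hm
  have hsum : s.sup + (s.erase s.sup).sum = s.sum := Multiset.sum_erase hm
  have : ((mrk s - r).toNat : ℤ) = mrk s - r := Int.toNat_of_nonneg (by omega)
  unfold dphi
  split_ifs with h <;>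
    simp only [Multiset.sum_add, sum_map_add_two, Multiset.sum_replicate, Multiset.sum_singleton, Multiset.sum_zero, smul_eq_mul] <;> unfold mrk at * <;> [skip; rw [Nat.not_even_iff_odd] at h] <;> obtain ⟨k, hk⟩ := h <;> omega

lemma dpart_dphi {r : ℤ} {s : Multiset ℕ} (hs : DDom r s) : dpart r (dphi r s) = s.sup := by
  unfold dpart
  have h1 := one_mem_dphi (r := r) hs.1
  have h2 := card_dphi hs
  by_cases h : Even s.sup
  · rw [if_pos (h1.2 h)]; rw [if_pos h] at h2; obtain ⟨k, hk⟩ := h; omega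
  · rw [if_neg (fun hh => h (h1.1 hh))]; rw [if_neg h] at h2; rw [Nat.not_even_iff_odd] at h; obtain ⟨k, hk⟩ := h; omega

lemma dpsi_dphi {r : ℤ} {s : Multiset ℕ} (hs : DDom r s) : dpsi r (dphi r s) = s := by
  unfold dpsi
  rw [dpart_dphi hs]
  have : (dphi r s).filter (3 ≤ ·) = (s.erase s.sup).map (· + 2) := by
    unfold dphi
    rw [Multiset.filter_add, Multiset.filter_add]
    have e1 : ((s.erase s.sup).map (· + 2)).filter (3 ≤ ·) = (s.erase s.sup).map (· + 2) := by
      rw [Multiset.filter_eq_self]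
      intro a ha
      obtain ⟨b, hb, rfl⟩ := Multiset.mem_map.1 ha
      have : b ≠ 0 := fun h => hs.1.1 (h ▸ Multiset.mem_of_mem_erase hb)
      omega
    have e2 : (Multiset.replicate (mrk s - r).toNat 2).filter (3 ≤ ·) = 0 := by
      rw [Multiset.filter_eq_nil]
      intro a ha
      rw [Multiset.eq_of_mem_replicate ha]; omega
    rw [e1, e2]
    split_ifs <;> simp
  rw [this, Multiset.map_map]
  simp only [Function.comp_def, Nat.add_sub_cancel, Multiset.map_id']
  exact Multiset.cons_erase (msup_mem hs.2.1)

lemma dphi_mem {r : ℤ} {s : Multiset ℕ} (hs : DDom r s) : DCod r (dphi r s) := by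
  have hc := card_dphi hs
  have h1 := one_mem_dphi (r := r) hs.1
  have hm := msup_mem hs.2.1
  have hpos : 1 ≤ s.sup := by
    rcases Nat.eq_zero_or_pos s.sup with h | h
    · rw [h] at hm; exact absurd hm hs.1.1
    · exact h
  refine ⟨⟨?_, ?_⟩, ?_, ?_⟩
  · unfold dphi
    simp only [Multiset.mem_add, Multiset.mem_map, Multiset.mem_replicate]
    rintro ((⟨a, _, h⟩ | ⟨_, h⟩) | h)
    · omega
    · omega
    · split_ifs at h <;> simp at h
  · intro j hj
    unfold dphi
    have hj2 : j ≠ 2 := by rintro rfl; revert hj; decide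
    simp only [Multiset.count_add, Multiset.count_replicate]
    rw [if_neg (Ne.symm hj2)]
    by_cases hj1 : j = 1
    · subst hj1
      have : Multiset.count 1 ((s.erase s.sup).map (· + 2)) = 0 := by
        rw [Multiset.count_eq_zero]
        simp
      rw [this]
      split_ifs <;> simp
    · obtain ⟨k, rfl⟩ : ∃ k, j = k + 2 := ⟨j - 2, by have := hj.pos; omega⟩
      rw [Multiset.count_map_eq_count' (· + 2) _ (add_left_injective 2)]
      have e : Multiset.count (k + 2) (if Even s.sup then ({1} : Multiset ℕ) else 0) = 0 := by
        rw [Multiset.count_eq_zero]; split_ifs <;> simp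
      rw [e]
      have : Odd k := by
        rcases hj with ⟨m, hm⟩
        exact ⟨m - 1, by omega⟩
      exact (Multiset.count_le_of_le _ (Multiset.erase_le _ _)).trans (hs.1.2 k this)
  · have key : ∀ x ∈ dphi r s, x ≤ 2 * (((s.sup + 1) / 2 + (if Even s.sup then 1 else 0))) := by
      intro x hx
      unfold dphi at hx
      simp only [Multiset.mem_add, Multiset.mem_map, Multiset.mem_replicate] at hx
      rcases hx with ((⟨a, ha, rfl⟩ | ⟨_, rfl⟩) | h)
      · have ha' : a ≤ s.sup := Multiset.le_sup (Multiset.mem_of_mem_erase ha)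
        split_ifs with he
        · omega
        · have hne : a ≠ s.sup := by
            rintro rfl
            have := hs.1.2 _ (Nat.not_even_iff_odd.1 he)
            have h2 := Multiset.count_pos.2 ha
            rw [Multiset.count_erase_self] at h2
            omega
          rw [Nat.not_even_iff_odd] at he
          obtain ⟨k, hk⟩ := he
          omega
      · omega
      · split_ifs at h ⊢ <;> simp at h; omega
    have := Multiset.sup_le.2 key
    unfold mrk
    split_ifs at this hc <;> omega
  · split_ifs with h
    · rw [h1] at h; rw [hc, if_pos h]; obtain ⟨k, hk⟩ := h; omega
    · rw [h1] at h; rw [hc, if_neg h]; omega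

lemma dpart_cast {r : ℤ} {u : Multiset ℕ} (hu : DCod r u) : (dpart r u : ℤ) =
    if 1 ∈ u then 2 * ((Multiset.card u : ℤ) + r) else 2 * ((Multiset.card u : ℤ) + r) + 1 := by
  have := hu.2.2
  unfold dpart
  split_ifs at this ⊢ <;> omega

lemma decomp_u {u : Multiset ℕ} (hu : Vld u) :
    u.filter (3 ≤ ·) + Multiset.replicate (u.count 2) 2 + (if 1 ∈ u then {1} else 0) = u := by
  ext j
  simp only [Multiset.count_add, Multiset.count_replicate, Multiset.count_filter]
  have h0 : u.count 0 = 0 := Multiset.count_eq_zero.2 hu.1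
  have h1 := hu.2 1 (by decide)
  by_cases hm : 1 ∈ u
  · have := Multiset.count_pos.2 hm
    simp only [hm, if_true, Multiset.count_singleton]
    split_ifs <;> subst_vars <;> try omega
    obtain rfl : j = 0 := by omega
    omega
  · have := Multiset.count_eq_zero.2 hm
    simp only [hm, if_false, Multiset.count_zero]
    split_ifs <;> subst_vars <;> try omega
    have : j = 0 ∨ j = 1 := by omega
    rcases this with rfl | rfl <;> omega

lemma card_u {u : Multiset ℕ} (hu : Vld u) :
    Multiset.card (u.filter (3 ≤ ·)) + u.count 2 + (if 1 ∈ u then 1 else 0) = Multiset.card u := by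
  conv_rhs => rw [← decomp_u hu]
  split_ifs <;> simp

lemma sup_dpsi {r : ℤ} {u : Multiset ℕ} (hu : DCod r u) : (dpsi r u).sup = dpart r u := by
  unfold dpsi
  rw [Multiset.sup_cons]
  apply sup_eq_left.2
  rw [Multiset.sup_le]
  intro x hx
  obtain ⟨y, hy, rfl⟩ := Multiset.mem_map.1 hx
  have hy2 : y ≤ u.sup := Multiset.le_sup (Multiset.mem_of_mem_filter hy)
  have h2 := hu.2.1
  have h3 := dpart_cast hu
  unfold mrk at h2
  split_ifs at h3 <;> omega

lemma mrk_dpsi {r : ℤ} {u : Multiset ℕ} (hu : DCod r u) : mrk (dpsi r u) = r + u.count 2 := by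
  have h := card_u hu.1
  have h3 := dpart_cast hu
  unfold mrk
  rw [sup_dpsi hu]
  unfold dpsi
  simp only [Multiset.card_cons, Multiset.card_map]
  split_ifs at h h3 <;> omega

lemma dphi_dpsi {r : ℤ} {u : Multiset ℕ} (hu : DCod r u) : dphi r (dpsi r u) = u := by
  conv_rhs => rw [← decomp_u hu.1]
  unfold dphi
  rw [sup_dpsi hu, mrk_dpsi hu]
  congr 1
  · congr 1
    · unfold dpsi
      rw [Multiset.erase_cons_head, Multiset.map_map]
      conv_rhs => rw [← Multiset.map_id (u.filter (3 ≤ ·))]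
      apply Multiset.map_congr rfl
      intro x hx
      have := (Multiset.mem_filter.1 hx).2
      simp only [Function.comp, id]; omega
    · congr 1; omega
  · have h3 := dpart_cast hu
    by_cases h : 1 ∈ u
    · rw [if_pos h] at *
      rw [if_pos]
      have : (Even (dpart r u : ℤ)) := by rw [h3]; exact even_two_mul _
      exact_mod_cast this
    · rw [if_neg h] at *
      rw [if_neg]
      have : (Odd (dpart r u : ℤ)) := by rw [h3]; exact odd_two_mul_add_one _
      rw [Nat.not_even_iff_odd]
      exact_mod_cast this

lemma dpsi_mem {r : ℤ} {u : Multiset ℕ} (hu : DCod r u) : DDom r (dpsi r u) := by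
  have h2 := hu.2.1
  have h3 := dpart_cast hu
  have h4 := hu.2.2
  unfold mrk at h2
  refine ⟨⟨?_, ?_⟩, ?_, ?_⟩
  · unfold dpsi
    rw [Multiset.mem_cons]
    rintro (h | h)
    · rw [← h] at h3; split_ifs at h3 h4 <;> omega
    · obtain ⟨y, hy, hh⟩ := Multiset.mem_map.1 h
      have := (Multiset.mem_filter.1 hy).2
      omega
  · intro j hj
    unfold dpsi
    have e : Multiset.count j ((u.filter (3 ≤ ·)).map (· - 2)) ≤ u.count (j + 2) := by
      have : Multiset.count j ((u.filter (3 ≤ ·)).map (· - 2)) =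
        Multiset.count (j + 2) (((u.filter (3 ≤ ·)).map (· - 2)).map (· + 2)) := by
        rw [Multiset.count_map_eq_count' (· + 2) _ (add_left_injective 2)]
      rw [this, Multiset.map_map]
      have e2 : (u.filter (3 ≤ ·)).map ((· + 2) ∘ (· - 2)) = u.filter (3 ≤ ·) := by
        conv_rhs => rw [← Multiset.map_id (u.filter (3 ≤ ·))]
        apply Multiset.map_congr rfl
        intro x hx
        have := (Multiset.mem_filter.1 hx).2
        simp only [Function.comp, id]; omega
      rw [e2]
      exact Multiset.count_le_of_le _ (Multiset.filter_le _ _)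
    have hj2 : Odd (j + 2) := by obtain ⟨m, hm⟩ := hj; exact ⟨m + 1, by omega⟩
    have e3 := hu.1.2 (j + 2) hj2
    rw [Multiset.count_cons]
    split_ifs with hjd
    · have : u.count (j + 2) = 0 := by
        rw [Multiset.count_eq_zero]
        intro hmem
        have := Multiset.le_sup hmem
        obtain ⟨m, hm⟩ := hj
        split_ifs at h3 <;> omega
      omega
    · omega
  · unfold dpsi; exact Multiset.cons_ne_zero
  · rw [mrk_dpsi hu]; omega

noncomputable def dysonEquiv (r : ℤ) : {s // DDom r s} ≃ {u // DCod r u} where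
  toFun s := ⟨dphi r s.1, dphi_mem s.2⟩
  invFun u := ⟨dpsi r u.1, dpsi_mem u.2⟩
  left_inv s := Subtype.ext (dpsi_dphi s.2)
  right_inv u := Subtype.ext (dphi_dpsi u.2)

lemma dcod_nonneg {r : ℤ} (hr : 0 ≤ r) (u : Multiset ℕ) : DCod r u ↔ Vld u ∧ mrk u ≤ r + 1 := by
  unfold DCod
  constructor
  · rintro ⟨a, b, _⟩; exact ⟨a, b⟩
  · rintro ⟨a, b⟩
    refine ⟨a, b, ?_⟩
    split_ifs with h
    · have := Multiset.card_pos_iff_exists_mem.2 ⟨1, h⟩; omega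
    · omega

lemma dcod_neg {a : ℤ} (ha : 1 ≤ a) (u : Multiset ℕ) :
    (Vld u ∧ mrk u ≤ -a) ↔ (DCod (-a-1) u ∨ u = 1 ::ₘ Multiset.replicate a.toNat 2) := by
  constructor
  · rintro ⟨h1, h2⟩
    have hne : u ≠ 0 := by rintro rfl; simp [mrk] at h2; omega
    have hm := msup_mem hne
    have hpos : 1 ≤ u.sup := by
      rcases Nat.eq_zero_or_pos u.sup with h | h
      · rw [h] at hm; exact absurd hm h1.1
      · exact h
    have h2' := h2
    unfold mrk at h2'
    by_cases h : 1 ∈ u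
    · by_cases hc : 1 ≤ (Multiset.card u : ℤ) + (-a-1)
      · left; exact ⟨h1, by omega, by rw [if_pos h]; exact hc⟩
      · right
        have hsup : u.sup ≤ 2 := by omega
        have hd := decomp_u h1
        have hc2 := card_u h1
        have : u.filter (3 ≤ ·) = 0 := by
          rw [Multiset.filter_eq_nil]
          intro x hx; have := Multiset.le_sup hx; omega
        rw [this, if_pos h] at hd hc2
        rw [← hd]
        simp only [Multiset.card_zero] at hc2
        rw [show u.count 2 = a.toNat by omega, zero_add, add_comm, Multiset.singleton_add]
    · left; exact ⟨h1, by omega, by rw [if_neg h]; omega⟩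
  · rintro (h | h)
    · exact ⟨h.1, by have := h.2.1; omega⟩
    · subst h
      refine ⟨⟨?_, ?_⟩, ?_⟩
      · simp [Multiset.mem_replicate]
      · intro j hj
        have hj2 : j ≠ 2 := by rintro rfl; revert hj; decide
        rw [Multiset.count_cons, Multiset.count_replicate, if_neg (Ne.symm hj2)]
        split_ifs <;> omega
      · unfold mrk
        have : (1 ::ₘ Multiset.replicate a.toNat 2).sup ≤ 2 := by
          rw [Multiset.sup_le]; intro x hx
          simp [Multiset.mem_replicate] at hx; omega
        simp only [Multiset.card_cons, Multiset.card_replicate]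
        omega

lemma special_not_dcod {a : ℤ} (ha : 1 ≤ a) :
    ¬ DCod (-a-1) (1 ::ₘ Multiset.replicate a.toNat 2) := by
  rintro ⟨_, _, h⟩
  rw [if_pos (Multiset.mem_cons_self _ _)] at h
  simp only [Multiset.card_cons, Multiset.card_replicate] at h
  omega

lemma special_vld {a : ℤ} (ha : 1 ≤ a) : Vld (1 ::ₘ Multiset.replicate a.toNat 2) :=
  ((dcod_neg ha _).2 (Or.inr rfl)).1
end Part1

section Part2
/-- factor of the product -/
noncomputable def fac {K : Type*} [Field K] (q : K) (k : ℕ) : K := if Odd k then 1 + q ^ k else (1 - q ^ k)⁻¹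

abbrev VN (N : ℕ) : Type := {s : Multiset ℕ // Vld s ∧ ∀ x ∈ s, x ≤ N}
abbrev CN (N : ℕ) : Type := {c : ℕ // Odd N → c ≤ 1}

noncomputable def vnEquiv (N : ℕ) : VN (N + 1) ≃ VN N × CN (N + 1) where
  toFun s := (⟨s.1.filter (· ≤ N), ⟨fun h => s.2.1.1 (Multiset.mem_of_mem_filter h), fun j hj =>
      (Multiset.count_le_of_le _ (Multiset.filter_le _ _)).trans (s.2.1.2 j hj)⟩,
      fun x hx => (Multiset.mem_filter.1 hx).2⟩, ⟨s.1.count (N + 1), fun h => s.2.1.2 _ h⟩)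
  invFun p := ⟨p.1.1 + Multiset.replicate p.2.1 (N + 1), by
    obtain ⟨⟨s, ⟨h1, h2⟩, h3⟩, ⟨c, hc⟩⟩ := p
    refine ⟨⟨?_, ?_⟩, ?_⟩
    · simp [Multiset.mem_replicate, h1]
    · intro j hj
      rw [Multiset.count_add, Multiset.count_replicate]
      split_ifs with h
      · subst h
        have : Multiset.count (N + 1) s = 0 := by
          rw [Multiset.count_eq_zero]; intro hh; have := h3 _ hh; omega
        have := hc hj
        dsimp only; omega
      · simpa using h2 j hj
    · intro x hx
      simp only [Multiset.mem_add, Multiset.mem_replicate] at hx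
      rcases hx with h | h
      · exact (h3 x h).trans (Nat.le_succ _)
      · exact h.2.le⟩
  left_inv s := by
    apply Subtype.ext
    ext j
    obtain ⟨s, h1, h2⟩ := s
    simp only [Multiset.count_add, Multiset.count_replicate, Multiset.count_filter]
    split_ifs with h3 h4 h4
    · omega
    · rfl
    · subst h4; simp
    · symm; rw [zero_add, Multiset.count_eq_zero]
      intro hh; have := h2 _ hh; omega
  right_inv p := by
    obtain ⟨⟨s, ⟨h1, h2⟩, h3⟩, ⟨c, hc⟩⟩ := p
    apply Prod.ext
    · apply Subtype.ext
      simp only [Multiset.filter_add]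
      rw [Multiset.filter_eq_self.2 h3, Multiset.filter_eq_nil.2, add_zero]
      intro a ha; rw [Multiset.eq_of_mem_replicate ha]; omega
    · apply Subtype.ext
      simp only [Multiset.count_add, Multiset.count_replicate_self]
      have : Multiset.count (N + 1) s = 0 := by
        rw [Multiset.count_eq_zero]; intro hh; have := h3 _ hh; omega
      omega

lemma hasSum_CN {q : ℂ} (hq : ‖q‖ < 1) {N : ℕ} (hN : N ≠ 0) :
    HasSum (fun c : CN N => q ^ (N * c.1)) (fac q N) := by
  unfold fac
  have hq' : ‖q ^ N‖ < 1 := by rw [norm_pow]; exact pow_lt_one₀ (norm_nonneg _) hq hN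
  split_ifs with h
  · let e : CN N ≃ Fin 2 := ⟨fun c => ⟨c.1, by have := c.2 h; omega⟩, fun i => ⟨i.1, fun _ => by omega⟩,
      fun c => rfl, fun i => rfl⟩
    rw [← e.symm.hasSum_iff]
    have := hasSum_fintype ((fun c : CN N => q ^ (N * c.1)) ∘ e.symm)
    rw [Fin.sum_univ_two] at this
    have h0 : ((e.symm 0).1) = 0 := rfl
    have h1 : ((e.symm 1).1) = 1 := rfl
    simp only [Function.comp_apply, h0, h1, mul_zero, pow_zero, mul_one] at this
    exact this
  · let e : CN N ≃ ℕ := ⟨fun c => c.1, fun i => ⟨i, fun h' => absurd h' h⟩, fun c => rfl, fun i => rfl⟩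
    rw [← e.symm.hasSum_iff]
    have := hasSum_geometric_of_norm_lt_one hq'
    have e2 : ((fun c : CN N => q ^ (N * c.1)) ∘ e.symm) = fun n => (q ^ N) ^ n := by
      funext i
      exact pow_mul q N i
    rw [e2]
    exact this

lemma summable_CN {q : ℂ} (hq : ‖q‖ < 1) {N : ℕ} (hN : N ≠ 0) :
    Summable (fun c : CN N => ‖q ^ (N * c.1)‖) := (hasSum_CN hq hN).summable.norm

lemma hasSum_VN {q : ℂ} (hq : ‖q‖ < 1) (N : ℕ) :
    HasSum (fun s : VN N => q ^ s.1.sum) (∏ k ∈ Finset.range N, fac q (k + 1)) := by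
  induction N with
  | zero =>
    have this_ : ∀ s : VN 0, s = ⟨0, ⟨by simp, by simp⟩, by simp⟩ := by
      rintro ⟨s, ⟨h1, h2⟩, h3⟩
      apply Subtype.ext
      apply Multiset.eq_zero_of_forall_notMem
      intro a ha
      have := h3 a ha
      obtain rfl : a = 0 := by omega
      exact h1 ha
    let i : Unique (VN 0) := ⟨⟨_⟩, this_⟩
    have := hasSum_fintype (fun s : VN 0 => q ^ s.1.sum)
    rw [Fintype.sum_unique] at this
    have h0 : (default : VN 0).1.sum = 0 := by rw [this_ default]; rfl
    rw [h0] at this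
    simpa using this
  | succ N ih =>
    rw [Finset.prod_range_succ, ← (vnEquiv N).symm.hasSum_iff]
    have hc := hasSum_CN hq (Nat.succ_ne_zero N)
    have h3 : Summable (fun p : VN N × CN (N + 1) => q ^ p.1.1.sum * q ^ ((N + 1) * p.2.1)) :=
      summable_mul_of_summable_norm (f := fun s : VN N => q ^ s.1.sum)
        (g := fun c : CN (N+1) => q ^ ((N + 1) * c.1)) ih.summable.norm hc.summable.norm
    have h := HasSum.mul ih hc h3
    have e2 : ((fun s : VN (N+1) => q ^ s.1.sum) ∘ (vnEquiv N).symm) =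
        fun p : VN N × CN (N + 1) => q ^ p.1.1.sum * q ^ ((N + 1) * p.2.1) := by
      funext p
      have : ((vnEquiv N).symm p).1 = p.1.1 + Multiset.replicate p.2.1 (N + 1) := rfl
      simp only [Function.comp_apply, this, Multiset.sum_add, Multiset.sum_replicate, smul_eq_mul, pow_add, mul_comm]
    rw [e2]
    exact h

lemma fac_le {r : ℝ} (h0 : 0 ≤ r) (h1 : r < 1) (k : ℕ) : 0 ≤ fac r (k+1) ∧ fac r (k + 1) ≤ Real.exp (r ^ k / (1 - r)) := by
  have hk : r ^ (k+1) ≤ r := by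
    calc r^(k+1) = r^k * r := pow_succ _ _
      _ ≤ 1 * r := by gcongr; exact pow_le_one₀ h0 h1.le
      _ = r := one_mul r
  have hk0 : 0 ≤ r^(k+1) := by positivity
  have hk1 : r^(k+1) ≤ r^k := pow_le_pow_of_le_one h0 h1.le (Nat.le_succ k)
  have h2 : r ^ (k+1) / (1 - r) ≤ r^k / (1-r) := by gcongr
  unfold fac
  split_ifs
  · refine ⟨by positivity, ?_⟩
    have : r ^ (k+1) ≤ r^k / (1-r) := by
      rw [le_div_iff₀ (by linarith)]
      nlinarith
    linarith [Real.add_one_le_exp (r ^ k / (1 - r))]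
  · refine ⟨inv_nonneg.2 (by linarith), ?_⟩
    have : (1 - r^(k+1))⁻¹ = r^(k+1) / (1 - r^(k+1)) + 1 := by
      have : 1 - r^(k+1) ≠ 0 := by linarith
      field_simp; ring
    rw [this]
    have : r^(k+1) / (1 - r^(k+1)) ≤ r^(k+1) / (1-r) := by gcongr
    linarith [Real.add_one_le_exp (r ^ k / (1 - r))]

lemma prod_fac_le {r : ℝ} (h0 : 0 ≤ r) (h1 : r < 1) (N : ℕ) :
    ∏ k ∈ Finset.range N, fac r (k + 1) ≤ Real.exp ((1 - r)⁻¹ / (1 - r)) := by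
  calc _ ≤ ∏ k ∈ Finset.range N, Real.exp (r ^ k / (1 - r)) :=
        Finset.prod_le_prod (fun k _ => (fac_le h0 h1 k).1) (fun k _ => (fac_le h0 h1 k).2)
    _ = Real.exp (∑ k ∈ Finset.range N, r ^ k / (1 - r)) := (Real.exp_sum _ _).symm
    _ ≤ _ := by
      rw [← Finset.sum_div]
      gcongr
      · rw [← tsum_geometric_of_lt_one h0 h1]
        exact (summable_geometric_of_lt_one h0 h1).sum_le_tsum _ (fun i _ => by positivity)

lemma ofReal_fac (r : ℝ) (k : ℕ) : ((fac r k : ℝ) : ℂ) = fac (r : ℂ) k := by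
  unfold fac; split_ifs <;> push_cast <;> rfl

lemma summ_V {r : ℝ} (h0 : 0 ≤ r) (h1 : r < 1) : Summable (fun s : {s // Vld s} => r ^ s.1.sum) := by
  apply summable_of_sum_le (c := Real.exp ((1 - r)⁻¹ / (1 - r)))
  · intro s; positivity
  · intro u
    set N := u.sup (fun s => s.1.sum) with hN
    have hb : ∀ s ∈ u, ∀ x ∈ s.1, x ≤ N := fun s hs x hx =>
      (Multiset.le_sum_of_mem hx).trans (Finset.le_sup (f := fun s : {s // Vld s} => s.1.sum) hs)
    have hs : HasSum (fun s : VN N => r ^ s.1.sum) (∏ k ∈ Finset.range N, fac r (k + 1)) := by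
      have := hasSum_VN (q := (r : ℂ)) (by simpa [abs_of_nonneg h0] using h1) N
      rw [← Complex.hasSum_ofReal]
      push_cast
      simpa [ofReal_fac] using this
    refine le_trans ?_ (prod_fac_le h0 h1 N)
    rw [← hs.tsum_eq]
    have : ∑ s ∈ u, r ^ s.1.sum = ∑ s ∈ u.attach.map ⟨fun s => (⟨s.1.1, s.1.2, hb s.1 s.2⟩ : VN N),
        fun a b h => by apply Subtype.ext; apply Subtype.ext; exact congrArg (fun s : VN N => s.1) h⟩, r ^ s.1.sum := by
      rw [Finset.sum_map, ← Finset.sum_attach]; rfl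
    rw [this]
    exact hs.summable.sum_le_tsum _ (fun i _ => by positivity)

noncomputable def Pf (q : ℂ) : ℂ := ∑' s : {s // Vld s}, q ^ s.1.sum

lemma tendsto_prod {q : ℂ} (hq : ‖q‖ < 1) :
    Filter.Tendsto (fun N => ∏ k ∈ Finset.range N, fac q (k + 1)) Filter.atTop (nhds (Pf q)) := by
  have key : ∀ N, ∏ k ∈ Finset.range N, fac q (k + 1) =
      ∑' s : {s // Vld s}, if (∀ x ∈ s.1, x ≤ N) then q ^ s.1.sum else 0 := by
    intro N
    rw [← (hasSum_VN hq N).tsum_eq]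
    let e : VN N ≃ {s : {s // Vld s} // ∀ x ∈ s.1, x ≤ N} :=
      ⟨fun s => ⟨⟨s.1, s.2.1⟩, s.2.2⟩, fun s => ⟨s.1.1, s.1.2, s.2⟩, fun _ => rfl, fun _ => rfl⟩
    rw [← e.symm.tsum_eq]
    have := tsum_subtype {s : {s // Vld s} | ∀ x ∈ s.1, x ≤ N} (fun s => q ^ s.1.sum)
    simp only [Set.indicator_apply, Set.mem_ofPred_eq] at this
    exact this
  simp_rw [key]
  unfold Pf
  refine tendsto_tsum_of_dominated_convergence (summ_V (norm_nonneg q) hq) ?_ ?_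
  · intro s
    apply tendsto_const_nhds.congr'
    filter_upwards [Filter.eventually_ge_atTop s.1.sum] with N hN
    rw [if_pos]
    intro x hx; exact (Multiset.le_sum_of_mem hx).trans hN
  · filter_upwards with N s
    split_ifs
    · rw [norm_pow]
    · simp
end Part2

section Part3
noncomputable def wS (q : ℂ) (S : Multiset ℕ → Prop) : ℂ := ∑' s : Multiset ℕ, if S s then q ^ s.sum else 0

lemma summ_ms {r : ℝ} (h0 : 0 ≤ r) (h1 : r < 1) :
    Summable (fun s : Multiset ℕ => if Vld s then r ^ s.sum else 0) := by
  have := summ_V h0 h1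
  have h2 := (summable_subtype_iff_indicator (s := {s | Vld s}) (f := fun s : Multiset ℕ => r ^ s.sum)).1 this
  refine h2.congr (fun s => ?_)
  simp only [Set.indicator_apply, Set.mem_ofPred_eq]

lemma summ_wS {q : ℂ} (hq : ‖q‖ < 1) {S : Multiset ℕ → Prop} (hS : ∀ s, S s → Vld s) :
    Summable (fun s : Multiset ℕ => if S s then q ^ s.sum else 0) := by
  apply Summable.of_norm_bounded (summ_ms (norm_nonneg q) hq)
  intro s
  by_cases h : S s
  · rw [if_pos h, if_pos (hS s h), norm_pow]
  · rw [if_neg h]; split_ifs <;> simp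

lemma wS_eq_sub (q : ℂ) (S : Multiset ℕ → Prop) : wS q S = ∑' s : {s // S s}, q ^ s.1.sum := by
  unfold wS
  have := tsum_subtype {s | S s} (fun s : Multiset ℕ => q ^ s.sum)
  simp only [Set.indicator_apply, Set.mem_ofPred_eq] at this
  exact this.symm

lemma Pf_eq (q : ℂ) : Pf q = wS q Vld := by rw [wS_eq_sub]; rfl

lemma norm_wS_le {q : ℂ} (hq : ‖q‖ < 1) {S : Multiset ℕ → Prop} (hS : ∀ s, S s → Vld s) :
    ‖wS q S‖ ≤ ∑' s : Multiset ℕ, if Vld s then ‖q‖ ^ s.sum else 0 := by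
  apply tsum_of_norm_bounded (summ_ms (norm_nonneg q) hq).hasSum
  intro s
  by_cases h : S s
  · rw [if_pos h, if_pos (hS s h), norm_pow]
  · rw [if_neg h]; split_ifs <;> simp

lemma wS_union {q : ℂ} (hq : ‖q‖ < 1) {S S1 S2 : Multiset ℕ → Prop} (h1 : ∀ s, S1 s → Vld s)
    (h2 : ∀ s, S2 s → Vld s) (hS : ∀ s, S s ↔ (S1 s ∨ S2 s)) (hd : ∀ s, S1 s → ¬ S2 s) :
    wS q S = wS q S1 + wS q S2 := by
  unfold wS
  rw [← (summ_wS hq h1).tsum_add (summ_wS hq h2)]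
  congr 1
  funext s
  have := hS s
  have := hd s
  by_cases a : S1 s
  · have b := hd s a
    rw [if_pos a, if_neg b, if_pos ((hS s).2 (Or.inl a)), add_zero]
  · by_cases b : S2 s
    · rw [if_neg a, if_pos b, if_pos ((hS s).2 (Or.inr b)), zero_add]
    · rw [if_neg a, if_neg b, if_neg (fun h => ((hS s).1 h).elim a b), add_zero]

lemma wS_single (q : ℂ) (u : Multiset ℕ) : wS q (fun s => s = u) = q ^ u.sum := by
  unfold wS
  rw [tsum_eq_single u]
  · simp
  · intro b hb; simp [hb]

lemma dyson_nonneg (q : ℂ) (r : ℕ) : wS q (DDom r) = q ^ (2 * r + 1) * wS q (DCod r) := by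
  rw [wS_eq_sub, wS_eq_sub, ← (dysonEquiv r).tsum_eq, ← tsum_mul_left]
  congr 1
  funext s
  rw [← pow_add]
  congr 1
  have := sum_dphi s.2
  have e : ((dysonEquiv r) s).1 = dphi r s.1 := rfl
  rw [e]
  omega

lemma dyson_neg (q : ℂ) (a : ℕ) : wS q (DCod (-a - 1)) = q ^ (2 * a + 1) * wS q (DDom (-a - 1)) := by
  rw [wS_eq_sub, wS_eq_sub, ← (dysonEquiv (-a-1)).tsum_eq, ← tsum_mul_left]
  congr 1
  funext s
  rw [← pow_add]
  congr 1
  have := sum_dphi s.2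
  have e : ((dysonEquiv (-a-1)) s).1 = dphi (-a-1) s.1 := rfl
  rw [e]
  omega

noncomputable def Hf (q : ℂ) (r : ℕ) : ℂ := wS q (DDom r)
noncomputable def Kf (q : ℂ) (a : ℕ) : ℂ := wS q (fun s => Vld s ∧ mrk s ≤ -a)

lemma mrk_zero : mrk 0 = 0 := by simp [mrk]
lemma vld_zero : Vld 0 := by simp [Vld]

lemma Hf_rec {q : ℂ} (hq : ‖q‖ < 1) (r : ℕ) : Hf q r = q ^ (2 * r + 1) * (Pf q - Hf q (r + 2)) := by
  unfold Hf
  rw [dyson_nonneg, Pf_eq]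
  congr 1
  rw [eq_sub_iff_add_eq]
  symm
  apply wS_union hq (fun s h => h.1) (fun s h => h.1)
  · intro s
    rw [dcod_nonneg (by positivity)]
    constructor
    · intro h
      by_cases hm : mrk s ≤ r + 1
      · left; exact ⟨h, hm⟩
      · right
        refine ⟨h, ?_, by push_cast; omega⟩
        rintro rfl; rw [mrk_zero] at hm; omega
    · rintro (h | h) <;> exact h.1
  · rintro s h1 ⟨_, _, h3⟩
    have := h1.2.1
    push_cast at h3
    omega

lemma Kf_rec {q : ℂ} (hq : ‖q‖ < 1) {a : ℕ} (ha : 1 ≤ a) :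
    Kf q a = q ^ (2 * a + 1) * (Pf q - Kf q (a + 2)) := by
  have ha' : (1 : ℤ) ≤ a := by exact_mod_cast ha
  have e1 : Kf q a = wS q (DCod (-a - 1)) + wS q (fun s => s = 1 ::ₘ Multiset.replicate (a : ℤ).toNat 2) := by
    apply wS_union hq (fun s h => h.1) (fun s h => by rw [h]; exact special_vld ha')
    · intro s; exact dcod_neg ha' s
    · rintro s h rfl; exact special_not_dcod ha' h
  have e2 : Pf q = wS q (fun s => Vld s ∧ -a - 1 ≤ mrk s) + Kf q (a + 2) := by
    rw [Pf_eq]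
    apply wS_union hq (fun s h => h.1) (fun s h => h.1)
    · intro s
      push_cast
      constructor
      · intro h
        by_cases hm : -a - 1 ≤ mrk s
        · left; exact ⟨h, hm⟩
        · right; exact ⟨h, by omega⟩
      · rintro (h | h) <;> exact h.1
    · rintro s h1 h2
      have := h1.2
      have := h2.2
      push_cast at *
      omega
  have e3 : wS q (fun s => Vld s ∧ -a - 1 ≤ mrk s) = wS q (DDom (-a - 1)) + wS q (fun s => s = 0) := by
    apply wS_union hq (fun s h => h.1) (fun s h => by rw [h]; exact vld_zero)
    · intro s
      constructor
      · rintro ⟨h1, h2⟩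
        by_cases h : s = 0
        · right; exact h
        · left; exact ⟨h1, h, h2⟩
      · rintro (h | rfl)
        · exact ⟨h.1, h.2.2⟩
        · exact ⟨vld_zero, by rw [mrk_zero]; omega⟩
    · rintro s h rfl; exact h.2.1 rfl
  rw [e1, e2, e3, dyson_neg, wS_single, wS_single]
  have : (1 ::ₘ Multiset.replicate (a : ℤ).toNat 2).sum = 2 * a + 1 := by
    simp [mul_comm, add_comm]
  rw [this]
  simp
  ring

noncomputable def Tt (q : ℂ) (r k : ℕ) : ℂ := (-1) ^ k * q ^ ((k + 1) * (2 * k + 1 + 2 * r))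
noncomputable def Tf (q : ℂ) (r : ℕ) : ℂ := ∑' k, Tt q r k

lemma norm_Tt_le {q : ℂ} (hq : ‖q‖ < 1) (r k : ℕ) : ‖Tt q r k‖ ≤ ‖q‖ ^ k * ‖q‖ ^ r := by
  unfold Tt
  rw [norm_mul, norm_pow, norm_neg, norm_one, one_pow, one_mul, norm_pow, ← pow_add]
  apply pow_le_pow_of_le_one (norm_nonneg _) hq.le
  nlinarith [Nat.zero_le k, Nat.zero_le r, Nat.zero_le (k*r), Nat.zero_le (k*k)]

lemma summ_Tt {q : ℂ} (hq : ‖q‖ < 1) (r : ℕ) : Summable (Tt q r) :=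
  Summable.of_norm_bounded ((summable_geometric_of_lt_one (norm_nonneg _) hq).mul_right _) (norm_Tt_le hq r)

lemma norm_Tf_le {q : ℂ} (hq : ‖q‖ < 1) (r : ℕ) : ‖Tf q r‖ ≤ (1 - ‖q‖)⁻¹ * ‖q‖ ^ r :=
  tsum_of_norm_bounded ((hasSum_geometric_of_lt_one (norm_nonneg _) hq).mul_right _) (norm_Tt_le hq r)

lemma Tf_rec {q : ℂ} (hq : ‖q‖ < 1) (r : ℕ) : Tf q r = q ^ (2 * r + 1) * (1 - Tf q (r + 2)) := by
  unfold Tf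
  rw [(summ_Tt hq r).tsum_eq_zero_add, mul_sub, mul_one, ← tsum_mul_left, sub_eq_add_neg, ← tsum_neg]
  congr 1
  · unfold Tt; simp; ring
  · congr 1; funext k
    unfold Tt
    rw [show (k + 1 + 1) * (2 * (k + 1) + 1 + 2 * r) = (2 * r + 1) + (k + 1) * (2 * k + 1 + 2 * (r + 2)) by ring, pow_add]
    ring

lemma rec_unique {q : ℂ} (hq : ‖q‖ < 1) (D : ℕ → ℂ) (B : ℝ) (hB : ∀ r, ‖D r‖ ≤ B) (r0 : ℕ)
    (hD : ∀ r, r0 ≤ r → D r = - q ^ (2 * r + 1) * D (r + 2)) (r : ℕ) (hr : r0 ≤ r) : D r = 0 := by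
  have hB0 : 0 ≤ B := (norm_nonneg _).trans (hB 0)
  have key : ∀ n r, r0 ≤ r → ‖D r‖ ≤ ‖q‖ ^ n * B := by
    intro n
    induction n with
    | zero => intro r _; simpa using hB r
    | succ n ih =>
      intro r hr
      rw [hD r hr, norm_mul, norm_neg, norm_pow, pow_succ' ‖q‖ n, mul_assoc]
      gcongr
      · calc ‖q‖ ^ (2 * r + 1) ≤ ‖q‖ ^ 1 := pow_le_pow_of_le_one (norm_nonneg _) hq.le (by omega)
          _ = ‖q‖ := pow_one _
      · exact ih _ (by omega)
  have ht : Filter.Tendsto (fun n => ‖q‖ ^ n * B) Filter.atTop (nhds 0) := by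
    simpa using (tendsto_pow_atTop_nhds_zero_of_lt_one (norm_nonneg _) hq).mul_const B
  have := ge_of_tendsto' ht (fun n => key n r hr)
  exact norm_le_zero_iff.1 this

lemma eq_of_rec {q : ℂ} (hq : ‖q‖ < 1) (F : ℕ → ℂ) (B : ℝ) (hB : ∀ r, ‖F r‖ ≤ B) (r0 : ℕ)
    (hF : ∀ r, r0 ≤ r → F r = q ^ (2 * r + 1) * (Pf q - F (r + 2))) (r : ℕ) (hr : r0 ≤ r) :
    F r = Pf q * Tf q r := by
  have := rec_unique hq (fun r => F r - Pf q * Tf q r) (B + ‖Pf q‖ * (1 - ‖q‖)⁻¹) ?_ r0 ?_ r hr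
  · exact sub_eq_zero.1 this
  · intro r
    refine (norm_sub_le _ _).trans ?_
    rw [norm_mul]
    gcongr
    · exact hB r
    · refine (norm_Tf_le hq r).trans ?_
      have : 0 < 1 - ‖q‖ := by linarith
      calc _ ≤ (1 - ‖q‖)⁻¹ * 1 := by gcongr; exact pow_le_one₀ (norm_nonneg _) hq.le
        _ = _ := mul_one _
  · intro r hr
    rw [hF r hr, Tf_rec hq r]
    ring

lemma Hf_eq {q : ℂ} (hq : ‖q‖ < 1) (r : ℕ) : Hf q r = Pf q * Tf q r :=
  eq_of_rec hq (Hf q) _ (fun _ => norm_wS_le hq (fun _ h => h.1)) 0 (fun r _ => Hf_rec hq r) r (Nat.zero_le _)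

lemma Kf_eq {q : ℂ} (hq : ‖q‖ < 1) {a : ℕ} (ha : 1 ≤ a) : Kf q a = Pf q * Tf q a :=
  eq_of_rec hq (Kf q) _ (fun _ => norm_wS_le hq (fun _ h => h.1)) 1 (fun _ h => Kf_rec hq h) a ha

lemma Pf_theta {q : ℂ} (hq : ‖q‖ < 1) : Pf q * (1 - Tf q 0 - Tf q 1) = 1 := by
  have e1 : Pf q = wS q (fun s => Vld s ∧ 0 ≤ mrk s) + Kf q 1 := by
    rw [Pf_eq]
    apply wS_union hq (fun s h => h.1) (fun s h => h.1)
    · intro s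
      push_cast
      constructor
      · intro h
        by_cases hm : 0 ≤ mrk s
        · left; exact ⟨h, hm⟩
        · right; exact ⟨h, by omega⟩
      · rintro (h | h) <;> exact h.1
    · rintro s h1 h2
      have := h1.2
      have := h2.2
      push_cast at *
      omega
  have e3 : wS q (fun s => Vld s ∧ 0 ≤ mrk s) = Hf q 0 + wS q (fun s => s = 0) := by
    apply wS_union hq (fun s h => h.1) (fun s h => by rw [h]; exact vld_zero)
    · intro s
      constructor
      · rintro ⟨h1, h2⟩
        by_cases h : s = 0
        · right; exact h
        · left; exact ⟨h1, h, h2⟩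
      · rintro (h | rfl)
        · exact ⟨h.1, h.2.2⟩
        · exact ⟨vld_zero, by rw [mrk_zero]⟩
    · rintro s h rfl; exact h.2.1 rfl
  rw [e3, wS_single, Hf_eq hq, Kf_eq hq le_rfl] at e1
  simp at e1
  linear_combination e1

noncomputable def Rf (ζ q : ℂ) : ℂ := ∑' s : Multiset ℕ, if Vld s then ζ ^ mrk s * q ^ s.sum else 0

noncomputable def Cterm (ζ q : ℂ) (k : ℕ) : ℂ := (-1) ^ k * q ^ ((k + 1) * (2 * k + 3)) *
  ((ζ - 1) / (1 - ζ * q ^ (2 * (k + 1))) + (ζ⁻¹ - 1) / (1 - ζ⁻¹ * q ^ (2 * (k + 1))))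

noncomputable def Cf (ζ q : ℂ) : ℂ := 1 + ∑' k : ℕ, Cterm ζ q k

noncomputable def gj (ζ : ℂ) (j : ℕ) : ℂ := (ζ ^ (j + 1) - ζ ^ j) + (ζ⁻¹ ^ (j + 1) - ζ⁻¹ ^ j)

noncomputable def clampz (J : ℕ) (m : ℤ) : ℤ := max (-J) (min J m)

lemma RJ {ζ q : ℂ} (hζ : ‖ζ‖ = 1) (hq : ‖q‖ < 1) (J : ℕ) :
    (∑' s : Multiset ℕ, if Vld s then ζ ^ clampz J (mrk s) * q ^ s.sum else 0) =
      Pf q * (1 + ∑ j ∈ Finset.range J, gj ζ j * Tf q (j + 1)) := by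
  have hζ0 : ζ ≠ 0 := by rintro rfl; simp at hζ
  have hsum : ∀ f : Multiset ℕ → ℤ, Summable (fun s : Multiset ℕ => if Vld s then ζ ^ f s * q ^ s.sum else 0) := by
    intro f
    apply Summable.of_norm_bounded (summ_ms (norm_nonneg q) hq)
    intro s
    split_ifs
    · simp [hζ]
    · simp
  induction J with
  | zero =>
    have : ∀ m, clampz 0 m = 0 := fun m => by unfold clampz; simp
    simp [this, Pf_eq, wS]
  | succ J ih =>
    rw [Finset.sum_range_succ, ← add_assoc, mul_add, ← ih]
    have e : Pf q * (gj ζ J * Tf q (J + 1)) = (ζ ^ (J + 1) - ζ ^ J) * Hf q (J+1) + (ζ⁻¹ ^ (J + 1) - ζ⁻¹ ^ J) * Kf q (J + 1) := by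
      rw [Hf_eq hq, Kf_eq hq (by omega)]; unfold gj; ring
    rw [e]
    unfold Hf Kf wS
    rw [← tsum_mul_left, ← tsum_mul_left, ← Summable.tsum_add, ← Summable.tsum_add]
    · congr 1
      funext s
      by_cases hv : Vld s
      · have hz : s = 0 → mrk s = 0 := by rintro rfl; exact mrk_zero
        rw [if_pos hv, if_pos hv]
        rcases lt_trichotomy (mrk s).natAbs (J + 1) with h | h | h
        · have e1 : clampz (J+1) (mrk s) = mrk s := by unfold clampz; push_cast; omega
          have e2 : clampz J (mrk s) = mrk s := by unfold clampz; omega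
          rw [e1, e2, if_neg, if_neg]
          · ring
          · rintro ⟨_, h2⟩; push_cast at h2; omega
          · rintro ⟨_, _, h2⟩; push_cast at h2; omega
        all_goals
        · rcases le_total 0 (mrk s) with hp | hp
          · have e1 : clampz (J+1) (mrk s) = ((J + 1 : ℕ) : ℤ) := by unfold clampz; push_cast; omega
            have e2 : clampz J (mrk s) = (J : ℤ) := by unfold clampz; omega
            rw [e1, e2, zpow_natCast, zpow_natCast, if_pos, if_neg]
            · ring
            · rintro ⟨_, h2⟩; push_cast at h2; omega
            · refine ⟨hv, fun h => ?_, by push_cast; omega⟩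
              have := hz h; omega
          · have e1 : clampz (J+1) (mrk s) = -((J + 1 : ℕ) : ℤ) := by unfold clampz; push_cast; omega
            have e2 : clampz J (mrk s) = -(J : ℤ) := by unfold clampz; omega
            rw [e1, e2, zpow_neg, zpow_neg, zpow_natCast, zpow_natCast, if_neg, if_pos]
            · rw [inv_pow, inv_pow]; ring
            · exact ⟨hv, by push_cast; omega⟩
            · rintro ⟨_, _, h2⟩; push_cast at h2; omega
      · rw [if_neg hv, if_neg hv, if_neg (fun h => hv h.1), if_neg (fun h => hv h.1)]; ring
    · exact hsum _
    · exact ((summ_wS hq (fun s h => h.1)).mul_left _).add ((summ_wS hq (fun s h => h.1)).mul_left _)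
    · exact ((summ_wS hq (fun s h => h.1)).mul_left _)
    · exact ((summ_wS hq (fun s h => h.1)).mul_left _)

lemma Cgeo {q : ℂ} (hq : ‖q‖ < 1) (k : ℕ) (z : ℂ) (hz : ‖z‖ = 1) : HasSum (fun j : ℕ => (z ^ (j + 1) - z ^ j) * Tt q (j + 1) k)
      ((-1) ^ k * q ^ ((k + 1) * (2 * k + 3)) * ((z - 1) / (1 - z * q ^ (2 * (k + 1))))) := by
  have hqk : ‖q ^ (2 * (k+1))‖ < 1 := by
    rw [norm_pow]; exact pow_lt_one₀ (norm_nonneg q) hq (by omega)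
  have := (hasSum_geometric_of_norm_lt_one (ξ := z * q ^ (2 * (k+1))) (by rw [norm_mul, hz, one_mul]; exact hqk)).mul_left
      ((-1) ^ k * q ^ ((k + 1) * (2 * k + 3)) * (z - 1))
  have e1 : (fun j : ℕ => (z ^ (j + 1) - z ^ j) * Tt q (j + 1) k) =
      fun j : ℕ => (-1) ^ k * q ^ ((k + 1) * (2 * k + 3)) * (z - 1) * (z * q ^ (2 * (k+1))) ^ j := by
    funext j
    unfold Tt
    rw [mul_pow, ← pow_mul, show (k + 1) * (2 * k + 1 + 2 * (j + 1)) = (k + 1) * (2 * k + 3) + 2 * (k + 1) * j by ring, pow_add]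
    ring
  rw [e1, div_eq_mul_inv, ← mul_assoc]
  exact this

lemma Cinner {ζ q : ℂ} (hζ : ‖ζ‖ = 1) (hq : ‖q‖ < 1) (k : ℕ) :
    HasSum (fun j : ℕ => gj ζ j * Tt q (j + 1) k) (Cterm ζ q k) := by
  have h1 := (Cgeo hq k ζ hζ).add (Cgeo hq k ζ⁻¹ (by rw [norm_inv, hζ, inv_one]))
  rw [← mul_add] at h1
  have e : (fun j : ℕ => gj ζ j * Tt q (j + 1) k) = fun j : ℕ => (ζ ^ (j + 1) - ζ ^ j) * Tt q (j + 1) k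
      + (ζ⁻¹ ^ (j + 1) - ζ⁻¹ ^ j) * Tt q (j + 1) k := by
    funext j; unfold gj; ring
  rw [e]
  exact h1

lemma Cdouble {ζ q : ℂ} (hζ : ‖ζ‖ = 1) (hq : ‖q‖ < 1) :
    Summable (fun p : ℕ × ℕ => gj ζ p.1 * Tt q (p.1 + 1) p.2) := by
  have hg : ∀ j, ‖gj ζ j‖ ≤ 4 := by
    intro j
    unfold gj
    calc _ ≤ (‖ζ ^ (j + 1)‖ + ‖ζ ^ j‖) + (‖ζ⁻¹ ^ (j + 1)‖ + ‖ζ⁻¹ ^ j‖) :=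
        (norm_add_le _ _).trans (add_le_add (norm_sub_le _ _) (norm_sub_le _ _))
      _ = 4 := by simp [hζ]; norm_num
  have hr := norm_nonneg q
  have hgeo := summable_geometric_of_lt_one hr hq
  apply Summable.of_norm_bounded (g := fun p : ℕ × ℕ => 4 * (‖q‖ ^ p.1 * ‖q‖ ^ p.2))
  · exact (hgeo.mul_of_nonneg hgeo (fun _ => by positivity) (fun _ => by positivity)).mul_left 4
  · rintro ⟨j, k⟩
    rw [norm_mul]
    refine mul_le_mul (hg j) ?_ (norm_nonneg _) (by norm_num)
    refine (norm_Tt_le hq _ _).trans ?_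
    rw [← pow_add, ← pow_add]
    exact pow_le_pow_of_le_one hr hq.le (by dsimp only; omega)

lemma Csum {ζ q : ℂ} (hζ : ‖ζ‖ = 1) (hq : ‖q‖ < 1) :
    HasSum (fun j => gj ζ j * Tf q (j + 1)) (∑' k : ℕ, Cterm ζ q k) := by
  have hs := Cdouble hζ hq
  have hf : ∀ j, HasSum (fun k => gj ζ j * Tt q (j + 1) k) (gj ζ j * Tf q (j + 1)) :=
    fun j => (summ_Tt hq (j+1)).hasSum.mul_left _
  have h1 := hs.hasSum.prod_fiberwise hf
  have hs' : HasSum (fun p : ℕ × ℕ => gj ζ p.2 * Tt q (p.2 + 1) p.1) (∑' p : ℕ × ℕ, gj ζ p.1 * Tt q (p.1 + 1) p.2) :=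
    (Equiv.prodComm ℕ ℕ).hasSum_iff.2 hs.hasSum
  have h2 := hs'.prod_fiberwise (fun k => Cinner hζ hq k)
  rw [h2.tsum_eq]
  exact h1

lemma Rf_eq {ζ q : ℂ} (hζ : ‖ζ‖ = 1) (hq : ‖q‖ < 1) : Rf ζ q = Pf q * Cf ζ q := by
  have h1 : Filter.Tendsto (fun J : ℕ => ∑' s : Multiset ℕ, if Vld s then ζ ^ clampz J (mrk s) * q ^ s.sum else 0)
      Filter.atTop (nhds (Rf ζ q)) := by
    unfold Rf
    refine tendsto_tsum_of_dominated_convergence (summ_ms (norm_nonneg q) hq) ?_ ?_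
    · intro s
      apply tendsto_const_nhds.congr'
      filter_upwards [Filter.eventually_ge_atTop (mrk s).natAbs] with J hJ
      have : clampz J (mrk s) = mrk s := by unfold clampz; omega
      rw [this]
    · filter_upwards with J s
      split_ifs
      · simp [hζ]
      · simp
  simp_rw [RJ hζ hq] at h1
  have h2 := ((Csum hζ hq).tendsto_sum_nat.const_add 1).const_mul (Pf q)
  exact tendsto_nhds_unique h1 h2
end Part3

section Part4
noncomputable def zet : ℂ := Complex.exp (2 * Real.pi * Complex.I / 9)

lemma zet9 : zet ^ 9 = 1 := by
  unfold zet
  rw [← Complex.exp_nat_mul]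
  rw [show ((9:ℕ):ℂ) * (2 * Real.pi * Complex.I / 9) = 2 * Real.pi * Complex.I by push_cast; ring]
  exact Complex.exp_two_pi_mul_I

lemma zet_ne : zet ≠ 0 := Complex.exp_ne_zero _

lemma norm_zet : ‖zet‖ = 1 := by
  unfold zet
  rw [show (2 * Real.pi * Complex.I / 9 : ℂ) = ((2 * Real.pi / 9 : ℝ) : ℂ) * Complex.I by push_cast; ring]
  exact Complex.norm_exp_ofReal_mul_I _

def partEquiv : (Σ n : ℕ, {P : n.Partition // NoRepeatedOddParts P}) ≃ {s : Multiset ℕ // Vld s} where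
  toFun x := ⟨x.2.1.parts, fun h => by have := x.2.1.parts_pos h; omega, x.2.2⟩
  invFun s := ⟨s.1.sum, ⟨⟨s.1, fun {i} hi => Nat.pos_of_ne_zero (fun h => s.2.1 (h ▸ hi)), rfl⟩, s.2.2⟩⟩
  left_inv := by
    rintro ⟨n, ⟨⟨p, hp, rfl⟩, hP⟩⟩
    rfl
  right_inv := by
    rintro ⟨s, hs⟩
    rfl

lemma zet_zpow_mod (m : ℤ) : zet ^ m = zet ^ ((m % 9).toNat) := by
  have h : m = 9 * (m / 9) + m % 9 := (Int.mul_ediv_add_emod m 9).symm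
  have h0 : 0 ≤ m % 9 := Int.emod_nonneg _ (by norm_num)
  conv_lhs => rw [h, zpow_add₀ zet_ne, zpow_mul]
  rw [show zet ^ (9:ℤ) = 1 by exact_mod_cast zet9, one_zpow, one_mul]
  conv_lhs => rw [← Int.toNat_of_nonneg h0]
  exact zpow_natCast _ _

lemma Acoef_eq (n : ℕ) : Acoef 1 9 n = ∑ P : {P : n.Partition // NoRepeatedOddParts P}, zet ^ m2Rank P.1 := by
  unfold Acoef
  rw [← Finset.sum_fiberwise_of_maps_to (s := Finset.univ) (t := Finset.range 9)
    (g := fun P : {P : n.Partition // NoRepeatedOddParts P} => (m2Rank P.1 % 9).toNat)]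
  · apply Finset.sum_congr rfl
    intro r hr
    have hr9 := Finset.mem_range.1 hr
    have hexp : Complex.exp (2 * Real.pi * Complex.I * ((1:ℤ) : ℂ) * (r : ℂ) / ((9:ℕ) : ℂ)) = zet ^ r := by
      unfold zet
      rw [← Complex.exp_nat_mul]
      congr 1
      push_cast; ring
    rw [hexp]
    have : ∀ P ∈ Finset.univ.filter (fun P : {P : n.Partition // NoRepeatedOddParts P} => (m2Rank P.1 % 9).toNat = r),
        zet ^ m2Rank P.1 = zet ^ r := by
      intro P hP
      rw [zet_zpow_mod, (Finset.mem_filter.1 hP).2]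
    rw [Finset.sum_congr rfl this, Finset.sum_const, nsmul_eq_mul]
    congr 2
    unfold N2
    rw [← Fintype.card_subtype, ← Nat.card_eq_fintype_card]
    refine Nat.card_congr ?_
    refine ((Equiv.subtypeSubtypeEquivSubtypeInter _ _).symm).trans (Equiv.subtypeEquivRight ?_)
    intro P
    rw [Int.ModEq]
    push_cast
    have := Int.emod_nonneg (m2Rank P.1) (show (9:ℤ) ≠ 0 by norm_num)
    omega
  · intro P _
    rw [Finset.mem_range]
    have := Int.emod_lt_of_pos (m2Rank P.1) (show (0:ℤ) < 9 by norm_num)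
    omega

lemma hasSum_Rf {q : ℂ} (hq : ‖q‖ < 1) : HasSum (fun n => Acoef 1 9 n * q ^ n) (Rf zet q) := by
  have hs : Summable (fun s : Multiset ℕ => if Vld s then zet ^ mrk s * q ^ s.sum else 0) := by
    apply Summable.of_norm_bounded (summ_ms (norm_nonneg q) hq)
    intro s
    split_ifs
    · simp [norm_zet]
    · simp
  have h1 : HasSum (fun s : {s // Vld s} => zet ^ mrk s.1 * q ^ s.1.sum) (Rf zet q) := by
    have h := hs.hasSum
    have h2 := (hasSum_subtype_iff_indicator (s := {s | Vld s}) (f := fun s : Multiset ℕ => zet ^ mrk s * q ^ s.sum)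
      (a := Rf zet q)).2 (by
        convert h using 1
        · funext s
          simp only [Set.indicator_apply, Set.mem_ofPred_eq]
        · rfl)
    exact h2
  have h2 := partEquiv.hasSum_iff.2 h1
  have h3 := h2.sigma (g := fun n => Acoef 1 9 n * q ^ n) (fun n => by
    rw [Acoef_eq, Finset.sum_mul]
    have := hasSum_fintype (fun P : {P : n.Partition // NoRepeatedOddParts P} => zet ^ m2Rank P.1 * q ^ n)
    have e : (fun P : {P : n.Partition // NoRepeatedOddParts P} => ((fun s : {s // Vld s} => zet ^ mrk s.1 * q ^ s.1.sum) ∘ partEquiv) ⟨n, P⟩)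
        = (fun P : {P : n.Partition // NoRepeatedOddParts P} => zet ^ m2Rank P.1 * q ^ n) := by
      funext P
      have h4 : (partEquiv ⟨n, P⟩).1 = P.1.parts := rfl
      simp only [Function.comp, h4, P.1.parts_sum]
      rfl
    rw [e]
    exact this)
  exact h3

open Complex in
lemma norm_q {t : ℂ} (ht : 0 < t.re) : ‖cexp (-t)‖ < 1 := by
  rw [norm_exp]; simpa using ht

lemma tau_im {t : ℂ} (ht : 0 < t.re) : 0 < (2 * Complex.I * t / Real.pi : ℂ).im := by
  rw [Complex.div_ofReal_im]
  apply div_pos _ Real.pi_pos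
  simp [Complex.mul_im]; exact ht

lemma neg_one_exp (n : ℤ) : Complex.exp (Real.pi * Complex.I * n) = (-1 : ℂ) ^ n := by
  rw [mul_comm, Complex.exp_int_mul, Complex.exp_pi_mul_I]

lemma int_sum {f : ℤ → ℂ} {a b c : ℂ} (h0 : f 0 = c) (h1 : HasSum (fun k : ℕ => f (k + 1)) a)
    (h2 : HasSum (fun k : ℕ => f (-(k + 1))) b) : HasSum f (c + a + b) := by
  apply HasSum.of_nat_of_neg_add_one _ h2
  have := (hasSum_nat_add_iff (f := fun n : ℕ => f n) 1 (g := a)).1 (by simpa using h1)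
  simpa [h0, add_comm] using this

lemma theta_bil {t : ℂ} (ht : 0 < t.re) :
    1 - Tf (Complex.exp (-t)) 0 - Tf (Complex.exp (-t)) 1 =
      jacobiTheta₂ (1 / 2 + Complex.I * t / (2 * Real.pi)) (2 * Complex.I * t / Real.pi) := by
  have hpi : (Real.pi : ℂ) ≠ 0 := by exact_mod_cast Real.pi_ne_zero
  have hT : ∀ n : ℤ, jacobiTheta₂_term n (1 / 2 + Complex.I * t / (2 * Real.pi)) (2 * Complex.I * t / Real.pi) =
      (-1) ^ n * Complex.exp (-t * (2 * n ^ 2 + n)) := by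
    intro n
    rw [← neg_one_exp, ← Complex.exp_add]
    unfold jacobiTheta₂_term
    congr 1
    field_simp
    linear_combination ((n:ℂ) * t + 2 * (n:ℂ)^2 * t) * Complex.I_sq
  have h := hasSum_jacobiTheta₂_term (1 / 2 + Complex.I * t / (2 * Real.pi)) (tau_im ht)
  have h2 : HasSum (fun n => jacobiTheta₂_term n (1 / 2 + Complex.I * t / (2 * Real.pi)) (2 * Complex.I * t / Real.pi))
      (1 + (- Tf (Complex.exp (-t)) 1) + (- Tf (Complex.exp (-t)) 0)) := by
    apply int_sum
    · rw [hT]; simp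
    · refine ((summ_Tt (norm_q ht) 1).hasSum.neg).congr_fun ?_
      intro k
      rw [hT]
      unfold Tt
      rw [← Complex.exp_nat_mul, show ((k:ℤ) + 1) = ((k + 1 : ℕ) : ℤ) by push_cast; rfl, zpow_natCast, pow_succ]
      rw [mul_neg_one, neg_mul]
      congr 3
      push_cast; ring
    · refine ((summ_Tt (norm_q ht) 0).hasSum.neg).congr_fun ?_
      intro k
      rw [hT]
      unfold Tt
      rw [← Complex.exp_nat_mul, show (-((k:ℤ) + 1)) = -((k + 1 : ℕ) : ℤ) by push_cast; rfl, zpow_neg, zpow_natCast, ← inv_pow,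
        inv_neg_one, pow_succ]
      rw [mul_neg_one, neg_mul]
      congr 3
      push_cast; ring
  rw [h.unique h2]
  ring

lemma Cterm_le {ζ q : ℂ} (hζ : ‖ζ‖ = 1) (hq : ‖q‖ < 1) (k : ℕ) :
    ‖Cterm ζ q k‖ ≤ (4 / (1 - ‖q‖)) * ‖q‖ ^ k := by
  have hr := norm_nonneg q
  have h1 : 0 < 1 - ‖q‖ := by linarith
  have hd : ∀ z : ℂ, ‖z‖ = 1 → ‖(z - 1) / (1 - z * q ^ (2 * (k + 1)))‖ ≤ 2 / (1 - ‖q‖) := by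
    intro z hz
    rw [norm_div]
    have a1 : ‖z - 1‖ ≤ 2 := (norm_sub_le _ _).trans (by rw [hz, norm_one]; norm_num)
    have a2 : 1 - ‖q‖ ≤ ‖1 - z * q ^ (2 * (k + 1))‖ := by
      have := norm_sub_norm_le (1 : ℂ) (z * q ^ (2 * (k + 1)))
      rw [norm_one, norm_mul, hz, one_mul, norm_pow] at this
      have : ‖q‖ ^ (2 * (k + 1)) ≤ ‖q‖ ^ 1 := pow_le_pow_of_le_one hr hq.le (by omega)
      rw [pow_one] at this
      linarith
    gcongr
  unfold Cterm
  rw [norm_mul, norm_mul, norm_pow, norm_neg, norm_one, one_pow, one_mul, norm_pow, mul_comm]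
  have hi : ‖ζ⁻¹‖ = 1 := by rw [norm_inv, hζ, inv_one]
  refine mul_le_mul ?_ ?_ (by positivity) (by positivity)
  · refine (norm_add_le _ _).trans ((add_le_add (hd ζ hζ) (hd _ hi)).trans (le_of_eq ?_))
    ring
  · exact pow_le_pow_of_le_one hr hq.le (by nlinarith)

lemma Cterm_summ {ζ q : ℂ} (hζ : ‖ζ‖ = 1) (hq : ‖q‖ < 1) : Summable (Cterm ζ q) :=
  Summable.of_norm_bounded ((summable_geometric_of_lt_one (norm_nonneg q) hq).mul_left _) (Cterm_le hζ hq)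

lemma norm_Cf_le {ζ q : ℂ} (hζ : ‖ζ‖ = 1) (hq : ‖q‖ < 1) : ‖Cf ζ q‖ ≤ 1 + 4 / (1 - ‖q‖) ^ 2 := by
  unfold Cf
  refine (norm_add_le _ _).trans ?_
  rw [norm_one]
  gcongr
  refine (tsum_of_norm_bounded ((hasSum_geometric_of_lt_one (norm_nonneg q) hq).mul_left _) (Cterm_le hζ hq)).trans (le_of_eq ?_)
  field_simp

noncomputable def bet : ℝ := 7 * Real.pi / 18

lemma cosh_ne {t : ℂ} (ht : 0 < t.re) (n : ℤ) : Complex.cosh (t * n + Complex.I * bet) ≠ 0 := by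
  intro h
  rw [Complex.cosh, div_eq_zero_iff] at h
  rcases h with h | h
  · have h1 : Complex.exp (t * n + Complex.I * bet) = - Complex.exp (-(t * n + Complex.I * bet)) := by
      linear_combination h
    have h2 := congrArg norm h1
    rw [norm_neg, Complex.norm_exp, Complex.norm_exp, Real.exp_eq_exp] at h2
    simp [Complex.mul_re] at h2
    have hn : n = 0 := by
      rcases mul_eq_zero.1 (by linarith : t.re * (n:ℝ) = 0) with h | h
      · exact absurd h ht.ne'
      · exact_mod_cast h
    subst hn
    have h3 := congrArg Complex.re h1
    simp [Complex.exp_re] at h3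
    have : 0 < Real.cos bet := by
      apply Real.cos_pos_of_mem_Ioo; constructor <;> unfold bet <;> linarith [Real.pi_pos]
    linarith
  · norm_num at h

/-- The key term identity. -/
lemma term_id {t : ℂ} (ht : 0 < t.re) (n : ℤ) :
    (1 - zet) * Complex.exp (-t * n) / (1 - zet * Complex.exp (-t * (2 * n))) =
      Real.sin (Real.pi / 9) / Complex.cosh (t * n + Complex.I * bet) := by
  have hpi := Real.pi_pos
  set w : ℂ := Complex.exp (Real.pi / 9 * Complex.I) with hw
  set E : ℂ := Complex.exp (t * n) with hE
  have hw0 : w ≠ 0 := Complex.exp_ne_zero _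
  have hE0 : E ≠ 0 := Complex.exp_ne_zero _
  have hz : zet = w ^ 2 := by
    rw [hw, ← Complex.exp_nat_mul]; unfold zet; congr 1; push_cast; ring
  have e1 : Complex.exp (-t * n) = E⁻¹ := by rw [hE, ← Complex.exp_neg]; congr 1; ring
  have e2 : Complex.exp (-t * (2 * n)) = E⁻¹ ^ 2 := by
    rw [← e1, ← Complex.exp_nat_mul]; congr 1; push_cast; ring
  have hb : Complex.exp (t * n + Complex.I * bet) = E * (Complex.I * w⁻¹) := by
    rw [Complex.exp_add, hE, hw, ← Complex.exp_neg]
    congr 1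
    have this : ∀ z, Complex.I * Complex.exp z = Complex.exp (Real.pi / 2 * Complex.I) * Complex.exp z := by
      intro z; rw [Complex.exp_pi_div_two_mul_I]
    rw [this, ← Complex.exp_add]
    congr 1
    unfold bet; push_cast; ring
  have hb' : Complex.exp (-(t * n + Complex.I * bet)) = E⁻¹ * (-Complex.I * w) := by
    rw [Complex.exp_neg, hb, mul_inv, mul_inv, inv_inv, Complex.inv_I]
  have hs : (Real.sin (Real.pi / 9) : ℂ) = (w⁻¹ - w) * Complex.I / 2 := by
    rw [Complex.ofReal_sin, Complex.sin, hw, ← Complex.exp_neg]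
    push_cast
    congr 4
    ring_nf
  have hc : Complex.cosh (t * n + Complex.I * bet) = (E * (Complex.I * w⁻¹) + E⁻¹ * (-Complex.I * w)) / 2 := by
    rw [Complex.cosh, hb, hb']
  have hne := cosh_ne ht n
  rw [hc] at hne ⊢
  rw [e1, e2, hz, hs]
  have hd : 1 - w ^ 2 * E⁻¹ ^ 2 ≠ 0 := by
    intro h
    apply hne
    have : (E * (Complex.I * w⁻¹) + E⁻¹ * (-Complex.I * w)) / 2 = Complex.I * E * w⁻¹ / 2 * (1 - w ^ 2 * E⁻¹ ^ 2) := by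
      field_simp
      ring
    rw [this, h, mul_zero]
  rw [div_eq_div_iff hd hne]
  field_simp
  ring

lemma Cf_bil {t : ℂ} (ht : 0 < t.re) :
    HasSum (fun n : ℤ => (-1) ^ n * Complex.exp (-2 * t * n ^ 2) *
      (Real.sin (Real.pi / 9) / Complex.cosh (t * n + Complex.I * bet))) (Cf zet (Complex.exp (-t))) := by
  simp_rw [← term_id ht]
  have hζ0 := zet_ne
  set q := Complex.exp (-t) with hq
  have hqn : ‖q‖ < 1 := norm_q ht
  have hq0 : q ≠ 0 := Complex.exp_ne_zero _
  have hne : ∀ (z : ℂ), ‖z‖ = 1 → ∀ k : ℕ, 1 - z * q ^ (2 * (k + 1)) ≠ 0 := by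
    intro z hz k h
    have h1 : z * q ^ (2 * (k + 1)) = 1 := by linear_combination -h
    have h2 := congrArg norm h1
    rw [norm_mul, hz, one_mul, norm_pow, norm_one] at h2
    have := pow_lt_one₀ (norm_nonneg q) hqn (show 2 * (k + 1) ≠ 0 by omega)
    linarith
  have hi : ‖zet⁻¹‖ = 1 := by rw [norm_inv, norm_zet, inv_one]
  set A : ℕ → ℂ := fun k => (-1) ^ k * q ^ ((k + 1) * (2 * k + 3)) * ((zet - 1) / (1 - zet * q ^ (2 * (k + 1)))) with hA
  set Bb : ℕ → ℂ := fun k => (-1) ^ k * q ^ ((k + 1) * (2 * k + 3)) * ((zet⁻¹ - 1) / (1 - zet⁻¹ * q ^ (2 * (k + 1)))) with hB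
  have hs : ∀ z : ℂ, ‖z‖ = 1 → Summable (fun k : ℕ => (-1) ^ k * q ^ ((k + 1) * (2 * k + 3)) * ((z - 1) / (1 - z * q ^ (2 * (k + 1))))) := by
    intro z hz
    have hr := norm_nonneg q
    have h1 : 0 < 1 - ‖q‖ := by linarith
    refine Summable.of_norm_bounded ((summable_geometric_of_lt_one (norm_nonneg q) hqn).mul_right (2 / (1 - ‖q‖))) ?_
    intro k
    rw [norm_mul, norm_mul, norm_pow, norm_neg, norm_one, one_pow, one_mul, norm_pow]
    refine mul_le_mul (pow_le_pow_of_le_one hr hqn.le (by nlinarith)) ?_ (by positivity) (by positivity)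
    rw [norm_div]
    have a1 : ‖z - 1‖ ≤ 2 := (norm_sub_le _ _).trans (by rw [hz, norm_one]; norm_num)
    have a2 : 1 - ‖q‖ ≤ ‖1 - z * q ^ (2 * (k + 1))‖ := by
      have := norm_sub_norm_le (1 : ℂ) (z * q ^ (2 * (k + 1)))
      rw [norm_one, norm_mul, hz, one_mul, norm_pow] at this
      have : ‖q‖ ^ (2 * (k + 1)) ≤ ‖q‖ ^ 1 := pow_le_pow_of_le_one hr hqn.le (by omega)
      rw [pow_one] at this
      linarith
    gcongr
  have hAs : Summable A := hs _ norm_zet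
  have hBs : Summable Bb := hs _ hi
  have hC : Cf zet q = 1 + (∑' k, A k) + ∑' k, Bb k := by
    unfold Cf
    rw [add_assoc, ← hAs.tsum_add hBs]
    congr 2
    funext k
    unfold Cterm
    rw [mul_add]
  rw [hC]
  apply int_sum
  · have h1 : 1 - zet ≠ 0 := by
      intro h
      have h2 : zet = 1 := by linear_combination -h
      unfold zet at h2
      rw [Complex.exp_eq_one_iff] at h2
      obtain ⟨n, hn⟩ := h2
      have hp : (2 * Real.pi * Complex.I : ℂ) ≠ 0 := Complex.two_pi_I_ne_zero
      have h3 : (2 * Real.pi * Complex.I : ℂ) * (9 * n - 1) = 0 := by linear_combination -9 * hn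
      have h4 : (9 * n - 1 : ℂ) = 0 := by
        rcases mul_eq_zero.1 h3 with h | h
        · exact absurd h hp
        · exact h
      have h5 : (9 * n - 1 : ℤ) = 0 := by exact_mod_cast h4
      omega
    simp [h1]
  · refine hAs.hasSum.congr_fun ?_
    intro k
    have e1 : ∀ m : ℕ, Complex.exp (-t * m) = q ^ m := by
      intro m; rw [hq, ← Complex.exp_nat_mul, mul_comm]
    have a1 := e1 (k+1)
    have a2 := e1 (2 * (k + 1))
    have a3 := e1 (2 * (k + 1) ^ 2)
    push_cast at a1 a2 a3 ⊢
    rw [show (-2 * t * ((k:ℂ) + 1) ^ 2) = -t * (2 * (k + 1) ^ 2) by ring, a1, a2, a3,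
      show ((k:ℤ) + 1) = ((k + 1 : ℕ) : ℤ) by push_cast; rfl, zpow_natCast, pow_succ]
    simp only [hA]
    rw [show (k + 1) * (2 * k + 3) = 2 * (k + 1) ^ 2 + (k + 1) by ring, pow_add]
    ring
  · refine hBs.hasSum.congr_fun ?_
    intro k
    have e1 : ∀ m : ℕ, Complex.exp (-t * m) = q ^ m := by
      intro m; rw [hq, ← Complex.exp_nat_mul, mul_comm]
    have e2 : ∀ m : ℕ, Complex.exp (t * m) = (q ^ m)⁻¹ := by
      intro m; rw [← e1, ← Complex.exp_neg]; congr 1; ring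
    have a1 := e2 (k+1)
    have a2 := e2 (2 * (k + 1))
    have a3 := e1 (2 * (k + 1) ^ 2)
    push_cast at a1 a2 a3 ⊢
    rw [show (-2 * t * (-((k:ℂ) + 1)) ^ 2) = -t * (2 * (k + 1) ^ 2) by ring, 
      show (-t * (-((k:ℂ) + 1))) = t * (k + 1) by ring,
      show (-t * (2 * (-((k:ℂ) + 1)))) = t * (2 * (k + 1)) by ring, a1, a2, a3,
      show (-((k:ℤ) + 1)) = -((k + 1 : ℕ) : ℤ) by push_cast; rfl, zpow_neg, zpow_natCast, ← inv_pow,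
        inv_neg_one, pow_succ]
    simp only [hB]
    rw [show (k + 1) * (2 * k + 3) = 2 * (k + 1) ^ 2 + (k + 1) by ring, pow_add]
    have n1 := hne _ hi k
    have hd : 1 - zet * (q ^ (2 * (k + 1)))⁻¹ = -zet * (q ^ (2 * (k + 1)))⁻¹ * (1 - zet⁻¹ * q ^ (2 * (k + 1))) := by
      field_simp
      ring
    rw [hd]
    have hz1 : zet⁻¹ - 1 = zet⁻¹ * (1 - zet) := by field_simp
    rw [hz1]
    set D := 1 - zet⁻¹ * q ^ (2 * (k + 1))
    rw [show q ^ (2 * (k + 1)) = q ^ (k+1) * q ^ (k+1) by rw [← pow_add]; congr 1; ring]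
    field_simp
    rw [pow_add q (2 * (k + 1) ^ 2), pow_succ q k]
    ring
end Part4

section Part5
open MeasureTheory

lemma sech_beta (p : ℂ) (h0 : 0 < p.re) (h1 : p.re < 1) :
    ∫ u : ℝ, Complex.exp (p * u) / (1 + Complex.exp u) = Real.pi / Complex.sin (Real.pi * p) := by
  have e1 := Complex.Gamma_mul_Gamma_eq_betaIntegral h0 (t := 1 - p) (by simpa using h1)
  rw [Complex.Gamma_mul_Gamma_one_sub, add_sub_cancel, Complex.Gamma_one, one_mul] at e1
  rw [e1]
  unfold Complex.betaIntegral
  rw [intervalIntegral.integral_of_le zero_le_one, integral_Ioc_eq_integral_Ioo, ← Real.range_sigmoid, ← Set.image_univ,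
    integral_image_eq_integral_abs_deriv_smul MeasurableSet.univ
      (fun x _ => (Real.hasDerivAt_sigmoid x).hasDerivWithinAt) Real.sigmoid_injective.injOn, setIntegral_univ]
  congr 1
  funext u
  set x := Real.sigmoid u with hx
  have hx0 : 0 < x := Real.sigmoid_pos u
  have hx1 : x < 1 := Real.sigmoid_lt_one u
  have hE : Real.exp u = x / (1 - x) := by
    rw [hx, ← Real.sigmoid_neg, Real.sigmoid_def, Real.sigmoid_def, neg_neg, Real.exp_neg]
    have := Real.exp_pos u
    field_simp
    ring
  have hl : u = Real.log x - Real.log (1 - x) := by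
    rw [← Real.log_div hx0.ne' (by linarith), ← hE, Real.log_exp]
  have h1x : (1 - x : ℂ) ≠ 0 := by
    exact_mod_cast (by linarith : (1 - x : ℝ) ≠ 0)
  have hxc : (x : ℂ) ≠ 0 := by exact_mod_cast hx0.ne'
  rw [abs_of_pos (mul_pos hx0 (by linarith)), show (1 - p - 1) = -p by ring]
  rw [← Complex.ofReal_exp, hE]
  rw [Complex.cpow_sub _ _ hxc, Complex.cpow_one, Complex.cpow_neg]
  rw [Complex.cpow_def_of_ne_zero hxc, Complex.cpow_def_of_ne_zero h1x, ← Complex.ofReal_log hx0.le,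
    show (1 - x : ℂ) = ((1 - x : ℝ) : ℂ) by push_cast; rfl, ← Complex.ofReal_log (by linarith), Complex.real_smul]
  rw [show p * (u:ℂ) = (Real.log x : ℂ) * p - (Real.log (1-x) : ℂ) * p by rw [hl]; push_cast; ring, Complex.exp_sub]
  have := Complex.exp_ne_zero ((Real.log (1-x) : ℂ) * p)
  push_cast
  have h3 : (1 + x / (1 - x) : ℂ) = 1 / (1 - x) := by field_simp; ring
  rw [h3]
  field_simp

lemma cosh_sector {z : ℂ} {κ : ℝ} (hκ : 0 ≤ κ) (hz : |z.im| ≤ κ * |z.re|) :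
    Real.cosh z.re ≤ (κ + 2) * ‖Complex.cosh z‖ := by
  have hn : ‖Complex.cosh z‖ ^ 2 = Real.sinh z.re ^ 2 + Real.cos z.im ^ 2 := by
    rw [← Complex.normSq_eq_norm_sq, Complex.normSq_apply]
    have e : Complex.cosh z = ((Real.cosh z.re * Real.cos z.im : ℝ) : ℂ) + ((Real.sinh z.re * Real.sin z.im : ℝ) : ℂ) * Complex.I := by
      conv_lhs => rw [← Complex.re_add_im z, Complex.cosh_add, Complex.cosh_mul_I, Complex.sinh_mul_I]
      push_cast
      ring
    rw [e]
    simp only [Complex.add_re, Complex.add_im, Complex.ofReal_re, Complex.ofReal_im, Complex.re_ofReal_mul, Complex.im_ofReal_mul, Complex.I_re, Complex.I_im]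
    linear_combination (Real.cos z.im ^ 2) * Real.cosh_sq z.re + (Real.sinh z.re ^ 2) * Real.sin_sq_add_cos_sq z.im
  have hc := Real.cosh_sq z.re
  refine (sq_le_sq₀ (Real.cosh_pos _).le (by positivity)).1 ?_
  rw [mul_pow, hn, hc]
  rcases le_or_gt 1 (κ * |z.re|) with h | h
  · have h1 : |z.re| ≤ |Real.sinh z.re| := by
      rw [Real.abs_sinh]; exact Real.self_le_sinh_iff.2 (abs_nonneg _)
    have h2 : 1 ≤ κ * |Real.sinh z.re| := h.trans (by gcongr)
    have h3 : 1 ≤ κ ^ 2 * Real.sinh z.re ^ 2 := by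
      rw [← sq_abs (Real.sinh z.re), ← mul_pow]; exact one_le_pow₀ h2
    nlinarith [sq_nonneg (Real.cos z.im), sq_nonneg (Real.sinh z.re), mul_nonneg hκ (sq_nonneg (Real.cos z.im)), mul_nonneg hκ (sq_nonneg (Real.sinh z.re)), mul_nonneg (sq_nonneg κ) (sq_nonneg (Real.cos z.im))]
  · have h1 : |z.im| ≤ 1 := hz.trans h.le
    have h2 : 1 / 2 ≤ Real.cos z.im := by
      rw [← Real.cos_abs, ← Real.cos_pi_div_three]
      apply Real.cos_le_cos_of_nonneg_of_le_pi (abs_nonneg _)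
      · linarith [Real.pi_pos]
      · linarith [Real.pi_gt_three]
    nlinarith [sq_nonneg (Real.sinh z.re), mul_nonneg hκ (sq_nonneg (Real.sinh z.re)), mul_nonneg hκ (sq_nonneg (Real.cos z.im)), mul_nonneg (sq_nonneg κ) (sq_nonneg (Real.cos z.im)), mul_nonneg (sq_nonneg κ) (sq_nonneg (Real.sinh z.re))]

lemma inv_cosh_sector {z : ℂ} {κ : ℝ} (hκ : 0 ≤ κ) (hz : |z.im| ≤ κ * |z.re|) :
    Complex.cosh z ≠ 0 ∧ ‖(Complex.cosh z)⁻¹‖ ≤ 2 * (κ + 2) * Real.exp (-|z.re|) := by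
  have h := cosh_sector hκ hz
  have h1 : Real.exp |z.re| ≤ 2 * Real.cosh z.re := by
    rw [← Real.cosh_abs, Real.cosh_eq]; linarith [Real.exp_pos (-|z.re|)]
  have h2 := Real.exp_pos |z.re|
  have h3 : 0 < ‖Complex.cosh z‖ := by
    by_contra hh
    have : ‖Complex.cosh z‖ = 0 := le_antisymm (not_lt.1 hh) (norm_nonneg _)
    rw [this] at h; linarith
  refine ⟨norm_pos_iff.1 h3, ?_⟩
  rw [norm_inv, Real.exp_neg, ← div_eq_mul_inv, le_div_iff₀ h2, inv_mul_le_iff₀ h3]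
  linarith

lemma integrable_exp_abs {c : ℝ} (hc : 0 < c) : Integrable (fun v : ℝ => Real.exp (-c * |v|)) := by
  rw [← integrableOn_univ, ← Set.Iic_union_Ioi (a := (0:ℝ))]
  apply IntegrableOn.union
  · refine (integrableOn_exp_mul_Iic hc 0).congr_fun ?_ measurableSet_Iic
    intro x hx
    simp only [Set.mem_Iic] at hx
    simp only
    rw [abs_of_nonpos hx]; ring_nf
  · refine (integrableOn_exp_mul_Ioi (neg_lt_zero.2 hc) 0).congr_fun ?_ measurableSet_Ioi
    intro x hx
    simp only [Set.mem_Ioi] at hx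
    simp only
    rw [abs_of_pos hx]

lemma integral_exp_abs {c : ℝ} (hc : 0 < c) : ∫ v : ℝ, Real.exp (-c * |v|) = 2 / c := by
  rw [integral_comp_abs (f := fun x => Real.exp (-c * x)), integral_exp_mul_Ioi (neg_lt_zero.2 hc) 0]
  simp
  field_simp

lemma mul_exp_le {c x : ℝ} (hc : 0 < c) : x * Real.exp (-c * x) ≤ (2 / c) * Real.exp (-(c / 2) * x) := by
  have h1 : x ≤ (2 / c) * Real.exp (c / 2 * x) := by
    have := Real.add_one_le_exp (c / 2 * x)
    calc x = (2 / c) * (c / 2 * x) := by field_simp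
      _ ≤ _ := by gcongr; linarith
  calc _ ≤ (2 / c) * Real.exp (c / 2 * x) * Real.exp (-c * x) := by gcongr
    _ = _ := by rw [mul_assoc, ← Real.exp_add]; congr 2; ring

/-- The kernel. -/
noncomputable def hk (s : ℂ) (v : ℝ) : ℂ := Complex.exp (-2 * bet * s * v) * (Complex.cosh (Real.pi * s * v))⁻¹

lemma sector_v {s : ℂ} {κ : ℝ} (hs : 0 < s.re) (h : |s.im| ≤ κ * s.re) (v : ℝ) :
    |(Real.pi * s * v : ℂ).im| ≤ κ * |(Real.pi * s * v : ℂ).re| := by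
  have e1 : (Real.pi * s * v : ℂ).im = Real.pi * s.im * v := by simp [Complex.mul_im]
  have e2 : (Real.pi * s * v : ℂ).re = Real.pi * s.re * v := by simp [Complex.mul_re]
  rw [e1, e2, abs_mul, abs_mul, abs_mul, abs_mul, abs_of_pos Real.pi_pos, abs_of_pos hs]
  have := mul_le_mul_of_nonneg_left h Real.pi_pos.le
  have := mul_le_mul_of_nonneg_right this (abs_nonneg v)
  nlinarith

lemma cosh_bd {s : ℂ} {κ : ℝ} (hκ : 0 ≤ κ) (hs : 0 < s.re) (h : |s.im| ≤ κ * s.re) (v : ℝ) :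
    Complex.cosh (Real.pi * s * v) ≠ 0 ∧
    ‖(Complex.cosh (Real.pi * s * v))⁻¹‖ ≤ 2 * (κ + 2) * Real.exp (-(Real.pi * s.re * |v|)) := by
  have := inv_cosh_sector hκ (sector_v hs h v)
  have e2 : (Real.pi * s * v : ℂ).re = Real.pi * s.re * v := by simp [Complex.mul_re]
  rwa [e2, abs_mul, abs_mul, abs_of_pos Real.pi_pos, abs_of_pos hs] at this

lemma hk_bd {s : ℂ} {κ : ℝ} (hκ : 0 ≤ κ) (hs : 0 < s.re) (h : |s.im| ≤ κ * s.re) (v : ℝ) :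
    ‖hk s v‖ ≤ 2 * (κ + 2) * Real.exp (-(2 * Real.pi / 9 * s.re) * |v|) := by
  unfold hk
  rw [norm_mul, Complex.norm_exp]
  have e : (-2 * bet * s * v : ℂ).re = -(7 * Real.pi / 9) * s.re * v := by
    rw [show (-2 * bet * s * v : ℂ) = ((-2 * bet * v : ℝ) : ℂ) * s by push_cast; ring, Complex.re_ofReal_mul]
    unfold bet; ring
  have h1 : (-2 * bet * s * v : ℂ).re ≤ (7 * Real.pi / 9) * s.re * |v| := by
    rw [e]
    have := neg_abs_le v
    have h2 : 0 < (7 * Real.pi / 9) * s.re := by have := Real.pi_pos; positivity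
    nlinarith
  calc _ ≤ Real.exp ((7 * Real.pi / 9) * s.re * |v|) * (2 * (κ + 2) * Real.exp (-(Real.pi * s.re * |v|))) := by
        gcongr
        exact (cosh_bd hκ hs h v).2
    _ = _ := by
        rw [mul_left_comm, ← Real.exp_add]; congr 2; ring

lemma sector_self {s : ℂ} (hs : 0 < s.re) : |s.im| ≤ (|s.im| / s.re) * s.re := by
  rw [div_mul_cancel₀ _ hs.ne']

lemma hk_cont {s : ℂ} (hs : 0 < s.re) : Continuous (hk s) := by
  unfold hk
  refine Continuous.mul (by fun_prop) (Continuous.inv₀ (by fun_prop) ?_)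
  intro v
  exact (cosh_bd (κ := |s.im| / s.re) (by positivity) hs (sector_self hs) v).1

lemma hk_int {s : ℂ} (hs : 0 < s.re) : Integrable (hk s) := by
  have hp := Real.pi_pos
  refine Integrable.mono' ((integrable_exp_abs (c := 2 * Real.pi / 9 * s.re) (by positivity)).const_mul (2 * (|s.im| / s.re + 2))) 
    (hk_cont hs).aestronglyMeasurable ?_
  filter_upwards with v
  exact hk_bd (by positivity) hs (sector_self hs) v

lemma hk_deriv {s : ℂ} (hs : 0 < s.re) (v : ℝ) :
    HasDerivAt (fun s => hk s v) (v * (-2 * bet - Real.pi * (Complex.sinh (Real.pi * s * v) * (Complex.cosh (Real.pi * s * v))⁻¹)) * hk s v) s := by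
  have h0 := (cosh_bd (κ := |s.im| / s.re) (by positivity) hs (sector_self hs) v).1
  have h1 : HasDerivAt (fun s : ℂ => -2 * bet * s * (v:ℂ)) (-2 * bet * v) s := by
    simpa using ((hasDerivAt_id s).const_mul (-2 * bet : ℂ)).mul_const (v:ℂ)
  have h2 : HasDerivAt (fun s : ℂ => Real.pi * s * (v:ℂ)) (Real.pi * v) s := by
    simpa using ((hasDerivAt_id s).const_mul (Real.pi : ℂ)).mul_const (v:ℂ)
  have h3 := h1.cexp.mul ((h2.ccosh).inv h0)
  unfold hk
  refine h3.congr_deriv ?_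
  simp only [Pi.inv_apply]
  generalize Complex.cosh (Real.pi * s * v) = Cc at h0 ⊢
  generalize Complex.sinh (Real.pi * s * v) = Ss
  generalize Complex.exp (-2 * bet * s * v) = Ee
  field_simp
  ring

lemma norm_sinh_le (z : ℂ) : ‖Complex.sinh z‖ ≤ Real.exp |z.re| := by
  rw [Complex.sinh, norm_div, Complex.norm_two, div_le_iff₀ two_pos]
  refine (norm_sub_le _ _).trans ?_
  rw [Complex.norm_exp, Complex.norm_exp, Complex.neg_re]
  have h1 := Real.exp_le_exp.2 (le_abs_self z.re)
  have h2 := Real.exp_le_exp.2 (neg_le_abs z.re)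
  linarith

lemma Fk_diff (x : ℝ) {s₀ : ℂ} (hs₀ : 0 < s₀.re) :
    DifferentiableAt ℂ (fun s => ∫ v : ℝ, Complex.exp (2 * Complex.I * x * v) * hk s v) s₀ := by
  have hpi := Real.pi_pos
  set r := s₀.re / 2 with hr
  have hr0 : 0 < r := by positivity
  set κ := 2 * (|s₀.im| / s₀.re) + 1 with hκ
  have hκ0 : 0 ≤ κ := by positivity
  have hball : ∀ s ∈ Metric.ball s₀ r, r ≤ s.re ∧ |s.im| ≤ κ * s.re := by
    intro s hs
    rw [Metric.mem_ball, dist_eq_norm] at hs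
    have a1 := (Complex.abs_re_le_norm (s - s₀)).trans hs.le
    have a2 := (Complex.abs_im_le_norm (s - s₀)).trans hs.le
    rw [Complex.sub_re] at a1
    rw [Complex.sub_im] at a2
    have b1 : r ≤ s.re := by have := (abs_le.1 a1).1; linarith
    refine ⟨b1, ?_⟩
    have b2 : |s.im| ≤ |s₀.im| + r := by
      have := abs_sub_abs_le_abs_sub s.im s₀.im; linarith
    have b3 : κ * r = |s₀.im| + r := by
      rw [hκ, hr]; field_simp
    calc _ ≤ κ * r := by rw [b3]; exact b2
      _ ≤ _ := by gcongr
  have hE : ∀ v : ℝ, ‖Complex.exp (2 * Complex.I * x * v)‖ = 1 := by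
    intro v
    rw [show (2 * Complex.I * x * v : ℂ) = ((2 * x * v : ℝ) : ℂ) * Complex.I by push_cast; ring]
    exact Complex.norm_exp_ofReal_mul_I _
  set c := 2 * Real.pi / 9 * r with hc
  have hc0 : 0 < c := by positivity
  have := hasDerivAt_integral_of_dominated_loc_of_deriv_le (μ := volume) (𝕜 := ℂ)
    (F := fun s (v : ℝ) => Complex.exp (2 * Complex.I * x * v) * hk s v)
    (F' := fun s (v : ℝ) => Complex.exp (2 * Complex.I * x * v) * 
      (v * (-2 * bet - Real.pi * (Complex.sinh (Real.pi * s * v) * (Complex.cosh (Real.pi * s * v))⁻¹)) * hk s v))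
    (bound := fun v => ((2 * bet + Real.pi * (2 * (κ + 2))) * (2 * (κ + 2)) * (2 / c)) * Real.exp (-(c / 2) * |v|))
    (Metric.ball_mem_nhds s₀ hr0) ?_ ?_ ?_ ?_ ?_ ?_
  · exact this.2.differentiableAt
  · filter_upwards [Metric.ball_mem_nhds s₀ hr0] with s hs
    have := hk_cont (hr0.trans_le (hball s hs).1)
    exact (Continuous.mul (by fun_prop) this).aestronglyMeasurable
  · refine ((hk_int hs₀).norm).mono' (Continuous.mul (by fun_prop) (hk_cont hs₀)).aestronglyMeasurable ?_
    filter_upwards with v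
    rw [norm_mul, hE, one_mul]
  · have h1 := hk_cont hs₀
    have h2 : Continuous (fun v : ℝ => (Complex.cosh (Real.pi * s₀ * v))⁻¹) :=
      Continuous.inv₀ (by fun_prop) (fun v => (cosh_bd (κ := |s₀.im| / s₀.re) (by positivity) hs₀ (sector_self hs₀) v).1)
    exact Continuous.aestronglyMeasurable (by fun_prop)
  · filter_upwards with v s hs
    obtain ⟨b1, b2⟩ := hball s hs
    have hsr : 0 < s.re := hr0.trans_le b1
    rw [norm_mul, hE, one_mul, norm_mul, norm_mul, Complex.norm_real, Real.norm_eq_abs]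
    have t1 : ‖Complex.sinh (Real.pi * s * v) * (Complex.cosh (Real.pi * s * v))⁻¹‖ ≤ 2 * (κ + 2) := by
      rw [norm_mul]
      have a1 := norm_sinh_le (Real.pi * s * v)
      have e2 : (Real.pi * s * v : ℂ).re = Real.pi * s.re * v := by simp [Complex.mul_re]
      rw [e2, abs_mul, abs_mul, abs_of_pos hpi, abs_of_pos hsr] at a1
      have a2 := (cosh_bd hκ0 hsr b2 v).2
      calc _ ≤ Real.exp (Real.pi * s.re * |v|) * (2 * (κ + 2) * Real.exp (-(Real.pi * s.re * |v|))) := by gcongr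
        _ = _ := by rw [mul_left_comm, ← Real.exp_add]; simp
    have hb0 : 0 < bet := by unfold bet; positivity
    have t2 : ‖(-2 * bet - Real.pi * (Complex.sinh (Real.pi * s * v) * (Complex.cosh (Real.pi * s * v))⁻¹) : ℂ)‖ ≤
        2 * bet + Real.pi * (2 * (κ + 2)) := by
      refine (norm_sub_le _ _).trans (add_le_add ?_ ?_)
      · rw [norm_mul, Complex.norm_real, norm_neg, Complex.norm_two, Real.norm_eq_abs, abs_of_pos hb0]
      · rw [norm_mul, Complex.norm_real, Real.norm_eq_abs, abs_of_pos hpi]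
        gcongr
    have t3 : ‖hk s v‖ ≤ 2 * (κ + 2) * Real.exp (-c * |v|) := by
      refine (hk_bd hκ0 hsr b2 v).trans ?_
      have : c ≤ 2 * Real.pi / 9 * s.re := by rw [hc]; gcongr
      gcongr
    have t4 := mul_exp_le (x := |v|) hc0
    calc _ ≤ |v| * (2 * bet + Real.pi * (2 * (κ + 2))) * (2 * (κ + 2) * Real.exp (-c * |v|)) := by gcongr
      _ = (2 * bet + Real.pi * (2 * (κ + 2))) * (2 * (κ + 2)) * (|v| * Real.exp (-c * |v|)) := by ring
      _ ≤ (2 * bet + Real.pi * (2 * (κ + 2))) * (2 * (κ + 2)) * ((2 / c) * Real.exp (-(c / 2) * |v|)) := by gcongr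
      _ = _ := by ring
  · exact (integrable_exp_abs (by positivity)).const_mul _
  · filter_upwards with v s hs
    exact (hk_deriv (hr0.trans_le (hball s hs).1) v).const_mul _

lemma alg_aux {a b c d e : ℂ} (h : c * e = a * b) (he : e ≠ 0) (hd : d ≠ 0) :
    a * (b * (e * d / 2)⁻¹) = 2 * (c / d) := by
  field_simp
  linear_combination -h

lemma sech_real (x : ℝ) {s : ℝ} (hs : 0 < s) :
    (s : ℂ) * ∫ v : ℝ, Complex.exp (2 * Complex.I * x * v) * hk s v = (Complex.cosh (x / s + Complex.I * bet))⁻¹ := by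
  have hpi := Real.pi_pos
  have hpc : (Real.pi : ℂ) ≠ 0 := by exact_mod_cast hpi.ne'
  have hsc : (s : ℂ) ≠ 0 := by exact_mod_cast hs.ne'
  set p : ℂ := 1 / 2 + (Complex.I * x / s - bet) / Real.pi with hp
  have hpre : p.re = 1 / 2 - 7 / 18 := by
    rw [hp, show (Complex.I * x / s : ℂ) = ((x / s : ℝ) : ℂ) * Complex.I by push_cast; ring]
    rw [Complex.add_re, Complex.div_ofReal_re, Complex.sub_re, Complex.re_ofReal_mul, Complex.I_re, Complex.ofReal_re]
    unfold bet
    field_simp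
    norm_num
    ring
  have h1 := sech_beta p (by rw [hpre]; norm_num) (by rw [hpre]; norm_num)
  have h2 := Measure.integral_comp_mul_left (fun u : ℝ => Complex.exp (p * u) / (1 + Complex.exp u)) (2 * Real.pi * s)
  have h3 : ∀ v : ℝ, Complex.exp (2 * Complex.I * x * v) * hk s v =
      2 * (Complex.exp (p * ((2 * Real.pi * s * v : ℝ) : ℂ)) / (1 + Complex.exp ((2 * Real.pi * s * v : ℝ) : ℂ))) := by
    intro v
    unfold hk
    have hc : Complex.cosh (Real.pi * s * v) = Complex.exp (-(Real.pi * s * v)) * (1 + Complex.exp ((2 * Real.pi * s * v : ℝ) : ℂ)) / 2 := by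
      rw [Complex.cosh, mul_add, mul_one, ← Complex.exp_add, add_comm]
      congr 3
      push_cast; ring_nf
    rw [hc]
    have e1 : (1 + Complex.exp ((2 * Real.pi * s * v : ℝ) : ℂ)) ≠ 0 := by
      rw [← Complex.ofReal_exp]
      have := Real.exp_pos (2 * Real.pi * s * v)
      exact_mod_cast (by positivity : (1 + Real.exp (2 * Real.pi * s * v)) ≠ 0)
    have e2 := Complex.exp_ne_zero (-(Real.pi * s * v) : ℂ)
    have e3 : Complex.exp (p * ((2 * Real.pi * s * v : ℝ) : ℂ)) * Complex.exp (-(Real.pi * s * v)) =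
        Complex.exp (2 * Complex.I * x * v) * Complex.exp (-2 * bet * s * v) := by
      rw [← Complex.exp_add, ← Complex.exp_add]
      congr 1
      rw [hp]
      push_cast
      field_simp
      ring
    exact alg_aux e3 e2 e1
  simp_rw [h3]
  rw [integral_const_mul, h2, h1, abs_of_pos (by positivity), Complex.real_smul]
  have h4 : Complex.sin (Real.pi * p) = Complex.cosh (x / s + Complex.I * bet) := by
    rw [hp, ← Complex.cos_mul_I, ← Complex.cos_sub_pi_div_two]
    congr 1
    field_simp
    linear_combination (-2 * (s:ℂ) * bet) * Complex.I_sq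
  rw [h4]
  push_cast
  field_simp

lemma sech_id (n : ℤ) {s : ℂ} (hs : 0 < s.re) :
    s * ∫ v : ℝ, Complex.exp (2 * Complex.I * n * v) * hk s v = (Complex.cosh (n / s + Complex.I * bet))⁻¹ := by
  have hopen : IsOpen {s : ℂ | 0 < s.re} := isOpen_lt continuous_const Complex.continuous_re
  have hconv : Convex ℝ {s : ℂ | 0 < s.re} := convex_halfSpace_re_gt 0
  have h1 : AnalyticOnNhd ℂ (fun s => s * ∫ v : ℝ, Complex.exp (2 * Complex.I * ((n : ℝ) : ℂ) * v) * hk s v) {s : ℂ | 0 < s.re} := by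
    apply DifferentiableOn.analyticOnNhd _ hopen
    intro s hs
    exact (differentiableAt_id.mul (Fk_diff n hs)).differentiableWithinAt
  have h2 : AnalyticOnNhd ℂ (fun s => (Complex.cosh (((n : ℝ) : ℂ) / s + Complex.I * bet))⁻¹) {s : ℂ | 0 < s.re} := by
    apply DifferentiableOn.analyticOnNhd _ hopen
    intro s hs
    have hs' : 0 < s.re := hs
    have hs0 : s ≠ 0 := by rintro rfl; simp at hs'
    refine DifferentiableAt.differentiableWithinAt (DifferentiableAt.inv ?_ ?_)
    · have : DifferentiableAt ℂ (fun s : ℂ => ((n : ℝ) : ℂ) / s + Complex.I * bet) s := by fun_prop (disch := assumption)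
      exact this.ccosh
    · have h := cosh_ne (t := s⁻¹) (by rw [Complex.inv_re]; exact div_pos hs' (Complex.normSq_pos.2 hs0)) n
      rw [inv_mul_eq_div] at h
      simpa using h
  have h3 := h1.eqOn_of_preconnected_of_frequently_eq h2 hconv.isPreconnected (z₀ := 1) (by simp) ?_
  · have := h3 hs
    simpa using this
  · have ht : Filter.Tendsto (fun k : ℕ => ((1 + 1 / ((k:ℝ) + 1) : ℝ) : ℂ)) Filter.atTop (nhdsWithin 1 {1}ᶜ) := by
      apply tendsto_nhdsWithin_of_tendsto_nhds_of_eventually_within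
      · have := (tendsto_one_div_add_atTop_nhds_zero_nat (𝕜 := ℝ)).const_add 1
        rw [add_zero] at this
        have h := (Complex.continuous_ofReal.tendsto 1).comp this
        rw [Complex.ofReal_one] at h
        exact h
      · filter_upwards with k
        have : (0:ℝ) < 1 / ((k:ℝ) + 1) := by positivity
        simp only [Set.mem_compl_iff, Set.mem_singleton_iff]
        intro h
        have h' : (1 + 1 / ((k:ℝ) + 1) : ℝ) = 1 := by exact_mod_cast h
        linarith
    refine ht.frequently (Filter.Frequently.of_forall ?_)
    intro k
    exact sech_real n (by positivity)
end Part5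

section Part6
open MeasureTheory

noncomputable def gK (s w : ℂ) (n : ℤ) : ℂ := Complex.exp (-s * (w + Real.pi * (1 / 2 - n)) ^ 2 / 2)

lemma theta_trans {t : ℂ} (ht : 0 < t.re) (w : ℂ) :
    HasSum (gK t⁻¹ w) ((2 * t / Real.pi) ^ (1 / 2 : ℂ) * jacobiTheta₂ (1 / 2 + w / Real.pi) (2 * Complex.I * t / Real.pi)) := by
  have hpi : (Real.pi : ℂ) ≠ 0 := by exact_mod_cast Real.pi_ne_zero
  have ht0 : t ≠ 0 := by rintro rfl; simp at ht
  have hτ := tau_im ht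
  set τ : ℂ := 2 * Complex.I * t / Real.pi with hτd
  set z : ℂ := 1 / 2 + w / Real.pi with hz
  have hτ0 : τ ≠ 0 := by intro h; rw [h] at hτ; simp at hτ
  have hτ' : 0 < (-1 / τ).im := by
    rw [neg_div, Complex.neg_im, one_div, Complex.inv_im, neg_div, neg_neg]
    exact div_pos hτ (Complex.normSq_pos.2 hτ0)
  have hP : (2 * t / Real.pi : ℂ) ^ (1 / 2 : ℂ) ≠ 0 := by
    rw [Complex.cpow_def_of_ne_zero (div_ne_zero (mul_ne_zero two_ne_zero ht0) hpi)]
    exact Complex.exp_ne_zero _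
  have hIτ : -Complex.I * τ = 2 * t / Real.pi := by
    rw [hτd]; linear_combination (-2 * t / Real.pi) * Complex.I_sq
  rw [jacobiTheta₂_functional_equation, hIτ, ← mul_assoc, ← mul_assoc, mul_one_div_cancel hP, one_mul]
  refine ((hasSum_jacobiTheta₂_term (z / τ) hτ').mul_left _).congr_fun ?_
  intro n
  unfold gK jacobiTheta₂_term
  rw [← Complex.exp_add]
  congr 1
  have hw : w = Real.pi * z - Real.pi / 2 := by rw [hz]; field_simp; ring
  have ht1 : t⁻¹ = 2 * Complex.I / (Real.pi * τ) := by
    rw [hτd]; field_simp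
  rw [hw, ht1]
  field_simp
  ring

lemma norm_term (n : ℤ) (v : ℝ) (τ : ℂ) :
    ‖jacobiTheta₂_term n (1 / 2 + v / Real.pi) τ‖ = ‖jacobiTheta₂_term n 0 τ‖ := by
  rw [norm_jacobiTheta₂_term, norm_jacobiTheta₂_term]
  have : ((1 / 2 : ℂ) + v / Real.pi) = ((1 / 2 + v / Real.pi : ℝ) : ℂ) := by push_cast; rfl
  rw [this, Complex.ofReal_im, Complex.zero_im]

lemma Cf_int {t : ℂ} (ht : 0 < t.re) : Cf zet (Complex.exp (-t)) =
    Real.sin (Real.pi / 9) * t⁻¹ * ∫ v : ℝ, jacobiTheta₂ (1 / 2 + v / Real.pi) (2 * Complex.I * t / Real.pi) * hk t⁻¹ v := by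
  have hpi : (Real.pi : ℂ) ≠ 0 := by exact_mod_cast Real.pi_ne_zero
  have ht0 : t ≠ 0 := by rintro rfl; simp at ht
  have hs : 0 < (t⁻¹).re := by rw [Complex.inv_re]; exact div_pos ht (Complex.normSq_pos.2 ht0)
  have hτ := tau_im ht
  set τ : ℂ := 2 * Complex.I * t / Real.pi with hτd
  have hF : ∀ n : ℤ, Integrable (fun v : ℝ => jacobiTheta₂_term n (1 / 2 + v / Real.pi) τ * hk t⁻¹ v) := by
    intro n
    have hc : Continuous (fun v : ℝ => jacobiTheta₂_term n (1 / 2 + v / Real.pi) τ) := by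
      unfold jacobiTheta₂_term; fun_prop
    refine ((hk_int hs).norm.const_mul ‖jacobiTheta₂_term n 0 τ‖).mono' (hc.mul (hk_cont hs)).aestronglyMeasurable ?_
    filter_upwards with v
    rw [norm_mul, norm_term]
  have hsum : Summable (fun n : ℤ => ∫ v : ℝ, ‖jacobiTheta₂_term n (1 / 2 + v / Real.pi) τ * hk t⁻¹ v‖) := by
    simp_rw [norm_mul, norm_term, integral_const_mul]
    exact ((hasSum_jacobiTheta₂_term 0 hτ).summable.norm).mul_right _
  have h1 := (hasSum_integral_of_summable_integral_norm hF hsum).mul_left (Real.sin (Real.pi / 9) * t⁻¹ : ℂ)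
  refine (Cf_bil ht).unique ?_
  have e : (fun v : ℝ => jacobiTheta₂ (1 / 2 + v / Real.pi) τ * hk t⁻¹ v) =
      fun v : ℝ => ∑' n : ℤ, jacobiTheta₂_term n (1 / 2 + v / Real.pi) τ * hk t⁻¹ v := by
    funext v
    rw [tsum_mul_right]; rfl
  rw [e]
  refine h1.congr_fun ?_
  intro n
  have h2 := sech_id n hs
  rw [div_inv_eq_mul, mul_comm (n:ℂ)] at h2
  rw [div_eq_mul_inv, ← h2]
  have h3 : ∀ v : ℝ, jacobiTheta₂_term n (1 / 2 + v / Real.pi) τ * hk t⁻¹ v =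
      ((-1) ^ n * Complex.exp (-2 * t * n ^ 2)) * (Complex.exp (2 * Complex.I * n * v) * hk t⁻¹ v) := by
    intro v
    rw [← neg_one_exp, ← mul_assoc, ← Complex.exp_add, ← Complex.exp_add]
    congr 1
    unfold jacobiTheta₂_term
    congr 1
    rw [hτd]
    field_simp
    linear_combination (2 * (n:ℂ)^2 * t) * Complex.I_sq
  simp_rw [h3]
  rw [integral_const_mul]
  ring

noncomputable def Phi (s w : ℂ) : ℂ := ∑' n : ℤ, gK s w n

lemma Rf_ratio {t : ℂ} (ht : 0 < t.re) :
    Rf zet (Complex.exp (-t)) * Phi t⁻¹ (Complex.I * t / 2) =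
      Real.sin (Real.pi / 9) * t⁻¹ * ∫ v : ℝ, Phi t⁻¹ v * hk t⁻¹ v := by
  have hq := norm_q ht
  have e1 := Pf_theta hq
  rw [theta_bil ht] at e1
  have e2 := Rf_eq norm_zet hq
  have e3 : Phi t⁻¹ (Complex.I * t / 2) = _ := (theta_trans ht _).tsum_eq
  have e4 : ∀ v : ℝ, Phi t⁻¹ v = _ := fun v => (theta_trans ht v).tsum_eq
  have e5 : ∫ v : ℝ, Phi t⁻¹ v * hk t⁻¹ v = (2 * t / Real.pi) ^ (1 / 2 : ℂ) * ∫ v : ℝ, jacobiTheta₂ (1 / 2 + v / Real.pi) (2 * Complex.I * t / Real.pi) * hk t⁻¹ v := by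
    rw [← integral_const_mul]
    congr 1
    funext v
    rw [e4, mul_assoc]
  rw [e5, e3, e2, Cf_int ht]
  rw [show Complex.I * t / 2 / (Real.pi : ℂ) = Complex.I * t / (2 * Real.pi) by rw [div_div]]
  generalize (∫ v : ℝ, jacobiTheta₂ (1 / 2 + v / Real.pi) (2 * Complex.I * t / Real.pi) * hk t⁻¹ v) = II
  generalize jacobiTheta₂ (1 / 2 + Complex.I * t / (2 * Real.pi)) (2 * Complex.I * t / Real.pi) = JJ at e1 ⊢
  generalize (2 * t / Real.pi) ^ (1 / 2 : ℂ) = PP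
  linear_combination (PP * (Real.sin (Real.pi / 9) * t⁻¹ * II)) * e1
end Part6

section Part7
open MeasureTheory

noncomputable def gd (n : ℤ) : ℝ := Real.exp (-(|(n:ℝ) - 1/2| - 3/2))

lemma gd_summable : Summable gd := by
  have h1 : Summable (fun n : ℕ => Real.exp (2 : ℝ) * Real.exp (-(n:ℝ))) := by
    apply Summable.mul_left
    exact Real.summable_exp_neg_nat
  have hb : ∀ n : ℤ, gd n ≤ Real.exp 2 * Real.exp (-|(n:ℝ)|) := by
    intro n
    unfold gd
    rw [← Real.exp_add]
    apply Real.exp_le_exp.2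
    have := abs_sub_abs_le_abs_sub (n:ℝ) (1/2)
    rw [abs_of_pos (show (0:ℝ) < 1/2 by norm_num)] at this
    linarith
  apply Summable.of_nat_of_neg
  · refine Summable.of_nonneg_of_le (fun n => (Real.exp_pos _).le) (fun n => ?_) h1
    have := hb n
    simpa using this
  · refine Summable.of_nonneg_of_le (fun n => (Real.exp_pos _).le) (fun n => ?_) h1
    have := hb (-n)
    simpa using this

lemma gd_nonneg (n : ℤ) : 0 ≤ gd n := (Real.exp_pos _).le

lemma K_ge {n : ℤ} (h0 : n ≠ 0) (h1 : n ≠ 1) : 3/2 ≤ |(n:ℝ) - 1/2| := by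
  rcases lt_or_ge n 0 with h | h
  · have : (n:ℝ) ≤ -1 := by exact_mod_cast (by omega : n ≤ -1)
    rw [abs_of_neg (by linarith)]; linarith
  · have : (2:ℝ) ≤ n := by exact_mod_cast (by omega : 2 ≤ n)
    rw [abs_of_pos (by linarith)]; linarith

/-- split off two terms of an integer sum, with domination of the rest -/
lemma split_bd {f : ℤ → ℂ} {M : ℝ} (hf : Summable f) (hM : 0 ≤ M)
    (h : ∀ n : ℤ, n ≠ 0 → n ≠ 1 → ‖f n‖ ≤ M * gd n) :
    ‖(∑' n, f n) - f 0 - f 1‖ ≤ M * ∑' n, gd n := by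
  have h2 : (∑' n, f n) - f 0 - f 1 = ∑' n, (if n = 0 ∨ n = 1 then 0 else f n) := by
    have hs := hf.hasSum
    have e := hs.sub ((hasSum_ite_eq (0:ℤ) (f 0)).add (hasSum_ite_eq (1:ℤ) (f 1)))
    have e' := e.tsum_eq
    rw [sub_sub, ← e']
    congr 1
    funext n
    by_cases h0 : n = 0
    · subst h0; simp
    by_cases h1 : n = 1
    · subst h1; simp
    simp [h0, h1]
  rw [h2, ← tsum_mul_left]
  refine tsum_of_norm_bounded (gd_summable.mul_left M).hasSum ?_
  intro n
  by_cases hn : n = 0 ∨ n = 1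
  · simp only [hn, if_true, norm_zero]
    exact mul_nonneg hM (gd_nonneg n)
  · simp only [hn, if_false]
    push Not at hn
    exact h n hn.1 hn.2

lemma norm_gK (s : ℂ) (v : ℝ) (n : ℤ) :
    ‖gK s v n‖ = Real.exp (-(s.re * ((v + Real.pi * (1/2 - n)) ^ 2 / 2))) := by
  unfold gK
  rw [Complex.norm_exp]
  congr 1
  have : (-s * ((v:ℂ) + Real.pi * (1 / 2 - n)) ^ 2 / 2) = (((-((v + Real.pi * (1/2 - n)) ^ 2 / 2) : ℝ)) : ℂ) * s := by
    push_cast; ring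
  rw [this, Complex.re_ofReal_mul]
  ring

lemma gK_summable {s : ℂ} (hs : 0 < s.re) (w : ℂ) : Summable (gK s w) := by
  have hs0 : s ≠ 0 := by rintro rfl; simp at hs
  have := (theta_trans (t := s⁻¹) (by rw [Complex.inv_re]; exact div_pos hs (Complex.normSq_pos.2 hs0)) w).summable
  rwa [inv_inv] at this

lemma Phi_cont {s : ℂ} (hs : 0 < s.re) : Continuous (fun v : ℝ => Phi s v) := by
  have hs0 : s ≠ 0 := by rintro rfl; simp at hs
  have hs' : 0 < (s⁻¹).re := by rw [Complex.inv_re]; exact div_pos hs (Complex.normSq_pos.2 hs0)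
  have : (fun v : ℝ => Phi s v) = fun v : ℝ => (2 * s⁻¹ / Real.pi) ^ (1 / 2 : ℂ) * jacobiTheta₂ (1 / 2 + v / Real.pi) (2 * Complex.I * s⁻¹ / Real.pi) := by
    funext v
    have := (theta_trans hs' v).tsum_eq
    rw [inv_inv] at this
    exact this
  rw [this]
  refine continuous_const.mul ?_
  rw [continuous_iff_continuousAt]
  intro v
  have h1 := continuousAt_jacobiTheta₂ (1 / 2 + (v:ℂ) / Real.pi) (tau_im hs')
  have h2 : ContinuousAt (fun v : ℝ => ((1 / 2 + (v:ℂ) / Real.pi, 2 * Complex.I * s⁻¹ / Real.pi) : ℂ × ℂ)) v := by fun_prop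
  exact ContinuousAt.comp (f := fun v : ℝ => ((1 / 2 + (v:ℂ) / Real.pi, 2 * Complex.I * s⁻¹ / Real.pi) : ℂ × ℂ)) h1 h2

lemma hk_bd2 {s : ℂ} (hs : 0 < s.re) (h : |s.im| ≤ 4 * s.re) (v : ℝ) :
    ‖hk s v‖ ≤ 12 * Real.exp (-(s.re * (7 * Real.pi / 9 * v + Real.pi * |v|))) := by
  unfold hk
  rw [norm_mul, Complex.norm_exp]
  have e : (-2 * bet * s * v : ℂ).re = -(7 * Real.pi / 9) * s.re * v := by
    have : (-2 * bet * s * v : ℂ) = ((-2 * bet * v : ℝ) : ℂ) * s := by push_cast; ring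
    rw [this, Complex.re_ofReal_mul]; unfold bet; ring
  rw [e]
  have h1 := (cosh_bd (by norm_num) hs h v).2
  calc _ ≤ Real.exp (-(7 * Real.pi / 9) * s.re * v) * (2 * (4 + 2) * Real.exp (-(Real.pi * s.re * |v|))) := by gcongr
    _ = 12 * (Real.exp (-(7 * Real.pi / 9) * s.re * v) * Real.exp (-(Real.pi * s.re * |v|))) := by ring
    _ = _ := by rw [← Real.exp_add]; ring_nf

/-- the main gaussian -/
noncomputable def mg (s : ℂ) (v : ℝ) : ℂ :=
  2 * Complex.exp (-s / 2 * v ^ 2 + (-(5 * Real.pi / 18) * s) * v + (-(Real.pi ^ 2 / 8) * s))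

lemma n0_id {s : ℂ} (v : ℝ) (hc : Complex.cosh (Real.pi * s * v) ≠ 0) :
    gK s v 0 * hk s v - mg s v = - (gK s v 0 * Complex.exp (-2 * bet * s * v) * Complex.exp (2 * Real.pi * s * v) * (Complex.cosh (Real.pi * s * v))⁻¹) := by
  have h1 : (Complex.cosh (Real.pi * s * v))⁻¹ = 2 * Complex.exp (Real.pi * s * v) - Complex.exp (2 * Real.pi * s * v) * (Complex.cosh (Real.pi * s * v))⁻¹ := by
    have : Complex.exp (2 * Real.pi * s * v) = 2 * Complex.cosh (Real.pi * s * v) * Complex.exp (Real.pi * s * v) - 1 := by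
      rw [Complex.cosh]
      rw [show 2 * ((Complex.exp (Real.pi * s * v) + Complex.exp (-(Real.pi * s * v))) / 2) * Complex.exp (Real.pi * s * v) - 1
        = Complex.exp (Real.pi * s * v) * Complex.exp (Real.pi * s * v) + Complex.exp (-(Real.pi * s * v)) * Complex.exp (Real.pi * s * v) - 1 by ring]
      rw [← Complex.exp_add, ← Complex.exp_add, neg_add_cancel, Complex.exp_zero]
      ring_nf
    rw [this]
    generalize Complex.cosh (Real.pi * s * v) = c at *
    field_simp
    ring
  have h2 : mg s v = gK s v 0 * Complex.exp (-2 * bet * s * v) * (2 * Complex.exp (Real.pi * s * v)) := by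
    unfold mg gK
    rw [show ∀ a b c : ℂ, a * b * (2 * c) = 2 * (a * b * c) by intros; ring, ← Complex.exp_add, ← Complex.exp_add]
    congr 2
    unfold bet
    push_cast
    ring
  rw [h2]
  unfold hk
  linear_combination (gK s v 0 * Complex.exp (-2 * bet * s * v)) * h1

lemma n0_bd {s : ℂ} (hs : 0 < s.re) (h : |s.im| ≤ 4 * s.re) (v : ℝ) :
    ‖gK s v 0 * hk s v - mg s v‖ ≤ 12 * (Real.exp (-(s.re * (Real.pi ^ 2 / 8))) * Real.exp (-(Real.pi / 9 * s.re) * |v|)) := by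
  have hc := cosh_bd (by norm_num) hs h v
  have hp := Real.pi_pos
  rw [n0_id v hc.1, norm_neg, norm_mul, norm_mul, norm_mul, norm_gK, Complex.norm_exp, Complex.norm_exp]
  have e : (-2 * bet * s * v : ℂ).re = -(7 * Real.pi / 9) * s.re * v := by
    have : (-2 * bet * s * v : ℂ) = ((-2 * bet * v : ℝ) : ℂ) * s := by push_cast; ring
    rw [this, Complex.re_ofReal_mul]; unfold bet; ring
  have e2 : (2 * Real.pi * s * v : ℂ).re = 2 * Real.pi * s.re * v := by
    have : (2 * Real.pi * s * v : ℂ) = ((2 * Real.pi * v : ℝ) : ℂ) * s := by push_cast; ring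
    rw [this, Complex.re_ofReal_mul]; ring
  rw [e, e2]
  refine (mul_le_mul_of_nonneg_left hc.2 (by positivity)).trans ?_
  rw [show ∀ a b c d : ℝ, a * b * c * (2 * (4 + 2) * d) = 12 * (a * b * c * d) by intros; ring]
  rw [← Real.exp_add, ← Real.exp_add, ← Real.exp_add, ← Real.exp_add]
  refine mul_le_mul_of_nonneg_left (Real.exp_le_exp.2 ?_) (by norm_num)
  have key : Real.pi ^ 2 / 8 + Real.pi / 9 * |v| ≤ (v + Real.pi * (1/2 - (0:ℤ))) ^ 2 / 2 + 7 * Real.pi / 9 * v - 2 * Real.pi * v + Real.pi * |v| := by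
    push_cast
    rcases abs_cases v with ⟨h1, h2⟩ | ⟨h1, h2⟩ <;> rw [h1] <;> nlinarith [mul_nonneg hp.le (abs_nonneg v), sq_nonneg v]
  nlinarith [mul_le_mul_of_nonneg_left key hs.le]

lemma n1_bd {s : ℂ} (hs : 0 < s.re) (h : |s.im| ≤ 4 * s.re) (v : ℝ) :
    ‖gK s v 1 * hk s v‖ ≤ 12 * (Real.exp (-(s.re * (Real.pi ^ 2 / 8))) * Real.exp (-(Real.pi / 9 * s.re) * |v|)) := by
  have hp := Real.pi_pos
  rw [norm_mul, norm_gK]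
  refine (mul_le_mul_of_nonneg_left (hk_bd2 hs h v) (by positivity)).trans ?_
  rw [show ∀ a d : ℝ, a * (12 * d) = 12 * (a * d) by intros; ring]
  rw [← Real.exp_add, ← Real.exp_add]
  refine mul_le_mul_of_nonneg_left (Real.exp_le_exp.2 ?_) (by norm_num)
  have key : Real.pi ^ 2 / 8 + Real.pi / 9 * |v| ≤ (v + Real.pi * (1/2 - (1:ℤ))) ^ 2 / 2 + 7 * Real.pi / 9 * v + Real.pi * |v| := by
    push_cast
    rcases abs_cases v with ⟨h1, h2⟩ | ⟨h1, h2⟩ <;> rw [h1] <;> nlinarith [mul_nonneg hp.le (abs_nonneg v), sq_nonneg v]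
  nlinarith [mul_le_mul_of_nonneg_left key hs.le]

lemma nn_bd {s : ℂ} (hs : 1 ≤ s.re) (h : |s.im| ≤ 4 * s.re) (v : ℝ) {n : ℤ} (hn0 : n ≠ 0) (hn1 : n ≠ 1) :
    ‖gK s v n * hk s v‖ ≤ 12 * (Real.exp (-(s.re * (Real.pi ^ 2 / 8))) * Real.exp (-(Real.pi / 9 * s.re) * |v|)) * gd n := by
  have hp := Real.pi_pos
  have hp3 := Real.pi_gt_three
  have hs0 : 0 < s.re := by linarith
  have hK := K_ge hn0 hn1
  rw [norm_mul, norm_gK]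
  refine (mul_le_mul_of_nonneg_left (hk_bd2 hs0 h v) (by positivity)).trans ?_
  rw [show ∀ a d : ℝ, a * (12 * d) = 12 * (a * d) by intros; ring, gd, mul_assoc]
  rw [← Real.exp_add, ← Real.exp_add, ← Real.exp_add]
  refine mul_le_mul_of_nonneg_left (Real.exp_le_exp.2 ?_) (by norm_num)
  set k := |(n:ℝ) - 1/2| with hk
  have h1 : (Real.pi * k - |v|) ^ 2 ≤ (v + Real.pi * (1/2 - n)) ^ 2 := by
    have e : Real.pi * k = |Real.pi * ((n:ℝ) - 1/2)| := by rw [abs_mul, abs_of_pos hp]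
    have := abs_abs_sub_abs_le_abs_sub (Real.pi * ((n:ℝ) - 1/2)) v
    rw [e]
    calc _ ≤ (Real.pi * ((n:ℝ) - 1/2) - v) ^ 2 := sq_le_sq.2 this
      _ = _ := by ring
  have h2 : 2 * Real.pi / 9 * |v| ≤ 7 * Real.pi / 9 * v + Real.pi * |v| := by
    nlinarith [neg_abs_le v]
  have h3 : Real.pi ^ 2 * (k / 9 - 1 / 162) ≤ Real.pi / 9 * |v| + (Real.pi * k - |v|) ^ 2 / 2 := by
    nlinarith [sq_nonneg (Real.pi * k - |v| - Real.pi / 9)]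
  have h4 : Real.pi ^ 2 / 8 + (k - 3/2) ≤ Real.pi ^ 2 * (k / 9 - 1 / 162) := by
    have hp9 : 9 ≤ Real.pi ^ 2 := by nlinarith
    nlinarith [mul_nonneg (sub_nonneg.2 hp9) (sub_nonneg.2 hK)]
  have key : Real.pi ^ 2 / 8 + Real.pi / 9 * |v| + (k - 3/2) ≤ (v + Real.pi * (1/2 - n)) ^ 2 / 2 + (7 * Real.pi / 9 * v + Real.pi * |v|) := by
    linarith
  have h5 : k - 3/2 ≤ s.re * (k - 3/2) := by nlinarith
  nlinarith [mul_le_mul_of_nonneg_left key hs0.le]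

lemma D_bd {s : ℂ} (hs : 1 ≤ s.re) (h : |s.im| ≤ 4 * s.re) (v : ℝ) :
    ‖Phi s v * hk s v - mg s v‖ ≤ 12 * (2 + ∑' n, gd n) * Real.exp (-(s.re * (Real.pi ^ 2 / 8))) * Real.exp (-(Real.pi / 9 * s.re) * |v|) := by
  have hs0 : 0 < s.re := by linarith
  have hsum := (gK_summable hs0 v).mul_right (hk s v)
  have h1 := split_bd hsum (M := 12 * (Real.exp (-(s.re * (Real.pi ^ 2 / 8))) * Real.exp (-(Real.pi / 9 * s.re) * |v|))) (by positivity) (fun n h0 h1 => nn_bd hs h v h0 h1)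
  rw [tsum_mul_right] at h1
  have e : Phi s v * hk s v - mg s v = ((∑' n, gK s v n) * hk s v - gK s v 0 * hk s v - gK s v 1 * hk s v) + (gK s v 0 * hk s v - mg s v) + gK s v 1 * hk s v := by
    unfold Phi; ring
  rw [e]
  refine (norm_add₃_le).trans ?_
  have := n0_bd hs0 h v
  have := n1_bd hs0 h v
  linarith

lemma mg_int {s : ℂ} (hs : 0 < s.re) : Integrable (mg s) := by
  unfold mg
  apply Integrable.const_mul
  exact integrable_cexp_quadratic' (b := -s / 2) (by simp; linarith) _ _

lemma mg_integral {s : ℂ} (hs : 0 < s.re) :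
    ∫ v, mg s v = 2 * ((2 * Real.pi / s) ^ (1/2 : ℂ) * Complex.exp (-(7 * Real.pi ^ 2 / 81) * s)) := by
  have hs0 : s ≠ 0 := by rintro rfl; simp at hs
  unfold mg
  rw [integral_const_mul, integral_cexp_quadratic (b := -s / 2) (by simp; linarith)]
  congr 3
  · field_simp
  · field_simp
    ring

lemma I_bd : ∃ C : ℝ, 0 < C ∧ ∀ s : ℂ, 1 ≤ s.re → |s.im| ≤ 4 * s.re →
    ‖(∫ v : ℝ, Phi s v * hk s v) - 2 * ((2 * Real.pi / s) ^ (1/2 : ℂ) * Complex.exp (-(7 * Real.pi ^ 2 / 81) * s))‖ ≤ C * Real.exp (-(s.re * (Real.pi ^ 2 / 8))) := by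
  have hp := Real.pi_pos
  have hg : 0 ≤ ∑' n, gd n := tsum_nonneg gd_nonneg
  refine ⟨12 * (2 + ∑' n, gd n) * (18 / Real.pi), by positivity, fun s hs h => ?_⟩
  have hs0 : 0 < s.re := by linarith
  have hc : Continuous (fun v : ℝ => Phi s v * hk s v - mg s v) := by
    refine ((Phi_cont hs0).mul (hk_cont hs0)).sub ?_
    unfold mg; fun_prop
  have hb := integrable_exp_abs (c := Real.pi / 9 * s.re) (by positivity)
  have hb' := hb.const_mul (12 * (2 + ∑' n, gd n) * Real.exp (-(s.re * (Real.pi ^ 2 / 8))))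
  have hD : Integrable (fun v : ℝ => Phi s v * hk s v - mg s v) :=
    hb'.mono' hc.aestronglyMeasurable (by filter_upwards with v using D_bd hs h v)
  have hPh : Integrable (fun v : ℝ => Phi s v * hk s v) := by
    have := hD.add (mg_int hs0)
    refine this.congr ?_
    filter_upwards with v
    simp
  rw [← mg_integral hs0, ← integral_sub hPh (mg_int hs0)]
  refine (norm_integral_le_of_norm_le hb' (by filter_upwards with v using D_bd hs h v)).trans ?_
  rw [integral_const_mul, integral_exp_abs (by positivity)]
  have : 2 / (Real.pi / 9 * s.re) ≤ 18 / Real.pi := by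
    rw [div_le_div_iff₀ (by positivity) hp]
    nlinarith
  calc _ ≤ 12 * (2 + ∑' n, gd n) * Real.exp (-(s.re * (Real.pi ^ 2 / 8))) * (18 / Real.pi) := by gcongr
    _ = _ := by ring
end Part7

section Part8
open MeasureTheory

lemma gK_It {t : ℂ} (ht0 : t ≠ 0) (n : ℤ) :
    gK t⁻¹ (Complex.I * t / 2) n = Complex.exp (t / 8) * Complex.exp (-(Real.pi ^ 2 / 8) * t⁻¹) *
      (Complex.exp (-(Complex.I * Real.pi * (1/2 - n) / 2)) * Complex.exp (-(Real.pi ^ 2 / 2 * ((1/2 - n) ^ 2 - 1/4)) * t⁻¹)) := by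
  unfold gK
  rw [← Complex.exp_add, ← Complex.exp_add, ← Complex.exp_add]
  congr 1
  field_simp
  linear_combination (-32*t^2) * Complex.I_sq

lemma Phi_It {t : ℂ} (ht : 0 < t.re) (hs : 1 ≤ (t⁻¹).re) :
    ∃ E : ℂ, Phi t⁻¹ (Complex.I * t / 2) = Complex.exp (t / 8) * Complex.exp (-(Real.pi ^ 2 / 8) * t⁻¹) * (Real.sqrt 2 + E) ∧
      ‖E‖ ≤ (∑' n, gd n) * Real.exp (-(Real.pi ^ 2 / 2) * (t⁻¹).re) := by
  have ht0 : t ≠ 0 := by rintro rfl; simp at ht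
  have hp := Real.pi_pos
  have hp3 := Real.pi_gt_three
  set A := Complex.exp (t / 8) * Complex.exp (-(Real.pi ^ 2 / 8) * t⁻¹) with hA
  have hA0 : A ≠ 0 := mul_ne_zero (Complex.exp_ne_zero _) (Complex.exp_ne_zero _)
  set f : ℤ → ℂ := fun n => Complex.exp (-(Complex.I * Real.pi * (1/2 - n) / 2)) * Complex.exp (-(Real.pi ^ 2 / 2 * ((1/2 - n) ^ 2 - 1/4)) * t⁻¹) with hf
  have hs0 : 0 < (t⁻¹).re := by linarith
  have e1 : ∀ n, gK t⁻¹ (Complex.I * t / 2) n = A * f n := fun n => gK_It ht0 n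
  have hsum : Summable f := by
    have := gK_summable hs0 (Complex.I * t / 2)
    rw [show gK t⁻¹ (Complex.I * t / 2) = fun n => A * f n from funext e1] at this
    exact (summable_mul_left_iff hA0).1 this
  have e2 : Phi t⁻¹ (Complex.I * t / 2) = A * ∑' n, f n := by
    unfold Phi; rw [← tsum_mul_left]; congr 1; funext n; exact e1 n
  have e3 : f 0 + f 1 = Real.sqrt 2 := by
    simp only [hf]
    have h1 : Complex.exp (-(Complex.I * Real.pi * (1/2 - (0:ℤ)) / 2)) = Complex.exp (-((Real.pi / 4 : ℝ) * Complex.I)) := by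
      congr 1; push_cast; ring
    have h2 : Complex.exp (-(Complex.I * Real.pi * (1/2 - (1:ℤ)) / 2)) = Complex.exp ((Real.pi / 4 : ℝ) * Complex.I) := by
      congr 1; push_cast; ring
    have h3 : ∀ m : ℤ, m = 0 ∨ m = 1 → Complex.exp (-(Real.pi ^ 2 / 2 * ((1/2 - (m:ℂ)) ^ 2 - 1/4)) * t⁻¹) = 1 := by
      intro m hm
      have h0 : (-(Real.pi ^ 2 / 2 * ((1/2 - (m:ℂ)) ^ 2 - 1/4)) * t⁻¹ : ℂ) = 0 := by
        rcases hm with rfl | rfl <;> push_cast <;> ring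
      rw [h0, Complex.exp_zero]
    rw [h1, h2, h3 0 (Or.inl rfl), h3 1 (Or.inr rfl), mul_one, mul_one]
    have := Complex.two_cos ((Real.pi / 4 : ℝ) : ℂ)
    rw [← Complex.ofReal_cos, Real.cos_pi_div_four] at this
    rw [← neg_mul, add_comm, ← this]
    push_cast; ring
  refine ⟨(∑' n, f n) - f 0 - f 1, ?_, ?_⟩
  · rw [e2, ← e3]; ring
  · rw [mul_comm]
    refine split_bd hsum (by positivity) ?_
    intro n h0 h1
    have hK := K_ge h0 h1
    simp only [hf]
    rw [norm_mul, Complex.norm_exp, Complex.norm_exp]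
    have r1 : (-(Complex.I * Real.pi * (1/2 - n) / 2) : ℂ).re = 0 := by
      have : (-(Complex.I * Real.pi * (1/2 - n) / 2) : ℂ) = ((-(Real.pi * (1/2 - n) / 2) : ℝ) : ℂ) * Complex.I := by push_cast; ring
      rw [this]; simp
    have r2 : (-(Real.pi ^ 2 / 2 * ((1/2 - n) ^ 2 - 1/4)) * t⁻¹ : ℂ).re = -(Real.pi ^ 2 / 2 * (|(n:ℝ) - 1/2| ^ 2 - 1/4)) * (t⁻¹).re := by
      have : (-(Real.pi ^ 2 / 2 * ((1/2 - n) ^ 2 - 1/4)) * t⁻¹ : ℂ) = ((-(Real.pi ^ 2 / 2 * ((1/2 - n) ^ 2 - 1/4)) : ℝ) : ℂ) * t⁻¹ := by push_cast; ring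
      rw [this, Complex.re_ofReal_mul, sq_abs]; ring
    rw [r1, r2, Real.exp_zero, one_mul, gd, ← Real.exp_add]
    apply Real.exp_le_exp.2
    set k := |(n:ℝ) - 1/2|
    have h5 : 1 + (k - 3/2) ≤ k ^ 2 - 1/4 := by nlinarith
    have hp9 : 9 ≤ Real.pi ^ 2 := by nlinarith
    have h6 : (k - 3/2) ≤ Real.pi ^ 2 / 2 * (t⁻¹).re * (k - 3/2) := by
      have : 1 ≤ Real.pi ^ 2 / 2 * (t⁻¹).re := by nlinarith
      nlinarith
    have h7 : 0 ≤ Real.pi ^ 2 / 2 * (t⁻¹).re := by positivity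
    nlinarith [mul_le_mul_of_nonneg_left h5 h7]

noncomputable def BB : ℝ := 25 * Real.pi ^ 2 / 648

noncomputable def Mn (t : ℂ) : ℂ :=
  Real.sqrt 2 * Real.sin (Real.pi / 9) * t⁻¹ * (2 * Real.pi * t) ^ (1/2 : ℂ) * Complex.exp (BB * t⁻¹)

lemma norm_sqrt_le {z : ℂ} : ‖z ^ (1/2 : ℂ)‖ ^ 2 ≤ ‖z‖ := by
  rw [← norm_pow, ← Complex.cpow_nat_mul]
  simp

lemma major : ∃ C r : ℝ, 0 < C ∧ 1 ≤ r ∧ ∀ t : ℂ, 0 < t.re → r ≤ (t⁻¹).re → |(t⁻¹).im| ≤ 4 * (t⁻¹).re →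
    ‖Rf zet (Complex.exp (-t)) * Complex.exp (t / 8) - Mn t‖ ≤ C * ‖t⁻¹‖ := by
  obtain ⟨C, hC, hI⟩ := I_bd
  have hp := Real.pi_pos
  have hp3 := Real.pi_gt_three
  have hp4 := Real.pi_lt_four
  have hg : 0 ≤ ∑' n, gd n := tsum_nonneg gd_nonneg
  set G := ∑' n, gd n with hG
  have hsq : 1.4 ≤ Real.sqrt 2 := by
    apply Real.le_sqrt_of_sq_le; norm_num
  have hsq2 : Real.sqrt 2 ≤ 2 := by
    rw [Real.sqrt_le_left] <;> norm_num
  refine ⟨5 * (C + G * 6), max 1 (3 * G), by positivity, le_max_left _ _, fun t ht hs him => ?_⟩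
  have hs1 : 1 ≤ (t⁻¹).re := (le_max_left _ _).trans hs
  have hs2 : 3 * G ≤ (t⁻¹).re := (le_max_right _ _).trans hs
  have ht0 : t ≠ 0 := by rintro rfl; simp at ht
  obtain ⟨E, hE, hEb⟩ := Phi_It ht hs1
  have hR := Rf_ratio ht
  have hI' := hI t⁻¹ hs1 him
  set J := ∫ v : ℝ, Phi t⁻¹ v * hk t⁻¹ v with hJ
  set ρ := (t⁻¹).re with hρ
  rw [show (2 * Real.pi / t⁻¹ : ℂ) = 2 * Real.pi * t by rw [div_inv_eq_mul]] at hI'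
  set E2 := J - 2 * ((2 * Real.pi * t) ^ (1/2 : ℂ) * Complex.exp (-(7 * Real.pi ^ 2 / 81) * t⁻¹)) with hE2
  rw [hE] at hR
  have hEsmall : ‖E‖ ≤ 1/3 * (1/3) + 2/9 := by
    refine hEb.trans ?_
    have h1 : Real.exp (-(Real.pi ^ 2 / 2) * ρ) ≤ Real.exp (-ρ) := by
      apply Real.exp_le_exp.2
      have : 1 ≤ Real.pi ^ 2 / 2 := by nlinarith
      nlinarith
    have h2 : ρ * Real.exp (-ρ) ≤ 1 := by
      rw [Real.exp_neg, ← div_eq_mul_inv, div_le_one (Real.exp_pos _)]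
      linarith [Real.add_one_le_exp ρ]
    have h3 : 3 * G * Real.exp (-ρ) ≤ 1 := by
      refine le_trans ?_ h2
      gcongr
    have : G * Real.exp (-(Real.pi ^ 2 / 2) * ρ) ≤ G * Real.exp (-ρ) := by gcongr
    linarith
  have hden : 1 ≤ ‖(Real.sqrt 2 : ℂ) + E‖ := by
    have h1 := norm_sub_norm_le (Real.sqrt 2 : ℂ) (-E)
    rw [sub_neg_eq_add, norm_neg, Complex.norm_real, Real.norm_of_nonneg (Real.sqrt_nonneg _)] at h1
    norm_num at hEsmall hsq
    linarith
  -- the basic identity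
  have hexp : Complex.exp (-(Real.pi ^ 2 / 8) * t⁻¹) * Complex.exp (Real.pi ^ 2 / 8 * t⁻¹) = 1 := by
    rw [← Complex.exp_add, ← Complex.exp_zero]; congr 1; ring
  have hexp2 : Complex.exp (-(7 * Real.pi ^ 2 / 81) * t⁻¹) * Complex.exp (Real.pi ^ 2 / 8 * t⁻¹) = Complex.exp (BB * t⁻¹) := by
    rw [← Complex.exp_add]; congr 1; unfold BB; push_cast; ring
  have hs22 : (Real.sqrt 2 : ℂ) * Real.sqrt 2 = 2 := by
    rw [← Complex.ofReal_mul, Real.mul_self_sqrt (by norm_num)]; norm_num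
  have hid : (Rf zet (Complex.exp (-t)) * Complex.exp (t / 8) - Mn t) * (Real.sqrt 2 + E) =
      Real.sin (Real.pi / 9) * t⁻¹ * (Complex.exp (Real.pi ^ 2 / 8 * t⁻¹) * E2) - E * Mn t := by
    have hJ2 : J = E2 + 2 * ((2 * Real.pi * t) ^ (1/2 : ℂ) * Complex.exp (-(7 * Real.pi ^ 2 / 81) * t⁻¹)) := by rw [hE2]; ring
    rw [hJ2] at hR
    unfold Mn
    rw [← hexp2]
    linear_combination Complex.exp (Real.pi ^ 2 / 8 * t⁻¹) * hR - (Rf zet (Complex.exp (-t)) * Complex.exp (t / 8) * (Real.sqrt 2 + E)) * hexp - (Real.sin (Real.pi / 9) * t⁻¹ * (2 * Real.pi * t) ^ (1/2 : ℂ) * (Complex.exp (-(7 * Real.pi ^ 2 / 81) * t⁻¹) * Complex.exp (Real.pi ^ 2 / 8 * t⁻¹))) * hs22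
  have hsin : |Real.sin (Real.pi / 9)| ≤ 1 := Real.abs_sin_le_one _
  have htn : ‖t‖ ≤ 1 := by
    have h1 : 1 ≤ ‖t⁻¹‖ := hs1.trans (Complex.re_le_norm _)
    rw [norm_inv] at h1
    exact (one_le_inv₀ (norm_pos_iff.2 ht0)).1 h1
  have hM : ‖Mn t‖ ≤ 6 * ‖t⁻¹‖ * Real.exp (BB * ρ) := by
    unfold Mn
    rw [norm_mul, norm_mul, norm_mul, norm_mul, Complex.norm_real, Complex.norm_real, Real.norm_of_nonneg (Real.sqrt_nonneg _), Complex.norm_exp, Complex.re_ofReal_mul, Real.norm_eq_abs]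
    have h1 : ‖(2 * Real.pi * t : ℂ) ^ (1/2 : ℂ)‖ ≤ 3 := by
      have h2 := norm_sqrt_le (z := 2 * Real.pi * t)
      rw [norm_mul, norm_mul, Complex.norm_two, Complex.norm_real, Real.norm_of_nonneg hp.le] at h2
      nlinarith [norm_nonneg ((2 * Real.pi * t : ℂ) ^ (1/2 : ℂ))]
    calc _ ≤ 2 * 1 * ‖t⁻¹‖ * 3 * Real.exp (BB * ρ) := by gcongr
      _ = _ := by ring
  have hEM : ‖E * Mn t‖ ≤ G * 6 * ‖t⁻¹‖ := by
    rw [norm_mul]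
    calc _ ≤ (G * Real.exp (-(Real.pi ^ 2 / 2) * ρ)) * (6 * ‖t⁻¹‖ * Real.exp (BB * ρ)) := by gcongr
      _ = G * 6 * ‖t⁻¹‖ * (Real.exp (-(Real.pi ^ 2 / 2) * ρ) * Real.exp (BB * ρ)) := by ring
      _ ≤ G * 6 * ‖t⁻¹‖ * 1 := by
        gcongr
        rw [← Real.exp_add, Real.exp_le_one_iff]
        unfold BB
        nlinarith [mul_nonneg (sq_nonneg Real.pi) (by linarith : 0 ≤ ρ)]
      _ = _ := by ring
  have hF : ‖Real.sin (Real.pi / 9) * t⁻¹ * (Complex.exp (Real.pi ^ 2 / 8 * t⁻¹) * E2)‖ ≤ C * ‖t⁻¹‖ := by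
    rw [norm_mul, norm_mul, norm_mul, Complex.norm_real, Real.norm_eq_abs, Complex.norm_exp]
    have : (Real.pi ^ 2 / 8 * t⁻¹ : ℂ).re = Real.pi ^ 2 / 8 * ρ := by
      rw [show (Real.pi ^ 2 / 8 * t⁻¹ : ℂ) = ((Real.pi ^ 2 / 8 : ℝ) : ℂ) * t⁻¹ by push_cast; ring, Complex.re_ofReal_mul]
    rw [this]
    calc _ ≤ 1 * ‖t⁻¹‖ * (Real.exp (Real.pi ^ 2 / 8 * ρ) * (C * Real.exp (-(ρ * (Real.pi ^ 2 / 8))))) := by gcongr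
      _ = C * ‖t⁻¹‖ * (Real.exp (Real.pi ^ 2 / 8 * ρ) * Real.exp (-(ρ * (Real.pi ^ 2 / 8)))) := by ring
      _ = C * ‖t⁻¹‖ := by rw [← Real.exp_add, mul_comm ρ, add_neg_cancel, Real.exp_zero, mul_one]
  calc _ ≤ ‖Rf zet (Complex.exp (-t)) * Complex.exp (t / 8) - Mn t‖ * ‖(Real.sqrt 2 : ℂ) + E‖ := le_mul_of_one_le_right (norm_nonneg _) hden
    _ = _ := by rw [← norm_mul, hid]
    _ ≤ _ := norm_sub_le _ _
    _ ≤ C * ‖t⁻¹‖ + G * 6 * ‖t⁻¹‖ := add_le_add hF hEM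
    _ ≤ _ := by nlinarith [norm_nonneg t⁻¹, mul_nonneg hg (norm_nonneg t⁻¹), mul_nonneg hC.le (norm_nonneg t⁻¹)]
end Part8

section Part9
open MeasureTheory

noncomputable def wm (q : ℂ) (m : ℕ) : ℂ := (-1) ^ (m + 1) * q ^ m

lemma norm_wm (q : ℂ) (m : ℕ) : ‖wm q m‖ = ‖q‖ ^ m := by
  unfold wm; simp

lemma log_fac {q : ℂ} (hq : ‖q‖ < 1) (k : ℕ) : ∃ L : ℂ, Complex.exp L = fac q (k + 1) ∧
    HasSum (fun m : ℕ => wm q (m + 1) ^ (k + 1) / ((m + 1 : ℕ) : ℂ)) L := by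
  have hqk : ‖q ^ (k + 1)‖ < 1 := by
    rw [norm_pow]; exact pow_lt_one₀ (norm_nonneg _) hq (by omega)
  by_cases h : Odd (k + 1)
  · refine ⟨Complex.log (1 + q ^ (k + 1)), ?_, ?_⟩
    · unfold fac
      rw [if_pos h, Complex.exp_log]
      intro h0
      rw [add_comm, add_eq_zero_iff_eq_neg] at h0
      rw [h0] at hqk; simp at hqk
    · have h1 := (hasSum_nat_add_iff' 1).2 (Complex.hasSum_taylorSeries_log hqk)
      simp only [Finset.sum_range_one, Nat.cast_zero, div_zero, sub_zero] at h1
      refine h1.congr_fun ?_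
      intro m
      unfold wm
      rw [mul_pow, ← pow_mul, mul_comm (m + 1 + 1), pow_mul, h.neg_one_pow, ← pow_mul, ← pow_mul, mul_comm (m+1)]
  · refine ⟨-Complex.log (1 - q ^ (k + 1)), ?_, ?_⟩
    · unfold fac
      rw [if_neg h, Complex.exp_neg, Complex.exp_log]
      intro h0
      rw [sub_eq_zero] at h0
      rw [← h0] at hqk; simp at hqk
    · have h1 := (hasSum_nat_add_iff' 1).2 (Complex.hasSum_taylorSeries_neg_log hqk)
      simp only [Finset.sum_range_one, Nat.cast_zero, div_zero, sub_zero] at h1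
      refine h1.congr_fun ?_
      intro m
      unfold wm
      rw [Nat.not_odd_iff_even] at h
      rw [mul_pow, ← pow_mul, mul_comm (m + 1 + 1), pow_mul, h.neg_one_pow, one_pow, one_mul, ← pow_mul, ← pow_mul, mul_comm (m+1)]

noncomputable def bm (q : ℂ) (m : ℕ) : ℝ := ‖wm q m‖ / ‖1 - wm q m‖

lemma wm_summable {q : ℂ} (hq : ‖q‖ < 1) :
    Summable (fun p : ℕ × ℕ => wm q (p.2 + 1) ^ (p.1 + 1) / ((p.2 + 1 : ℕ) : ℂ)) := by
  have hg := summable_geometric_of_lt_one (norm_nonneg q) hq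
  have h2 := hg.mul_of_nonneg hg (fun n => by positivity) (fun n => by positivity)
  refine Summable.of_norm_bounded h2 ?_
  rintro ⟨k, m⟩
  simp only
  rw [norm_div, norm_pow, norm_wm, ← pow_mul, ← pow_add, Complex.norm_natCast]
  have h3 : (1:ℝ) ≤ ((m + 1 : ℕ) : ℝ) := by push_cast; linarith [Nat.cast_nonneg (α := ℝ) m]
  refine (div_le_self (by positivity) h3).trans ?_
  apply pow_le_pow_of_le_one (norm_nonneg _) hq.le
  nlinarith

lemma Pf_le {q : ℂ} (hq : ‖q‖ < 1) {c : ℝ}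
    (h : ∀ N, ∑ m ∈ Finset.range N, bm q (m + 1) / ((m + 1 : ℕ) : ℝ) ≤ c) : ‖Pf q‖ ≤ Real.exp c := by
  choose L hL1 hL2 using log_fac hq
  have hS := wm_summable hq
  obtain ⟨T, hT⟩ := hS
  have hk : HasSum L T := hT.prod_fiberwise hL2
  have hPf : Pf q = Complex.exp T := by
    refine tendsto_nhds_unique (tendsto_prod hq) ?_
    have := (Complex.continuous_exp.tendsto T).comp hk.tendsto_sum_nat
    refine this.congr ?_
    intro N
    simp only [Function.comp]
    rw [Complex.exp_sum]
    exact Finset.prod_congr rfl (fun k _ => hL1 k)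
  have hT' : HasSum (fun p : ℕ × ℕ => wm q (p.1 + 1) ^ (p.2 + 1) / ((p.1 + 1 : ℕ) : ℂ)) T := by
    have := (Equiv.prodComm ℕ ℕ).hasSum_iff.2 hT
    exact this
  have hm : HasSum (fun m : ℕ => wm q (m + 1) / (1 - wm q (m + 1)) / ((m + 1 : ℕ) : ℂ)) T := by
    refine hT'.prod_fiberwise ?_
    intro m
    have hw : ‖wm q (m + 1)‖ < 1 := by
      rw [norm_wm]; exact pow_lt_one₀ (norm_nonneg _) hq (by omega)
    have := ((hasSum_geometric_of_norm_lt_one hw).mul_left (wm q (m + 1))).div_const ((m + 1 : ℕ) : ℂ)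
    rw [← div_eq_mul_inv] at this
    refine this.congr_fun ?_
    intro k
    simp only [pow_succ']
  rw [hPf, Complex.norm_exp]
  apply Real.exp_le_exp.2
  have h1 := (Complex.continuous_re.tendsto T).comp hm.tendsto_sum_nat
  refine le_of_tendsto h1 (Filter.Eventually.of_forall ?_)
  intro N
  simp only [Function.comp]
  refine (Complex.re_le_norm _).trans ((norm_sum_le _ _).trans (le_trans (le_of_eq ?_) (h N)))
  refine Finset.sum_congr rfl ?_
  intro m _
  rw [norm_div, norm_div, Complex.norm_natCast]; rfl

lemma sq_tail (N : ℕ) : ∑ i ∈ Finset.range N, (1:ℝ) / ((20 + i + 1 : ℕ) : ℝ) ^ 2 ≤ 1 / 20 - 1 / (20 + N) := by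
  induction N with
  | zero => simp
  | succ N ih =>
    rw [Finset.sum_range_succ]
    refine (add_le_add_left ih _).trans ?_
    push_cast
    have h : (0:ℝ) ≤ N := Nat.cast_nonneg N
    have : (1:ℝ) / (20 + N + 1) ^ 2 ≤ 1 / (20 + N) - 1 / (20 + (N + 1)) := by
      rw [div_sub_div _ _ (by positivity) (by positivity), div_le_div_iff₀ (by positivity) (by positivity)]
      nlinarith
    linarith

lemma bm_nonneg (q : ℂ) (m : ℕ) : 0 ≤ bm q m := by unfold bm; positivity

/-- abstract summation -/
lemma sum_abs {a : ℕ → ℝ} {c : ℕ → ℝ} {x : ℝ} (hx : 0 < x) (ha : ∀ m, 0 ≤ a m)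
    (h1 : ∀ m, a (m + 1) ≤ 1 / (((m + 1 : ℕ) : ℝ) * x))
    (h2 : ∀ m, m < 20 → a (m + 1) ≤ c (m + 1) / (((m + 1 : ℕ) : ℝ) * x) + 1000)
    (hc : ∑ m ∈ Finset.range 20, c (m + 1) / ((m + 1 : ℕ) : ℝ) ^ 2 ≤ 13 / 40) (N : ℕ) :
    ∑ m ∈ Finset.range N, a (m + 1) / ((m + 1 : ℕ) : ℝ) ≤ (3 / 8) / x + 20000 := by
  have hpos : ∀ m : ℕ, 0 ≤ a (m + 1) / ((m + 1 : ℕ) : ℝ) := fun m => div_nonneg (ha _) (by positivity)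
  have e1 : ∑ m ∈ Finset.range N, a (m + 1) / ((m + 1 : ℕ) : ℝ) ≤ ∑ m ∈ Finset.range (20 + N), a (m + 1) / ((m + 1 : ℕ) : ℝ) :=
    Finset.sum_le_sum_of_subset_of_nonneg (Finset.range_mono (by omega)) (fun m _ _ => hpos m)
  refine e1.trans ?_
  rw [Finset.sum_range_add]
  have e2 : ∑ m ∈ Finset.range 20, a (m + 1) / ((m + 1 : ℕ) : ℝ) ≤ (13 / 40) / x + 20000 := by
    have : ∀ m ∈ Finset.range 20, a (m + 1) / ((m + 1 : ℕ) : ℝ) ≤ (c (m + 1) / ((m + 1 : ℕ) : ℝ) ^ 2) / x + 1000 := by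
      intro m hm
      have hm1 : (1:ℝ) ≤ ((m + 1 : ℕ) : ℝ) := by push_cast; linarith [Nat.cast_nonneg (α := ℝ) m]
      have := h2 m (Finset.mem_range.1 hm)
      calc _ ≤ (c (m + 1) / (((m + 1 : ℕ) : ℝ) * x) + 1000) / ((m + 1 : ℕ) : ℝ) := by gcongr
        _ = (c (m + 1) / ((m + 1 : ℕ) : ℝ) ^ 2) / x + 1000 / ((m + 1 : ℕ) : ℝ) := by
          rw [add_div, div_div, div_div]; ring_nf
        _ ≤ _ := by gcongr; exact div_le_self (by norm_num) hm1
    refine (Finset.sum_le_sum this).trans ?_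
    rw [Finset.sum_add_distrib, ← Finset.sum_div]
    simp only [Finset.sum_const, Finset.card_range]
    have : (∑ m ∈ Finset.range 20, c (m + 1) / ((m + 1 : ℕ) : ℝ) ^ 2) / x ≤ (13/40) / x := by gcongr
    norm_num at this ⊢
    linarith
  have e3 : ∑ i ∈ Finset.range N, a (20 + i + 1) / ((20 + i + 1 : ℕ) : ℝ) ≤ (1 / 20) / x := by
    have : ∀ i ∈ Finset.range N, a (20 + i + 1) / ((20 + i + 1 : ℕ) : ℝ) ≤ ((1:ℝ) / ((20 + i + 1 : ℕ) : ℝ) ^ 2) / x := by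
      intro i _
      have := h1 (20 + i)
      calc _ ≤ (1 / (((20 + i + 1 : ℕ) : ℝ) * x)) / ((20 + i + 1 : ℕ) : ℝ) := by gcongr
        _ = _ := by rw [div_div, div_div]; ring_nf
    refine (Finset.sum_le_sum this).trans ?_
    rw [← Finset.sum_div]
    have h := sq_tail N
    have : (0:ℝ) ≤ 1 / (20 + N) := by positivity
    gcongr
    linarith
  have : (3 / 8) / x = (13/40) / x + (1/20) / x := by ring
  linarith

lemma bm_sq {x y : ℝ} (hx : 0 < x) (m : ℕ) :
    bm (Complex.exp (-(x + y * Complex.I))) (m + 1) ^ 2 * ((Real.exp ((m + 1 : ℕ) * x) - 1) ^ 2 + 2 * (1 - (-1) ^ (m + 2) * Real.cos ((m + 1 : ℕ) * y))) ≤ 1 := by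
  set M : ℕ := m + 1 with hM
  have hMx : (0:ℝ) < M * x := by rw [hM]; positivity
  set R := Real.exp (M * x) with hR
  have hR1 : 1 ≤ R := by rw [hR]; exact Real.one_le_exp hMx.le
  have hRp : 0 < R := by linarith
  set σ : ℝ := (-1) ^ (m + 2) with hσ
  have hσ2 : σ ^ 2 = 1 := by rw [hσ, ← pow_mul, mul_comm, pow_mul]; norm_num
  have hw : wm (Complex.exp (-(x + y * Complex.I))) M = ((σ * R⁻¹ * Real.cos (M * y) : ℝ) : ℂ) + ((-(σ * R⁻¹ * Real.sin (M * y)) : ℝ) : ℂ) * Complex.I := by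
    unfold wm
    rw [← Complex.exp_nat_mul]
    have : ((M : ℂ) * -(x + y * Complex.I)) = ((-(M * x) : ℝ) : ℂ) + ((-(M * y) : ℝ) : ℂ) * Complex.I := by push_cast; ring
    rw [this, Complex.exp_add, Complex.exp_mul_I, ← Complex.ofReal_exp, ← Complex.ofReal_cos, ← Complex.ofReal_sin, Real.exp_neg, ← hR, Real.cos_neg, Real.sin_neg, show m + 1 + 1 = m + 2 by ring]
    rw [hσ]; push_cast; ring
  have hn1 : ‖wm (Complex.exp (-(x + y * Complex.I))) M‖ ^ 2 = R⁻¹ ^ 2 := by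
    rw [hw, ← Complex.normSq_eq_norm_sq, Complex.normSq_add_mul_I]
    linear_combination (R⁻¹ ^ 2) * hσ2 + (σ ^ 2 * R⁻¹ ^ 2 ) * Real.sin_sq_add_cos_sq (M * y)
  have hn2 : ‖1 - wm (Complex.exp (-(x + y * Complex.I))) M‖ ^ 2 = 1 - 2 * σ * R⁻¹ * Real.cos (M * y) + R⁻¹ ^ 2 := by
    rw [hw, ← Complex.normSq_eq_norm_sq]
    have : (1 - (((σ * R⁻¹ * Real.cos (M * y) : ℝ) : ℂ) + ((-(σ * R⁻¹ * Real.sin (M * y)) : ℝ) : ℂ) * Complex.I)) = ((1 - σ * R⁻¹ * Real.cos (M * y) : ℝ) : ℂ) + ((σ * R⁻¹ * Real.sin (M * y) : ℝ) : ℂ) * Complex.I := by push_cast; ring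
    rw [this, Complex.normSq_add_mul_I]
    linear_combination (R⁻¹ ^ 2) * hσ2 + (σ ^ 2 * R⁻¹ ^ 2 ) * Real.sin_sq_add_cos_sq (M * y)
  unfold bm
  rw [div_pow, hn1, hn2]
  set c := Real.cos (M * y)
  have hcl : c ≤ 1 := Real.cos_le_one _
  have hcl' : -1 ≤ c := Real.neg_one_le_cos _
  have hsc : σ * c ≤ 1 := by nlinarith [sq_nonneg (σ - c)]
  have hD : 1 - 2 * σ * R⁻¹ * c + R⁻¹ ^ 2 = R⁻¹ ^ 2 * ((R - 1) ^ 2 + 2 * R * (1 - σ * c)) := by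
    field_simp; ring
  rw [hD]
  have hb : (R - 1) ^ 2 + 2 * (1 - σ * c) ≤ (R - 1) ^ 2 + 2 * R * (1 - σ * c) := by nlinarith
  have hRm : 0 < R - 1 := by
    have := Real.add_one_le_exp (M * x); linarith
  have hpos : 0 < (R - 1) ^ 2 + 2 * R * (1 - σ * c) := by
    have : 0 ≤ 2 * R * (1 - σ * c) := mul_nonneg (by positivity) (by linarith)
    positivity
  rw [div_mul_eq_mul_div, div_le_one (by positivity)]
  gcongr

lemma bm_triv {x y : ℝ} (hx : 0 < x) (m : ℕ) :
    bm (Complex.exp (-(x + y * Complex.I))) (m + 1) ≤ 1 / (((m + 1 : ℕ) : ℝ) * x) := by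
  have h := bm_sq (y := y) hx m
  have h0 := bm_nonneg (Complex.exp (-(x + y * Complex.I))) (m + 1)
  set b := bm (Complex.exp (-(x + y * Complex.I))) (m + 1)
  have hMx : (0:ℝ) < ((m + 1 : ℕ):ℝ) * x := by positivity
  have hR := Real.add_one_le_exp (((m + 1 : ℕ):ℝ) * x)
  set R := Real.exp (((m + 1 : ℕ):ℝ) * x)
  have hsc : (-1:ℝ) ^ (m + 2) * Real.cos ((m + 1 : ℕ) * y) ≤ 1 := by
    refine (le_abs_self _).trans ?_
    rw [abs_mul, abs_pow, abs_neg, abs_one, one_pow, one_mul]; exact Real.abs_cos_le_one _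
  rw [le_div_iff₀ hMx]
  have h2 : (b * (((m + 1 : ℕ):ℝ) * x)) ^ 2 ≤ 1 := by
    rw [mul_pow]
    refine le_trans ?_ h
    gcongr
    nlinarith
  exact (sq_le_one_iff₀ (by positivity)).1 h2

lemma bm_cos {x y : ℝ} (hx : 0 < x) (m : ℕ) {D : ℝ} (hD : 0 < D)
    (h : D ^ 2 ≤ 2 * (1 - (-1) ^ (m + 2) * Real.cos ((m + 1 : ℕ) * y))) :
    bm (Complex.exp (-(x + y * Complex.I))) (m + 1) ≤ 1 / D := by
  have h1 := bm_sq (y := y) hx m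
  have h0 := bm_nonneg (Complex.exp (-(x + y * Complex.I))) (m + 1)
  set b := bm (Complex.exp (-(x + y * Complex.I))) (m + 1)
  rw [le_div_iff₀ hD]
  have h2 : (b * D) ^ 2 ≤ 1 := by
    rw [mul_pow]
    refine le_trans ?_ h1
    gcongr
    nlinarith [sq_nonneg (Real.exp ((m + 1 : ℕ) * x) - 1)]
  exact (sq_le_one_iff₀ (by positivity)).1 h2
end Part9

section Part10
open MeasureTheory

lemma bm_cos' {x y : ℝ} (hx : 0 < x) (m : ℕ) {D : ℝ} (hD : 0 < D)
    (h : D ^ 2 ≤ 2 * (1 - (-1) ^ (m + 2) * Real.cos ((m + 1 : ℕ) * |y|))) :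
    bm (Complex.exp (-(x + y * Complex.I))) (m + 1) ≤ 1 / D := by
  apply bm_cos hx m hD
  rwa [← Real.cos_abs, abs_mul, abs_of_nonneg (Nat.cast_nonneg (m+1))]

lemma bm_good {x y : ℝ} (hx : 0 < x) (m : ℕ)
    (h : 1 / 1000000 ≤ 2 * (1 - (-1) ^ (m + 2) * Real.cos ((m + 1 : ℕ) * |y|))) :
    bm (Complex.exp (-(x + y * Complex.I))) (m + 1) ≤ 0 / (((m + 1 : ℕ) : ℝ) * x) + 1000 := by
  have := bm_cos' (y := y) hx m (D := 1 / 1000) (by norm_num) (by norm_num at h ⊢; linarith)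
  norm_num at this ⊢
  exact this

lemma minor_a {x y : ℝ} (hx : 0 < x) (hy : 4 * x ≤ |y|) (hy2 : |y| ≤ 1 / 20) (N : ℕ) :
    ∑ m ∈ Finset.range N, bm (Complex.exp (-(x + y * Complex.I))) (m + 1) / ((m + 1 : ℕ) : ℝ) ≤ (3 / 8) / x + 20000 := by
  refine sum_abs (c := fun m => if m % 2 = 1 then 53/200 else 0) hx (bm_nonneg _) (bm_triv hx) ?_ ?_ N
  · intro m hm
    have hm20 : (((m + 1 : ℕ)) : ℝ) ≤ 20 := by exact_mod_cast hm
    have hm1 : (1:ℝ) ≤ ((m + 1 : ℕ) : ℝ) := by push_cast; linarith [Nat.cast_nonneg (α := ℝ) m]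
    set M : ℝ := ((m + 1 : ℕ) : ℝ) with hM
    have hMy : M * |y| ≤ 1 := by nlinarith [abs_nonneg y]
    have hMy0 : 0 < M * |y| := by
      have : 0 < |y| := by linarith
      positivity
    by_cases h : (m + 1) % 2 = 1
    · simp only [h, if_true]
      have hev : Even (m + 2) := by rw [Nat.even_iff]; omega
      have hb := bm_cos' (y := y) hx m (D := 118/125 * (M * |y|)) (by positivity) ?_
      · refine hb.trans ?_
        have : 1 / (118/125 * (M * |y|)) ≤ 53/200 / (M * x) := by
          rw [div_le_div_iff₀ (by positivity) (by positivity)]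
          nlinarith
        linarith
      · rw [hev.neg_one_pow, one_mul, ← hM]
        have hc := Real.cos_bound (x := M * |y|) (by rw [abs_of_pos hMy0]; exact hMy)
        rw [abs_of_pos hMy0] at hc
        have hc2 := (abs_le.1 hc).2
        set θ := M * |y|
        have : θ ^ 4 ≤ θ ^ 2 := by
          have := pow_le_pow_of_le_one hMy0.le hMy (show 2 ≤ 4 by norm_num)
          exact this
        nlinarith [sq_nonneg θ]
    · simp only [h, if_false]
      apply bm_good hx m
      have hod : Odd (m + 2) := by rw [Nat.odd_iff]; omega
      rw [hod.neg_one_pow, ← hM]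
      have : 0 ≤ Real.cos (M * |y|) := Real.cos_nonneg_of_mem_Icc ⟨by linarith [Real.pi_gt_three], by linarith [Real.pi_gt_three]⟩
      linarith
  · norm_num [Finset.sum_range_succ]

lemma minor_b {x y : ℝ} (hx : 0 < x) (hy : |(|y| - Real.pi / 2)| ≤ 1 / 40) (N : ℕ) :
    ∑ m ∈ Finset.range N, bm (Complex.exp (-(x + y * Complex.I))) (m + 1) / ((m + 1 : ℕ) : ℝ) ≤ (3 / 8) / x + 20000 := by
  refine sum_abs (c := fun m => if m % 4 = 2 then 1 else 0) hx (bm_nonneg _) (bm_triv hx) ?_ ?_ N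
  · intro m hm
    by_cases h : (m + 1) % 4 = 2
    · simp only [h, if_true]
      linarith [bm_triv (y := y) hx m]
    simp only [h, if_false]
    apply bm_good hx m
    have hm20 : (((m + 1 : ℕ)) : ℝ) ≤ 20 := by exact_mod_cast hm
    have hm1 : (1:ℝ) ≤ ((m + 1 : ℕ) : ℝ) := by push_cast; linarith [Nat.cast_nonneg (α := ℝ) m]
    obtain ⟨ε, hε⟩ : ∃ ε, ε = |y| - Real.pi / 2 := ⟨_, rfl⟩
    rw [← hε] at hy
    have hyε : |y| = Real.pi / 2 + ε := by linarith
    have hMe : |((m + 1 : ℕ) : ℝ) * ε| ≤ 1 / 2 := by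
      rw [abs_mul, abs_of_nonneg (by linarith)]
      nlinarith [abs_nonneg ε]
    rcases Nat.even_or_odd (m + 1) with he | ho
    · -- divisible by four
      obtain ⟨j, hj⟩ : ∃ j, m + 1 = 4 * j := ⟨(m + 1) / 4, by rw [Nat.even_iff] at he; omega⟩
      have e : ((m + 1 : ℕ) : ℝ) * |y| = ((m + 1 : ℕ) : ℝ) * ε + (j : ℝ) * (2 * Real.pi) := by
        rw [hyε, hj]; push_cast; ring
      rw [e, Real.cos_add_nat_mul_two_pi]
      have : 0 ≤ Real.cos (((m + 1 : ℕ) : ℝ) * ε) := by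
        have := abs_le.1 hMe
        exact Real.cos_nonneg_of_mem_Icc ⟨by linarith [Real.pi_gt_three], by linarith [Real.pi_gt_three]⟩
      have hod : Odd (m + 2) := by rw [Nat.odd_iff]; omega
      rw [hod.neg_one_pow]
      linarith
    · have hev : Even (m + 2) := by rw [Nat.even_iff]; rw [Nat.odd_iff] at ho; omega
      rw [hev.neg_one_pow, one_mul]
      obtain ⟨j, hj⟩ := ho
      have e : ((m + 1 : ℕ) : ℝ) * |y| = (((m + 1 : ℕ) : ℝ) * ε + Real.pi / 2) + (j : ℝ) * Real.pi := by
        rw [hyε, hj]; push_cast; ring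
      have : |Real.cos (((m + 1 : ℕ) : ℝ) * |y|)| ≤ 1 / 2 := by
        rw [e, Real.cos_add_nat_mul_pi, abs_mul, abs_pow, abs_neg, abs_one, one_pow, one_mul, Real.cos_add_pi_div_two, abs_neg]
        exact Real.abs_sin_le_abs.trans hMe
      have := (abs_le.1 this).2
      linarith
  · norm_num [Finset.sum_range_succ]

lemma minor_c {x y : ℝ} (hx : 0 < x) (h1 : 1 / 20 ≤ |y|) (hpi : |y| ≤ Real.pi) (hy : 1 / 40 ≤ |(|y| - Real.pi / 2)|) (N : ℕ) :
    ∑ m ∈ Finset.range N, bm (Complex.exp (-(x + y * Complex.I))) (m + 1) / ((m + 1 : ℕ) : ℝ) ≤ (3 / 8) / x + 20000 := by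
  set Y := |y| with hY
  have hp4 := Real.pi_lt_four
  have hp := Real.pi_pos
  have hc1 : Real.cos Y ≤ 1 - 1 / 1000 := by
    have a1 : Real.cos Y ≤ Real.cos (1 / 20) := Real.cos_le_cos_of_nonneg_of_le_pi (by norm_num) hpi h1
    have a2 := (abs_le.1 (Real.cos_bound (x := 1 / 20) (by norm_num [abs_le]))).2
    rw [abs_of_pos (by norm_num)] at a2
    norm_num at a2
    linarith
  have hc2 : 1 / 10000 ≤ Real.cos Y ^ 2 := by
    have e : Real.cos Y ^ 2 = Real.sin |Y - Real.pi / 2| ^ 2 := by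
      rcases abs_cases (Y - Real.pi / 2) with ⟨h, _⟩ | ⟨h, _⟩
      · rw [h, Real.sin_sub_pi_div_two]; ring
      · rw [h, neg_sub, Real.sin_pi_div_two_sub]
    rw [e]
    have hle : |Y - Real.pi / 2| ≤ Real.pi / 2 := by rw [abs_le]; constructor <;> linarith [abs_nonneg y]
    have := Real.mul_le_sin (abs_nonneg _) hle
    have h2 : 1 / 2 ≤ 2 / Real.pi := by rw [div_le_div_iff₀ two_pos hp]; linarith
    have h3 : 1 / 80 ≤ Real.sin |Y - Real.pi / 2| := by nlinarith
    nlinarith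
  set c := Real.cos Y with hc
  have hcm : -1 ≤ c := Real.neg_one_le_cos _
  have g1 : bm (Complex.exp (-(x + y * Complex.I))) (0 + 1) ≤ 0 / (((0 + 1 : ℕ) : ℝ) * x) + 1000 := by
    apply bm_good hx 0
    rw [← hY]; norm_num; rw [← hc]; linarith
  have g2 : bm (Complex.exp (-(x + y * Complex.I))) (1 + 1) ≤ 0 / (((1 + 1 : ℕ) : ℝ) * x) + 1000 := by
    apply bm_good hx 1
    rw [← hY]; norm_num; rw [Real.cos_two_mul, ← hc]; linarith
  by_cases h3 : 1 / 10 ≤ |1 + 2 * c|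
  · have g3 : bm (Complex.exp (-(x + y * Complex.I))) (2 + 1) ≤ 0 / (((2 + 1 : ℕ) : ℝ) * x) + 1000 := by
      apply bm_good hx 2
      rw [← hY]; norm_num; rw [Real.cos_three_mul, ← hc]
      have : 1 / 100 ≤ (1 + 2 * c) ^ 2 := by rw [← sq_abs]; nlinarith
      have e : 1 - (4 * c ^ 3 - 3 * c) = (1 - c) * (1 + 2 * c) ^ 2 := by ring
      rw [e]
      nlinarith
    refine sum_abs (c := fun m => if m ≤ 3 then 0 else 1) hx (bm_nonneg _) (bm_triv hx) ?_ ?_ N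
    · intro m hm
      by_cases h : m + 1 ≤ 3
      · simp only [h, if_true]
        have : m = 0 ∨ m = 1 ∨ m = 2 := by omega
        rcases this with rfl | rfl | rfl
        · exact g1
        · exact g2
        · exact g3
      · simp only [h, if_false]
        linarith [bm_triv (y := y) hx m]
    · norm_num [Finset.sum_range_succ]
  · have g3 : bm (Complex.exp (-(x + y * Complex.I))) (3 + 1) ≤ 0 / (((3 + 1 : ℕ) : ℝ) * x) + 1000 := by
      apply bm_good hx 3
      push Not at h3
      have h4 := abs_lt.1 h3
      rw [← hY]; norm_num; rw [show 4 * Y = 2 * (2 * Y) by ring, Real.cos_two_mul, Real.cos_two_mul, ← hc]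
      have : 1/10 ≤ 1 - 2 * c ^ 2 := by nlinarith
      nlinarith
    refine sum_abs (c := fun m => if m ≤ 2 ∨ m = 4 then 0 else 1) hx (bm_nonneg _) (bm_triv hx) ?_ ?_ N
    · intro m hm
      by_cases h : m + 1 ≤ 2 ∨ m + 1 = 4
      · simp only [h, if_true]
        have : m = 0 ∨ m = 1 ∨ m = 3 := by omega
        rcases this with rfl | rfl | rfl
        · exact g1
        · exact g2
        · exact g3
      · simp only [h, if_false]
        linarith [bm_triv (y := y) hx m]
    · norm_num [Finset.sum_range_succ]

lemma minor_Pf {x y : ℝ} (hx : 0 < x) (hy : 4 * x ≤ |y|) (hpi : |y| ≤ Real.pi) :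
    ‖Pf (Complex.exp (-(x + y * Complex.I)))‖ ≤ Real.exp ((3 / 8) / x + 20000) := by
  apply Pf_le (norm_q (by simpa using hx))
  intro N
  rcases le_total |y| (1 / 20) with h | h
  · exact minor_a hx hy h N
  rcases le_total |(|y| - Real.pi / 2)| (1 / 40) with h' | h'
  · exact minor_b hx h' N
  · exact minor_c hx h hpi h' N

lemma minor {x y : ℝ} (hx : 0 < x) (hx1 : x ≤ 1) (hy : 4 * x ≤ |y|) (hpi : |y| ≤ Real.pi) :
    ‖Rf zet (Complex.exp (-(x + y * Complex.I)))‖ ≤ 17 / x ^ 2 * Real.exp ((3 / 8) / x + 20000) := by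
  have hq := norm_q (t := x + y * Complex.I) (by simpa using hx)
  rw [Rf_eq norm_zet hq, norm_mul, mul_comm]
  have hC := norm_Cf_le norm_zet hq
  have hn : ‖Complex.exp (-(x + y * Complex.I))‖ = Real.exp (-x) := by
    rw [Complex.norm_exp]; simp
  rw [hn] at hC
  have h1 : x / 2 ≤ 1 - Real.exp (-x) := by
    have h3 := Real.add_one_le_exp x
    have : Real.exp (-x) ≤ 1 / (1 + x) := by
      rw [Real.exp_neg, ← one_div]; apply one_div_le_one_div_of_le <;> linarith
    have h4 : 1 / (1 + x) ≤ 1 - x / 2 := by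
      rw [div_le_iff₀ (by linarith)]; nlinarith
    linarith
  have h2 : 1 + 4 / (1 - Real.exp (-x)) ^ 2 ≤ 17 / x ^ 2 := by
    have a : 4 / (1 - Real.exp (-x)) ^ 2 ≤ 4 / (x / 2) ^ 2 := by gcongr
    have b : 4 / (x / 2) ^ 2 = 16 / x ^ 2 := by field_simp; norm_num
    have c : 1 ≤ 1 / x ^ 2 := by
      rw [le_div_iff₀ (by positivity)]; nlinarith
    have d : 17 / x ^ 2 = 16 / x ^ 2 + 1 / x ^ 2 := by ring
    linarith
  have := minor_Pf hx hy hpi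
  exact mul_le_mul (hC.trans h2) this (norm_nonneg _) (by positivity)
end Part10

section Part11
open MeasureTheory

lemma A_summ {x : ℝ} (hx : 0 < x) : Summable (fun m : ℕ => ‖Acoef 1 9 m‖ * Real.exp (-x) ^ m) := by
  have h := (hasSum_Rf (q := (Real.exp (-x) : ℝ)) (by
    rw [Complex.norm_real, Real.norm_of_nonneg (Real.exp_pos _).le]; simpa using hx)).summable.norm
  refine h.congr ?_
  intro m
  rw [norm_mul, norm_pow, Complex.norm_real, Real.norm_of_nonneg (Real.exp_pos _).le]

lemma norm_exp_xy (x y : ℝ) : ‖Complex.exp (-(x + y * Complex.I))‖ = Real.exp (-x) := by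
  rw [Complex.norm_exp]; simp

lemma Rf_cont {x : ℝ} (hx : 0 < x) : Continuous (fun y : ℝ => Rf zet (Complex.exp (-(x + y * Complex.I)))) := by
  have h : (fun y : ℝ => Rf zet (Complex.exp (-(x + y * Complex.I)))) =
      fun y : ℝ => ∑' m, Acoef 1 9 m * Complex.exp (-(x + y * Complex.I)) ^ m := by
    funext y
    exact (hasSum_Rf (norm_q (by simpa using hx))).tsum_eq.symm
  rw [h]
  refine continuous_tsum (fun m => by fun_prop) (A_summ hx) ?_
  intro m y
  rw [norm_mul, norm_pow, norm_exp_xy]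

lemma int_exp_k {k : ℤ} (hk : k ≠ 0) : ∫ y in (-Real.pi)..Real.pi, Complex.exp (k * (y * Complex.I)) = 0 := by
  have h : ∀ y : ℝ, Complex.exp (k * (y * Complex.I)) = Complex.exp (((k : ℂ) * Complex.I) * y) := by
    intro y; congr 1; ring
  simp_rw [h]
  rw [integral_exp_mul_complex (mul_ne_zero (by exact_mod_cast hk) Complex.I_ne_zero)]
  have : Complex.exp ((k : ℂ) * Complex.I * Real.pi) = Complex.exp ((k : ℂ) * Complex.I * ((-Real.pi : ℝ) : ℂ)) := by
    rw [Complex.exp_eq_exp_iff_exists_int]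
    exact ⟨k, by push_cast; ring⟩
  rw [this, sub_self, zero_div]

lemma coef {x : ℝ} (hx : 0 < x) (n : ℕ) :
    ∫ y in (-Real.pi)..Real.pi, Rf zet (Complex.exp (-(x + y * Complex.I))) * Complex.exp (n * (x + y * Complex.I)) =
      2 * Real.pi * Acoef 1 9 n := by
  have hp := Real.pi_pos
  set F : ℕ → ℝ → ℂ := fun m y => Acoef 1 9 m * Complex.exp (-(x + y * Complex.I)) ^ m * Complex.exp (n * (x + y * Complex.I)) with hF
  have hFn : ∀ m y, ‖F m y‖ = ‖Acoef 1 9 m‖ * Real.exp (-x) ^ m * Real.exp (n * x) := by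
    intro m y
    simp only [hF]
    rw [norm_mul, norm_mul, norm_pow, norm_exp_xy, Complex.norm_exp]
    simp
  have hFc : ∀ m, Continuous (F m) := by intro m; simp only [hF]; fun_prop
  have hinteg : ∀ m, Integrable (F m) (volume.restrict (Set.Ioc (-Real.pi) Real.pi)) := by
    intro m
    exact ((hFc m).continuousOn.integrableOn_Icc (a := -Real.pi) (b := Real.pi)).mono_set Set.Ioc_subset_Icc_self
  have hsum : Summable (fun m => ∫ y in Set.Ioc (-Real.pi) Real.pi, ‖F m y‖) := by
    simp_rw [hFn]
    simp only [integral_const, smul_eq_mul]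
    exact ((A_summ hx).mul_right _).mul_left _
  have h1 := hasSum_integral_of_summable_integral_norm hinteg hsum
  have h2 : ∀ y : ℝ, ∑' m, F m y = Rf zet (Complex.exp (-(x + y * Complex.I))) * Complex.exp (n * (x + y * Complex.I)) := by
    intro y
    exact ((hasSum_Rf (norm_q (by simpa using hx))).mul_right _).tsum_eq
  simp_rw [h2] at h1
  rw [← intervalIntegral.integral_of_le (by linarith)] at h1
  refine h1.unique ?_
  have h3 : ∀ m, ∫ y in Set.Ioc (-Real.pi) Real.pi, F m y = if m = n then 2 * Real.pi * Acoef 1 9 n else 0 := by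
    intro m
    rw [← intervalIntegral.integral_of_le (by linarith)]
    have e : ∀ y, F m y = Acoef 1 9 m * Complex.exp (((n:ℂ) - m) * x) * Complex.exp (((n - m : ℤ) : ℂ) * (y * Complex.I)) := by
      intro y
      simp only [hF]
      rw [← Complex.exp_nat_mul, mul_assoc, mul_assoc, ← Complex.exp_add, ← Complex.exp_add]
      congr 2
      push_cast; ring
    simp_rw [e]
    rw [intervalIntegral.integral_const_mul]
    by_cases hmn : m = n
    · subst hmn
      simp
      ring
    · rw [if_neg hmn, int_exp_k (by omega), mul_zero]
  simp_rw [h3]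
  exact hasSum_ite_eq n _

noncomputable def gz (z : ℝ) : ℂ := (1 + z * Complex.I) ^ (1/2 : ℂ) * (1 + z * Complex.I)⁻¹

noncomputable def Qf (l : ℝ) : ℂ := Real.sqrt l * ∫ z in (-4 : ℝ)..4, gz z * Complex.exp (-l * z ^ 2 * (1 + z * Complex.I)⁻¹)

lemma one_add_ne (z : ℝ) : (1 + z * Complex.I : ℂ) ≠ 0 := by
  intro h
  have := congrArg Complex.re h
  simp at this

lemma gz_cont : Continuous gz := by
  unfold gz
  refine Continuous.mul ?_ (Continuous.inv₀ (by fun_prop) one_add_ne)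
  refine Continuous.cpow (by fun_prop) continuous_const ?_
  intro z
  left; simp

lemma gz_le (z : ℝ) : ‖gz z‖ ≤ 1 := by
  have h1 : 1 ≤ ‖(1 + z * Complex.I : ℂ)‖ := by
    have := Complex.re_le_norm (1 + z * Complex.I : ℂ)
    simpa using this
  have h2 := norm_sqrt_le (z := 1 + z * Complex.I)
  unfold gz
  rw [norm_mul, norm_inv, ← div_eq_mul_inv, div_le_one (by linarith)]
  nlinarith [norm_nonneg ((1 + z * Complex.I : ℂ) ^ (1/2 : ℂ))]

lemma inv_re (z : ℝ) : ((1 + z * Complex.I : ℂ)⁻¹).re = 1 / (1 + z ^ 2) := by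
  rw [Complex.inv_re, show (1 + z * Complex.I : ℂ) = ((1:ℝ):ℂ) + (z:ℂ) * Complex.I by push_cast; ring, Complex.normSq_add_mul_I]
  simp

lemma Qf_lim : Filter.Tendsto Qf Filter.atTop (nhds (Real.sqrt Real.pi)) := by
  have hgauss : ∫ u : ℝ, Complex.exp (-(u:ℂ) ^ 2) = Real.sqrt Real.pi := by
    have := integral_gaussian 1
    rw [div_one] at this
    rw [← this, ← integral_complex_ofReal]
    congr 1; funext u; push_cast; simp
  rw [← hgauss]
  set G : ℝ → ℝ → ℂ := fun l u => (Set.Ioc (-4 * Real.sqrt l) (4 * Real.sqrt l)).indicator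
    (fun u => gz (u / Real.sqrt l) * Complex.exp (-u ^ 2 * (1 + (u / Real.sqrt l : ℝ) * Complex.I)⁻¹)) u with hG
  have hQ : ∀ l : ℝ, 0 < l → Qf l = ∫ u, G l u := by
    intro l hl
    have hsl : 0 < Real.sqrt l := Real.sqrt_pos.2 hl
    simp only [hG]
    rw [integral_indicator measurableSet_Ioc, ← intervalIntegral.integral_of_le (by linarith)]
    have h2 := intervalIntegral.integral_comp_mul_left (a := -4) (b := 4) (c := Real.sqrt l)
      (fun u : ℝ => gz (u / Real.sqrt l) * Complex.exp (-u ^ 2 * (1 + (u / Real.sqrt l : ℝ) * Complex.I)⁻¹)) hsl.ne'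
    rw [mul_comm (-4 : ℝ), mul_comm (4:ℝ)]
    have h3 : ∫ u in (Real.sqrt l * -4)..(Real.sqrt l * 4), gz (u / Real.sqrt l) * Complex.exp (-u ^ 2 * (1 + (u / Real.sqrt l : ℝ) * Complex.I)⁻¹) = Real.sqrt l * ∫ x in (-4:ℝ)..4, gz (Real.sqrt l * x / Real.sqrt l) * Complex.exp (-((Real.sqrt l * x : ℝ):ℂ) ^ 2 * (1 + (Real.sqrt l * x / Real.sqrt l : ℝ) * Complex.I)⁻¹) := by
      rw [h2, Complex.real_smul, ← mul_assoc, ← Complex.ofReal_mul, mul_inv_cancel₀ hsl.ne', Complex.ofReal_one, one_mul]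
    rw [h3, Qf]
    congr 2
    funext z
    rw [mul_div_cancel_left₀ _ hsl.ne']
    congr 3
    have : ((Real.sqrt l : ℝ) : ℂ) ^ 2 = l := by
      rw [← Complex.ofReal_pow, Real.sq_sqrt hl.le]
    push_cast
    rw [mul_pow, this]; ring
  refine Filter.Tendsto.congr' (f₁ := fun l => ∫ u, G l u) ?_ ?_
  · filter_upwards [Filter.eventually_gt_atTop 0] with l hl
    exact (hQ l hl).symm
  refine tendsto_integral_filter_of_dominated_convergence (fun u => Real.exp (-(1/17) * u ^ 2)) ?_ ?_ ?_ ?_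
  · filter_upwards with l
    simp only [hG]
    refine (Continuous.aestronglyMeasurable ?_).indicator measurableSet_Ioc
    refine Continuous.mul (gz_cont.comp (by fun_prop)) (Complex.continuous_exp.comp (Continuous.mul (by fun_prop) (Continuous.inv₀ (by fun_prop) (fun u => one_add_ne _))))
  · filter_upwards [Filter.eventually_gt_atTop 0] with l hl
    filter_upwards with u
    have hsl : 0 < Real.sqrt l := Real.sqrt_pos.2 hl
    simp only [hG]
    by_cases hu : u ∈ Set.Ioc (-4 * Real.sqrt l) (4 * Real.sqrt l)
    · rw [Set.indicator_of_mem hu, norm_mul, Complex.norm_exp]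
      have hz : |u / Real.sqrt l| ≤ 4 := by
        rw [abs_div, abs_of_pos hsl, div_le_iff₀ hsl, abs_le]
        exact ⟨by linarith [hu.1], hu.2⟩
      have hre : (-(u:ℂ) ^ 2 * (1 + (u / Real.sqrt l : ℝ) * Complex.I)⁻¹).re = -(u ^ 2 * (1 / (1 + (u / Real.sqrt l) ^ 2))) := by
        rw [show (-(u:ℂ) ^ 2) = ((-(u ^ 2) : ℝ) : ℂ) by push_cast; ring, Complex.re_ofReal_mul, inv_re]; ring
      rw [hre]
      have h16 : (u / Real.sqrt l) ^ 2 ≤ 16 := by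
        rw [← sq_abs]; nlinarith [abs_nonneg (u / Real.sqrt l)]
      have h17 : 1 / 17 ≤ 1 / (1 + (u / Real.sqrt l) ^ 2) := by
        apply one_div_le_one_div_of_le (by positivity); linarith
      calc _ ≤ 1 * Real.exp (-(1/17) * u ^ 2) := by
            gcongr
            · exact gz_le _
            · nlinarith [sq_nonneg u]
        _ = _ := one_mul _
    · rw [Set.indicator_of_notMem hu, norm_zero]
      positivity
  · exact integrable_exp_neg_mul_sq (by norm_num)
  · filter_upwards with u
    have hlim : Filter.Tendsto (fun l : ℝ => u / Real.sqrt l) Filter.atTop (nhds 0) :=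
      Filter.Tendsto.div_atTop tendsto_const_nhds Real.tendsto_sqrt_atTop
    have hc : Continuous (fun z : ℝ => gz z * Complex.exp (-(u:ℂ) ^ 2 * (1 + z * Complex.I)⁻¹)) :=
      gz_cont.mul (Complex.continuous_exp.comp (continuous_const.mul (Continuous.inv₀ (by fun_prop) one_add_ne)))
    have h0 := (hc.tendsto 0).comp hlim
    have e0 : gz 0 * Complex.exp (-(u:ℂ) ^ 2 * (1 + (0:ℝ) * Complex.I)⁻¹) = Complex.exp (-(u:ℂ) ^ 2) := by
      unfold gz; simp
    rw [e0] at h0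
    refine h0.congr' ?_
    filter_upwards [Real.tendsto_sqrt_atTop.eventually_gt_atTop |u|] with l hl
    have hu : u ∈ Set.Ioc (-4 * Real.sqrt l) (4 * Real.sqrt l) := by
      have := abs_lt.1 hl
      have h2 : 0 ≤ Real.sqrt l := Real.sqrt_nonneg _
      exact ⟨by linarith, by linarith⟩
    simp only [hG, Function.comp]
    rw [Set.indicator_of_mem hu]
end Part11

section Part12
open MeasureTheory

lemma BB_pos : 0 < BB := by unfold BB; have := Real.pi_pos; positivity

lemma sqrt_mul_c {a : ℝ} (ha : 0 < a) {w : ℂ} (hw : w ≠ 0) :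
    ((a : ℂ) * w) ^ (1/2 : ℂ) = Real.sqrt a * w ^ (1/2 : ℂ) := by
  have h0 : (a : ℂ) ≠ 0 := by exact_mod_cast ha.ne'
  rw [Complex.cpow_def_of_ne_zero (mul_ne_zero h0 hw), Complex.log_ofReal_mul ha hw, add_mul, Complex.exp_add,
    ← Complex.cpow_def_of_ne_zero hw, Real.sqrt_eq_rpow, Complex.ofReal_cpow ha.le, Complex.cpow_def_of_ne_zero h0, Complex.ofReal_log ha.le]
  push_cast
  rfl

lemma main_id {l : ℝ} (hl : 0 < l) :
    ∫ y in (-(4 * (BB / l)))..(4 * (BB / l)), Mn ((BB / l : ℝ) + y * Complex.I) * Complex.exp ((l ^ 2 / BB : ℝ) * ((BB / l : ℝ) + y * Complex.I)) =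
      (2 * Real.sqrt Real.pi * Real.sin (Real.pi / 9) * Real.sqrt BB / l * Real.exp (2 * l) : ℝ) * Qf l := by
  have hB := BB_pos
  have hp := Real.pi_pos
  set x := BB / l with hx
  have hx0 : 0 < x := by positivity
  have hxc : (x : ℂ) ≠ 0 := by exact_mod_cast hx0.ne'
  have h2 := intervalIntegral.integral_comp_mul_left (a := -4) (b := 4) (c := x)
      (fun y : ℝ => Mn ((x : ℝ) + y * Complex.I) * Complex.exp ((l ^ 2 / BB : ℝ) * ((x : ℝ) + y * Complex.I))) hx0.ne'
  have h3 : ∫ y in (-(4 * x))..(4 * x), Mn ((x : ℝ) + y * Complex.I) * Complex.exp ((l ^ 2 / BB : ℝ) * ((x : ℝ) + y * Complex.I)) =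
      x * ∫ z in (-4:ℝ)..4, Mn ((x : ℝ) + ((x * z : ℝ) : ℂ) * Complex.I) * Complex.exp ((l ^ 2 / BB : ℝ) * ((x : ℝ) + ((x * z : ℝ) : ℂ) * Complex.I)) := by
    rw [h2, Complex.real_smul, ← mul_assoc, ← Complex.ofReal_mul, mul_inv_cancel₀ hx0.ne', Complex.ofReal_one, one_mul]
    congr 1 <;> ring
  rw [h3, Qf, ← intervalIntegral.integral_const_mul, ← mul_assoc, ← intervalIntegral.integral_const_mul]
  congr 1
  funext z
  have hw := one_add_ne z
  have e1 : ((x : ℝ) + ((x * z : ℝ) : ℂ) * Complex.I : ℂ) = x * (1 + z * Complex.I) := by push_cast; ring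
  rw [e1]
  have hwsq : (1 + z * Complex.I) ^ 2 = 1 + 2 * z * Complex.I - (z:ℂ) ^ 2 := by
    linear_combination (z:ℂ) ^ 2 * Complex.I_sq
  have hwd : (1 + z * Complex.I : ℂ) = 1 + z * Complex.I := rfl
  unfold Mn gz
  have e2 : (2 * Real.pi * (x * (1 + z * Complex.I)) : ℂ) = ((2 * Real.pi * x : ℝ) : ℂ) * (1 + z * Complex.I) := by push_cast; ring
  rw [e2, sqrt_mul_c (by positivity) hw]
  have e3 : Complex.exp (BB * (x * (1 + z * Complex.I))⁻¹) * Complex.exp ((l ^ 2 / BB : ℝ) * (x * (1 + z * Complex.I))) =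
      (Real.exp (2 * l) : ℝ) * Complex.exp (-l * z ^ 2 * (1 + z * Complex.I)⁻¹) := by
    rw [Complex.ofReal_exp, ← Complex.exp_add, ← Complex.exp_add]
    congr 1
    have hlc : (l : ℂ) ≠ 0 := by exact_mod_cast hl.ne'
    have hBc : (BB : ℂ) ≠ 0 := by exact_mod_cast hB.ne'
    have a1 : (BB * (x * (1 + z * Complex.I))⁻¹ : ℂ) = l * (1 + z * Complex.I)⁻¹ := by
      rw [mul_inv, hx]; push_cast; generalize (1 + (z:ℂ) * Complex.I)⁻¹ = W; field_simp
    have a2 : ((l ^ 2 / BB : ℝ) * (x * (1 + z * Complex.I)) : ℂ) = l * (1 + z * Complex.I) := by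
      rw [hx]; push_cast; generalize (1 + (z:ℂ) * Complex.I) = W; field_simp
    rw [a1, a2]
    push_cast
    have : (z:ℂ) ^ 2 = 2 * (1 + z * Complex.I) - 1 - (1 + z * Complex.I) ^ 2 := by rw [hwsq]; ring
    rw [this]
    generalize (1 + (z:ℂ) * Complex.I) = W at *
    field_simp
    ring
  have e4 : Real.sqrt 2 * Real.sqrt (2 * Real.pi * x) = 2 * Real.sqrt Real.pi * Real.sqrt BB / l * Real.sqrt l := by
    have b1 : Real.sqrt (2 * Real.pi * x) = Real.sqrt 2 * Real.sqrt Real.pi * (Real.sqrt BB / Real.sqrt l) := by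
      rw [Real.sqrt_mul (by positivity), Real.sqrt_mul (by positivity), hx, Real.sqrt_div hB.le]
    have b2 : Real.sqrt 2 * Real.sqrt 2 = 2 := Real.mul_self_sqrt (by norm_num)
    have b3 : Real.sqrt l * Real.sqrt l = l := Real.mul_self_sqrt hl.le
    have b4 : Real.sqrt l ≠ 0 := (Real.sqrt_pos.2 hl).ne'
    rw [b1]
    have b5 : Real.sqrt l / l = 1 / Real.sqrt l := by
      rw [div_eq_div_iff hl.ne' b4, b3, one_mul]
    calc _ = (Real.sqrt 2 * Real.sqrt 2) * Real.sqrt Real.pi * Real.sqrt BB * (1 / Real.sqrt l) := by ring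
      _ = _ := by rw [b2, ← b5]; ring
  have e4c : (Real.sqrt 2 : ℂ) * Real.sqrt (2 * Real.pi * x) = 2 * Real.sqrt Real.pi * Real.sqrt BB / l * Real.sqrt l := by exact_mod_cast e4
  have e5 : (x : ℂ) * (x * (1 + z * Complex.I))⁻¹ = (1 + z * Complex.I)⁻¹ := by
    rw [mul_inv, ← mul_assoc, mul_inv_cancel₀ hxc, one_mul]
  push_cast at e3 ⊢
  calc _ = (Real.sin (Real.pi / 9) : ℂ) * ((x : ℂ) * (x * (1 + z * Complex.I))⁻¹) * ((Real.sqrt 2 : ℂ) * Real.sqrt (2 * Real.pi * x)) * (1 + z * Complex.I) ^ (1/2 : ℂ) *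
        (Complex.exp (BB * (x * (1 + z * Complex.I))⁻¹) * Complex.exp ((l ^ 2 / BB) * (x * (1 + z * Complex.I)))) := by push_cast; ring
    _ = _ := by rw [e3, e4c, e5]; push_cast; ring

lemma t_inv {x y : ℝ} : ((x + y * Complex.I : ℂ)⁻¹).re = x / (x ^ 2 + y ^ 2) ∧ ((x + y * Complex.I : ℂ)⁻¹).im = -y / (x ^ 2 + y ^ 2) := by
  rw [Complex.inv_re, Complex.inv_im, Complex.normSq_add_mul_I]
  simp

lemma Mn_cont {x : ℝ} (hx : 0 < x) : Continuous (fun y : ℝ => Mn (x + y * Complex.I)) := by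
  have h0 : ∀ y : ℝ, (x + y * Complex.I : ℂ) ≠ 0 := by
    intro y h
    have := congrArg Complex.re h
    simp at this
    linarith
  have hi : Continuous (fun y : ℝ => (x + y * Complex.I : ℂ)⁻¹) := Continuous.inv₀ (by fun_prop) h0
  unfold Mn
  refine ((continuous_const.mul hi).mul ?_).mul (Complex.continuous_exp.comp (continuous_const.mul hi))
  refine Continuous.cpow (by fun_prop) continuous_const ?_
  intro y
  left
  have : (2 * Real.pi * (x + y * Complex.I) : ℂ).re = 2 * Real.pi * x := by
    rw [show (2 * Real.pi * (x + y * Complex.I) : ℂ) = ((2 * Real.pi : ℝ) : ℂ) * (x + y * Complex.I) by push_cast; ring, Complex.re_ofReal_mul]; simp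
  rw [this]
  have := Real.pi_pos
  positivity

lemma err : ∃ C L : ℝ, 0 < C ∧ 0 < L ∧ ∀ l : ℝ, L ≤ l → ∀ n : ℕ, (n : ℝ) = l ^ 2 / BB + 1 / 8 →
    ‖2 * Real.pi * Acoef 1 9 n - (2 * Real.sqrt Real.pi * Real.sin (Real.pi / 9) * Real.sqrt BB / l * Real.exp (2 * l) : ℝ) * Qf l‖ ≤
      C * (Real.exp l + l ^ 2 * Real.exp ((3 / 8) / BB * l + l)) := by
  obtain ⟨C, r, hC, hr, hmaj⟩ := major
  have hB := BB_pos
  have hp := Real.pi_pos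
  have hp3 := Real.pi_gt_three
  refine ⟨8 * C + 2 * Real.pi * (17 / BB ^ 2 * Real.exp 20001), 8 * BB + 17 * BB * r, by positivity, by positivity, fun l hl n hn => ?_⟩
  have hl1 : 8 * BB ≤ l := by nlinarith [mul_pos hB (show 0 < r by linarith)]
  have hl2 : 17 * BB * r ≤ l := by nlinarith
  have hl0 : 0 < l := by linarith
  rw [← main_id hl0]
  set x := BB / l with hx
  have hx0 : 0 < x := by positivity
  have hx8 : x ≤ 1 / 8 := by rw [hx, div_le_div_iff₀ hl0 (by norm_num)]; linarith
  have hxr : r ≤ 1 / (17 * x) := by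
    rw [le_div_iff₀ (by positivity), hx]
    have : r * (17 * (BB / l)) = (17 * BB * r) / l := by ring
    rw [this, div_le_one hl0]; exact hl2
  set N := l ^ 2 / BB with hN
  have hNx : N * x = l := by rw [hN, hx]; field_simp
  rw [← coef hx0 n]
  set F : ℝ → ℂ := fun y => Rf zet (Complex.exp (-(x + y * Complex.I))) * Complex.exp (n * (x + y * Complex.I)) with hF
  set M : ℝ → ℂ := fun y => Mn (x + y * Complex.I) * Complex.exp (N * (x + y * Complex.I)) with hM
  have hFc : Continuous F := (Rf_cont hx0).mul (by fun_prop)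
  have hMc : Continuous M := (Mn_cont hx0).mul (by fun_prop)
  have hsplit : (∫ y in (-Real.pi)..Real.pi, F y) = (∫ y in (-Real.pi)..(-(4 * x)), F y) + (∫ y in (-(4 * x))..(4 * x), F y) + ∫ y in (4 * x)..Real.pi, F y := by
    rw [intervalIntegral.integral_add_adjacent_intervals (hFc.intervalIntegrable _ _) (hFc.intervalIntegrable _ _),
      intervalIntegral.integral_add_adjacent_intervals (hFc.intervalIntegrable _ _) (hFc.intervalIntegrable _ _)]
  have hmid : ‖(∫ y in (-(4 * x))..(4 * x), F y) - ∫ y in (-(4 * x))..(4 * x), M y‖ ≤ 8 * C * Real.exp l := by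
    rw [← intervalIntegral.integral_sub (hFc.intervalIntegrable _ _) (hMc.intervalIntegrable _ _)]
    have hb : ∀ y ∈ Set.uIoc (-(4 * x)) (4 * x), ‖F y - M y‖ ≤ C / x * Real.exp l := by
      intro y hy
      rw [Set.uIoc_of_le (by linarith)] at hy
      have hy4 : |y| ≤ 4 * x := abs_le.2 ⟨hy.1.le, hy.2⟩
      have hyy : y ^ 2 ≤ 16 * x ^ 2 := by rw [← sq_abs]; nlinarith [abs_nonneg y]
      obtain ⟨hre, him⟩ := t_inv (x := x) (y := y)
      have hd : 0 < x ^ 2 + y ^ 2 := by positivity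
      have h1 := hmaj (x + y * Complex.I) (by simpa using hx0) (by
          rw [hre]
          refine hxr.trans ?_
          rw [div_le_div_iff₀ (by positivity) hd]
          nlinarith) (by
          rw [hre, him, abs_div, abs_neg, abs_of_pos hd, ← mul_div_assoc]
          gcongr)
      have e : F y - M y = (Rf zet (Complex.exp (-(x + y * Complex.I))) * Complex.exp ((x + y * Complex.I) / 8) - Mn (x + y * Complex.I)) * Complex.exp (N * (x + y * Complex.I)) := by
        simp only [hF, hM]
        rw [sub_mul, mul_assoc (Rf zet _), ← Complex.exp_add]
        congr 3
        have : (n : ℂ) = (N : ℂ) + 1 / 8 := by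
          have := congrArg (fun a : ℝ => (a : ℂ)) hn
          push_cast at this
          exact this
        rw [this]; ring
      rw [e, norm_mul, Complex.norm_exp, Complex.re_ofReal_mul]
      have hre2 : (x + y * Complex.I : ℂ).re = x := by simp
      rw [hre2, hNx]
      have hinv : ‖(x + y * Complex.I : ℂ)⁻¹‖ ≤ 1 / x := by
        rw [norm_inv, ← one_div]
        apply one_div_le_one_div_of_le hx0
        have := Complex.re_le_norm (x + y * Complex.I : ℂ)
        rwa [hre2] at this
      calc _ ≤ (C * (1 / x)) * Real.exp l := by
            gcongr
            exact h1.trans (by gcongr)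
        _ = _ := by ring
    refine (intervalIntegral.norm_integral_le_of_norm_le_const hb).trans ?_
    rw [abs_of_pos (by linarith)]
    apply le_of_eq
    field_simp
    ring
  have hmin : ∀ y : ℝ, 4 * x ≤ |y| → |y| ≤ Real.pi → ‖F y‖ ≤ (17 / BB ^ 2 * Real.exp 20001) * (l ^ 2 * Real.exp ((3 / 8) / BB * l + l)) := by
    intro y h1 h2
    have h3 := minor hx0 (by linarith) h1 h2
    simp only [hF]
    rw [norm_mul, Complex.norm_exp]
    have hre2 : ((n:ℂ) * (x + y * Complex.I) : ℂ).re = l + x / 8 := by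
      rw [show (n:ℂ) = ((n : ℝ) : ℂ) by push_cast; rfl, Complex.re_ofReal_mul, hn, ← hNx]
      simp; ring
    rw [hre2]
    have e1 : 17 / x ^ 2 = 17 / BB ^ 2 * l ^ 2 := by rw [hx]; field_simp
    have e2 : (3/8) / x = (3 / 8) / BB * l := by rw [hx]; field_simp
    rw [e1, e2] at h3
    calc _ ≤ (17 / BB ^ 2 * l ^ 2 * Real.exp (3 / 8 / BB * l + 20000)) * Real.exp (l + x / 8) := by gcongr
      _ = 17 / BB ^ 2 * l ^ 2 * Real.exp ((3 / 8 / BB * l + 20000) + (l + x / 8)) := by rw [Real.exp_add (3 / 8 / BB * l + 20000) (l + x / 8), mul_assoc]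
      _ ≤ 17 / BB ^ 2 * l ^ 2 * Real.exp (20001 + (3 / 8 / BB * l + l)) := by
        gcongr ?_ * Real.exp ?_
        linarith
      _ = _ := by rw [Real.exp_add]; ring
  set K := (17 / BB ^ 2 * Real.exp 20001) * (l ^ 2 * Real.exp ((3 / 8) / BB * l + l)) with hK
  have hK0 : 0 ≤ K := by positivity
  have hleft : ‖∫ y in (-Real.pi)..(-(4 * x)), F y‖ ≤ K * Real.pi := by
    have hb : ∀ y ∈ Set.uIoc (-Real.pi) (-(4 * x)), ‖F y‖ ≤ K := by
      intro y hy
      rw [Set.uIoc_of_le (by linarith)] at hy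
      have : |y| = -y := abs_of_neg (by linarith [hy.2])
      exact hmin y (by rw [this]; linarith [hy.2]) (by rw [this]; linarith [hy.1])
    refine (intervalIntegral.norm_integral_le_of_norm_le_const hb).trans ?_
    gcongr
    rw [abs_of_nonneg (by linarith)]; linarith
  have hright : ‖∫ y in (4 * x)..Real.pi, F y‖ ≤ K * Real.pi := by
    have hb : ∀ y ∈ Set.uIoc (4 * x) Real.pi, ‖F y‖ ≤ K := by
      intro y hy
      rw [Set.uIoc_of_le (by linarith)] at hy
      have : |y| = y := abs_of_pos (by linarith [hy.1])
      exact hmin y (by rw [this]; linarith [hy.1]) (by rw [this]; linarith [hy.2])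
    refine (intervalIntegral.norm_integral_le_of_norm_le_const hb).trans ?_
    gcongr
    rw [abs_of_nonneg (by linarith)]; linarith
  rw [hsplit]
  have e : ∀ a b c d : ℂ, a + b + c - d = a + (b - d) + c := by intros; ring
  rw [e]
  refine norm_add₃_le.trans ?_
  have hfin : (8 * C + 2 * Real.pi * (17 / BB ^ 2 * Real.exp 20001)) * (Real.exp l + l ^ 2 * Real.exp ((3 / 8) / BB * l + l)) =
      8 * C * Real.exp l + K * Real.pi + K * Real.pi + (8 * C * (l ^ 2 * Real.exp ((3 / 8) / BB * l + l)) + 2 * Real.pi * (17 / BB ^ 2 * Real.exp 20001) * Real.exp l) := by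
    rw [hK]; ring
  rw [hfin]
  have : 0 ≤ (8 * C * (l ^ 2 * Real.exp ((3 / 8) / BB * l + l)) + 2 * Real.pi * (17 / BB ^ 2 * Real.exp 20001) * Real.exp l) := by positivity
  linarith
end Part12

section Part13
open MeasureTheory

lemma sqrtBB : Real.sqrt BB = 5 * Real.pi / (18 * Real.sqrt 2) := by
  have hp := Real.pi_pos
  have h2 : Real.sqrt 2 ^ 2 = 2 := Real.sq_sqrt (by norm_num)
  rw [Real.sqrt_eq_iff_mul_self_eq (BB_pos).le (by positivity)]
  rw [BB]
  have : (18 * Real.sqrt 2) ≠ 0 := by positivity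
  field_simp
  rw [h2]; norm_num

lemma ccoef_lt : (3 / 8) / BB < 1 := by
  rw [div_lt_one BB_pos, BB]
  nlinarith [Real.pi_gt_d2]

lemma expcosh_lim : Filter.Tendsto (fun l : ℝ => Real.exp (2 * l) / Real.cosh (2 * l)) Filter.atTop (nhds 2) := by
  have h1 : Filter.Tendsto (fun l : ℝ => Real.exp (-(4 * l))) Filter.atTop (nhds 0) :=
    Real.tendsto_exp_neg_atTop_nhds_zero.comp (Filter.tendsto_id.const_mul_atTop (by norm_num : (0 : ℝ) < 4))
  have h2 : Filter.Tendsto (fun l : ℝ => 2 / (1 + Real.exp (-(4 * l)))) Filter.atTop (nhds (2 / (1 + 0))) :=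
    tendsto_const_nhds.div (tendsto_const_nhds.add h1) (by norm_num)
  rw [show (2 : ℝ) / (1 + 0) = 2 by norm_num] at h2
  refine h2.congr fun l => ?_
  rw [Real.cosh_eq, show -(2 * l) = 2 * l + -(4 * l) by ring, Real.exp_add]
  have := Real.exp_pos (2 * l)
  have := Real.exp_pos (-(4 * l))
  field_simp

lemma errterm_lim (K : ℝ) : Filter.Tendsto (fun l : ℝ => K * (l * Real.exp (-(2 * l)) *
    (Real.exp l + l ^ 2 * Real.exp ((3 / 8) / BB * l + l)))) Filter.atTop (nhds 0) := by
  have hb : 0 < 1 - (3 / 8) / BB := by linarith [ccoef_lt]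
  generalize (3 / 8) / BB = c at *
  have hP : ∀ (m : ℕ) (b : ℝ), 0 < b → Filter.Tendsto (fun l : ℝ => l ^ m * Real.exp (-(b * l))) Filter.atTop (nhds 0) := by
    intro m b hb
    have h := (Real.tendsto_pow_mul_exp_neg_atTop_nhds_zero m).comp (Filter.tendsto_id.const_mul_atTop hb)
    have h' := h.const_mul ((b ^ m)⁻¹)
    rw [mul_zero] at h'
    refine h'.congr fun l => ?_
    simp only [Function.comp, id]
    rw [mul_pow]
    field_simp
  have h := ((hP 1 1 one_pos).add (hP 3 _ hb)).const_mul K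
  rw [add_zero, mul_zero] at h
  refine h.congr fun l => ?_
  rw [mul_add (l * _), mul_assoc l, ← Real.exp_add, 
    show l * Real.exp (-(2 * l)) * (l ^ 2 * Real.exp (c * l + l)) = l ^ 3 * (Real.exp (-(2 * l)) * Real.exp (c * l + l)) by ring, ← Real.exp_add]
  ring_nf

theorem Acoef_one_ninth_aux :
    Filter.Tendsto
      (fun n : ℕ =>
        Acoef 1 9 n * ((Real.sqrt (8 * (n : ℝ) - 1) : ℝ) : ℂ) /
          (((4 * Real.sqrt 2 * Real.sin (Real.pi / 9) : ℝ) : ℂ) *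
            ((Real.cosh (5 * Real.pi * Real.sqrt (8 * (n : ℝ) - 1) / 36) : ℝ) : ℂ)))
      Filter.atTop (nhds 1) := by
  have hp := Real.pi_pos
  have ha : 0 < Real.sin (Real.pi / 9) := Real.sin_pos_of_pos_of_lt_pi (by positivity) (by linarith)
  have hs2 : 0 < Real.sqrt 2 := by positivity
  have hsp : 0 < Real.sqrt Real.pi := by positivity
  obtain ⟨C, L, hC, hL, herr⟩ := err
  set lf : ℕ → ℝ := fun n => 5 * Real.pi * Real.sqrt (8 * (n : ℝ) - 1) / 72 with hlf
  have hlim : Filter.Tendsto lf Filter.atTop Filter.atTop := by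
    have h1 : Filter.Tendsto (fun n : ℕ => 8 * (n : ℝ) - 1) Filter.atTop Filter.atTop :=
      Filter.tendsto_atTop_add_const_right _ _ (tendsto_natCast_atTop_atTop.const_mul_atTop (by norm_num))
    have h2 := (Real.tendsto_sqrt_atTop.comp h1).const_mul_atTop (show 0 < 5 * Real.pi / 72 by positivity)
    refine h2.congr fun n => ?_
    simp only [hlf, Function.comp]; ring
  -- the coefficient
  set K : ℝ → ℝ := fun l => 72 * l / (5 * Real.pi) / (2 * Real.pi * (4 * Real.sqrt 2 * Real.sin (Real.pi / 9) * Real.cosh (2 * l))) with hK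
  set M : ℝ → ℝ := fun l => 2 * Real.sqrt Real.pi * Real.sin (Real.pi / 9) * Real.sqrt BB / l * Real.exp (2 * l) with hM
  set K0 : ℝ := 72 / (5 * Real.pi) / (2 * Real.pi * (4 * Real.sqrt 2 * Real.sin (Real.pi / 9))) with hK0
  have hK0p : 0 < K0 := by positivity
  have hKb : ∀ l, 0 < l → |K l| ≤ 2 * K0 * (l * Real.exp (-(2 * l))) := by
    intro l hl
    have hc := Real.cosh_pos (2 * l)
    have h1 : K l = K0 * l * (Real.cosh (2 * l))⁻¹ := by
      simp only [hK, hK0]; field_simp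
    have h2 : (Real.cosh (2 * l))⁻¹ ≤ 2 * Real.exp (-(2 * l)) := by
      rw [Real.exp_neg, ← div_eq_mul_inv, inv_eq_one_div, div_le_div_iff₀ hc (Real.exp_pos _), Real.cosh_eq]
      linarith [Real.exp_pos (-(2 * l))]
    rw [h1, abs_of_pos (by positivity)]
    calc K0 * l * (Real.cosh (2 * l))⁻¹ ≤ K0 * l * (2 * Real.exp (-(2 * l))) := by gcongr
      _ = _ := by ring
  have hMK : ∀ l, 0 < l → M l * K l = 1 / (2 * Real.sqrt Real.pi) * (Real.exp (2 * l) / Real.cosh (2 * l)) := by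
    intro l hl
    have hc := Real.cosh_pos (2 * l)
    have h2 : Real.sqrt 2 ^ 2 = 2 := Real.sq_sqrt (by norm_num)
    have h3 : Real.sqrt Real.pi ^ 2 = Real.pi := Real.sq_sqrt hp.le
    simp only [hM, hK, sqrtBB]
    field_simp
    rw [h2, h3]; ring
  have hmain : Filter.Tendsto (fun l : ℝ => ((1 / (2 * Real.sqrt Real.pi) * (Real.exp (2 * l) / Real.cosh (2 * l)) : ℝ) : ℂ) * Qf l)
      Filter.atTop (nhds 1) := by
    have h1 := (expcosh_lim.const_mul (1 / (2 * Real.sqrt Real.pi)))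
    have h2 := ((Complex.continuous_ofReal.tendsto _).comp h1).mul Qf_lim
    have h3 : ((1 / (2 * Real.sqrt Real.pi) * 2 : ℝ) : ℂ) * ((Real.sqrt Real.pi : ℝ) : ℂ) = 1 := by
      rw [← Complex.ofReal_mul, ← Complex.ofReal_one]; congr 1; field_simp
    rw [h3] at h2
    exact h2
  have hev : ∀ᶠ n : ℕ in Filter.atTop, L ≤ lf n ∧ 1 ≤ n :=
    (hlim.eventually_ge_atTop L).and (Filter.eventually_ge_atTop 1)
  have hE : Filter.Tendsto (fun n : ℕ => (2 * Real.pi * Acoef 1 9 n - (M (lf n) : ℝ) * Qf (lf n)) * ((K (lf n) : ℝ) : ℂ))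
      Filter.atTop (nhds 0) := by
    refine squeeze_zero_norm' ?_ ((errterm_lim (C * (2 * K0))).comp hlim)
    filter_upwards [hev] with n hn
    have hn1 : (1 : ℝ) ≤ n := by exact_mod_cast hn.2
    have hl0 : 0 < lf n := lt_of_lt_of_le hL hn.1
    have hnn : (n : ℝ) = lf n ^ 2 / BB + 1 / 8 := by
      have : Real.sqrt (8 * (n : ℝ) - 1) ^ 2 = 8 * n - 1 := Real.sq_sqrt (by linarith)
      simp only [hlf, BB]
      rw [div_pow, mul_pow, this]
      field_simp
      ring
    have h1 := herr (lf n) hn.1 n hnn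
    have h2 := hKb (lf n) hl0
    rw [norm_mul, Complex.norm_real, Real.norm_eq_abs]
    calc _ ≤ (C * (Real.exp (lf n) + lf n ^ 2 * Real.exp ((3 / 8) / BB * lf n + lf n))) * (2 * K0 * (lf n * Real.exp (-(2 * lf n)))) := by
          refine mul_le_mul h1 h2 (abs_nonneg _) (by positivity)
      _ = _ := by simp only [Function.comp]; ring
  have hfin := hE.add (hmain.comp hlim)
  rw [zero_add] at hfin
  refine hfin.congr' ?_
  filter_upwards [hev] with n hn
  have hl0 : 0 < lf n := lt_of_lt_of_le hL hn.1
  have hs : Real.sqrt (8 * (n : ℝ) - 1) = 72 * lf n / (5 * Real.pi) := by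
    simp only [hlf]; field_simp
  have hc2 : 5 * Real.pi * Real.sqrt (8 * (n : ℝ) - 1) / 36 = 2 * lf n := by
    simp only [hlf]; ring
  rw [hc2, hs]
  simp only [Function.comp]
  rw [← hMK _ hl0]
  have hc := Real.cosh_pos (2 * lf n)
  have hKK : ((K (lf n) : ℝ) : ℂ) * (2 * Real.pi) = ((72 * lf n / (5 * Real.pi) : ℝ) : ℂ) / (((4 * Real.sqrt 2 * Real.sin (Real.pi / 9) : ℝ) : ℂ) * ((Real.cosh (2 * lf n) : ℝ) : ℂ)) := by
    have : K (lf n) * (2 * Real.pi) = (72 * lf n / (5 * Real.pi)) / ((4 * Real.sqrt 2 * Real.sin (Real.pi / 9)) * Real.cosh (2 * lf n)) := by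
      simp only [hK]; field_simp
    exact_mod_cast congrArg (fun x : ℝ => (x : ℂ)) this
  rw [mul_div_assoc, ← hKK, Complex.ofReal_mul (M (lf n)) (K (lf n))]
  generalize M (lf n) = m
  generalize K (lf n) = k
  ring
end Part13

theorem Acoef_one_ninth_asymptotic :
    Filter.Tendsto
      (fun n : ℕ =>
        Acoef 1 9 n * ((Real.sqrt (8 * (n : ℝ) - 1) : ℝ) : ℂ) /
          (((4 * Real.sqrt 2 * Real.sin (Real.pi / 9) : ℝ) : ℂ) *
            ((Real.cosh (5 * Real.pi * Real.sqrt (8 * (n : ℝ) - 1) / 36) : ℝ) : ℂ)))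
      Filter.atTop (nhds 1) := by
  exact Acoef_one_ninth_aux
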